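/- arXiv:1712.09855 — 5 statements merged into one kernel-verified Lean document; each statement's English description precedes it below -/
import Mathlib

section
/- For infinitely many values of n, there exists a bipartite IC-planar graph with n vertices and exactly 2.25n − 4 edges. -/
open Set

/-- A topological drawing of a simple graph in the plane: vertices are mapped to distinct
points, each edge to a Jordan arc (parametrized over `[0,1]`) connecting its endpoints;
no arc passes through a vertex other than its endpoints; two adjacent edges meet only at
their shared endpoint (i.e. adjacent edges do not cross); two independent edges meet in at
most one point (so no edge crosses another more than once). -/
structure Drawing {V : Type*} (G : SimpleGraph V) where
  vert : V → ℝ × ℝ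
  vert_inj : Function.Injective vert
  arc : G.edgeSet → ℝ → ℝ × ℝ
  arc_cont : ∀ e, ContinuousOn (arc e) (Set.Icc 0 1)
  arc_inj : ∀ e, Set.InjOn (arc e) (Set.Icc 0 1)
  arc_ends : ∀ (e : G.edgeSet) (u v : V), (e : Sym2 V) = s(u, v) →
      ({arc e 0, arc e 1} : Set (ℝ × ℝ)) = {vert u, vert v}
  arc_vertex : ∀ (e : G.edgeSet), ∀ t ∈ Set.Icc (0:ℝ) 1, ∀ w : V,
      arc e t = vert w → w ∈ (e : Sym2 V)
  adj_meet : ∀ e f : G.edgeSet, e ≠ f →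
      (∃ w : V, w ∈ (e : Sym2 V) ∧ w ∈ (f : Sym2 V)) →
      ∀ p ∈ arc e '' Set.Icc (0:ℝ) 1, p ∈ arc f '' Set.Icc (0:ℝ) 1 →
        ∃ w : V, w ∈ (e : Sym2 V) ∧ w ∈ (f : Sym2 V) ∧ p = vert w
  nonadj_meet : ∀ e f : G.edgeSet,
      (¬ ∃ w : V, w ∈ (e : Sym2 V) ∧ w ∈ (f : Sym2 V)) →
      ((arc e '' Set.Icc (0:ℝ) 1) ∩ (arc f '' Set.Icc (0:ℝ) 1)).Subsingleton

/-- The image (point set) of an edge in a drawing. -/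
def Drawing.img {V : Type*} {G : SimpleGraph V} (D : Drawing G) (e : G.edgeSet) :
    Set (ℝ × ℝ) :=
  D.arc e '' Set.Icc (0:ℝ) 1

/-- Two edges cross in a drawing if they are distinct and meet at a point that is not the
image of any vertex. -/
def Drawing.Crosses {V : Type*} {G : SimpleGraph V} (D : Drawing G) (e f : G.edgeSet) :
    Prop :=
  e ≠ f ∧ ∃ p ∈ D.img e ∩ D.img f, ∀ w : V, D.vert w ≠ p

/-- In the drawing `D`, every edge is crossed at most `k` times (any two edges cross at
most once, so this is the number of edges crossing it). -/
def Drawing.AtMostKCrossings {V : Type*} {G : SimpleGraph V} (D : Drawing G) (k : ℕ) :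
    Prop :=
  ∀ e : G.edgeSet, {f : G.edgeSet | D.Crosses e f}.ncard ≤ k

/-- A graph is bipartite: its vertices can be split in two parts such that every edge
joins the two parts. -/
def IsBipartite {V : Type*} (G : SimpleGraph V) : Prop :=
  ∃ c : V → Bool, ∀ u v : V, G.Adj u v → c u ≠ c v

/-- A graph is IC-planar if it admits a drawing in which every edge is crossed at most
once and no two crossed edges share an endpoint (crossings are independent). -/
def IsICPlanar {V : Type*} (G : SimpleGraph V) : Prop :=
  ∃ D : Drawing G, D.AtMostKCrossings 1 ∧
    ∀ e f : G.edgeSet, (∃ g, D.Crosses e g) → (∃ g, D.Crosses f g) → e ≠ f →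
      ∀ w : V, w ∈ (e : Sym2 V) → w ∉ (f : Sym2 V)

namespace ICB

/-- Polar map: angle measured in quarter turns. -/
noncomputable def P (θ r : ℝ) : ℝ × ℝ :=
  (r * Real.cos (Real.pi / 2 * θ), r * Real.sin (Real.pi / 2 * θ))

lemma P_eq {θ r θ' r' : ℝ} (hr : 0 < r) (hr' : 0 < r') (h : P θ r = P θ' r') :
    r = r' ∧ ∃ k : ℤ, θ = θ' + 4 * k := by
  simp only [P, Prod.mk.injEq] at h
  obtain ⟨h1, h2⟩ := h
  have hrr : r = r' := by
    have e1 := Real.cos_sq_add_sin_sq (Real.pi / 2 * θ)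
    have e2 := Real.cos_sq_add_sin_sq (Real.pi / 2 * θ')
    have : r ^ 2 = r' ^ 2 := by
      calc r ^ 2 = (r * Real.cos (Real.pi / 2 * θ)) ^ 2 + (r * Real.sin (Real.pi / 2 * θ)) ^ 2 := by
            rw [mul_pow, mul_pow, ← mul_add, e1, mul_one]
        _ = r' ^ 2 := by
            rw [h1, h2, mul_pow, mul_pow, ← mul_add, e2, mul_one]
    exact (pow_left_inj₀ hr.le hr'.le two_ne_zero).1 this
  subst hrr
  refine ⟨rfl, ?_⟩
  have hc := mul_left_cancel₀ hr.ne' h1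
  have hs := mul_left_cancel₀ hr.ne' h2
  have := Real.Angle.cos_sin_inj hc hs
  rw [Real.Angle.angle_eq_iff_two_pi_dvd_sub] at this
  obtain ⟨k, hk⟩ := this
  refine ⟨k, ?_⟩
  have hp := Real.pi_pos
  have : Real.pi / 2 * (θ - θ' - 4 * k) = 0 := by linarith
  rcases mul_eq_zero.1 this with h | h
  · linarith
  · linarith

@[ext] structure Ed where
  i : ℕ
  j : ℕ
  a : ℕ
  b : ℕ

/-- The three kinds of edges: ring edges, radial edges, and chords. -/
def Ed.Valid (e : Ed) : Prop :=
  e.i < 4 ∧ ((e.a = 1 ∧ e.b = 0) ∨ (e.a = 0 ∧ e.b = 1) ∨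
    (e.a = 2 ∧ e.b = 1 ∧ e.i % 2 = 0 ∧ e.j % 2 = 0))

def Ed.src (e : Ed) : ℕ := 4 * e.j + e.i
def Ed.tgt (e : Ed) : ℕ := 4 * (e.j + e.b) + (e.i + e.a) % 4

noncomputable def Ed.arc (e : Ed) (t : ℝ) : ℝ × ℝ := P (e.i + e.a * t) (e.j + 1 + e.b * t)

noncomputable def vt (v : ℕ) : ℝ × ℝ := P ((v % 4 : ℕ) : ℝ) ((v / 4 : ℕ) + 1)

/-- chord `e` crosses radial edge `f` -/
def CP (e f : Ed) : Prop :=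
  e.a = 2 ∧ f.a = 0 ∧ f.j = e.j ∧ f.i = e.i + 1

lemma int01 {z : ℤ} {t : ℝ} (h : t = z) (ht : t ∈ Icc (0:ℝ) 1) : t = 0 ∨ t = 1 := by
  subst h
  have h1 : (0:ℤ) ≤ z := by exact_mod_cast ht.1
  have h2 : z ≤ 1 := by exact_mod_cast ht.2
  have : z = 0 ∨ z = 1 := by omega
  rcases this with rfl | rfl <;> simp

lemma intdiff {z : ℤ} {t s : ℝ} (h : t - s = z) (ht : t ∈ Icc (0:ℝ) 1) (hs : s ∈ Icc (0:ℝ) 1) :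
    z = 0 ∨ (t = 0 ∨ t = 1) ∧ (s = 0 ∨ s = 1) := by
  obtain ⟨t0, t1⟩ := ht
  obtain ⟨s0, s1⟩ := hs
  have h1 : (-1:ℤ) ≤ z := by
    have : (-1:ℝ) ≤ z := by linarith
    exact_mod_cast this
  have h2 : z ≤ 1 := by
    have : (z:ℝ) ≤ 1 := by linarith
    exact_mod_cast this
  have : z = 0 ∨ z = 1 ∨ z = -1 := by omega
  rcases this with rfl | rfl | rfl
  · left; rfl
  · push_cast at h; right; exact ⟨.inr (by linarith), .inl (by linarith)⟩
  · push_cast at h; right; exact ⟨.inl (by linarith), .inr (by linarith)⟩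

lemma arc_pos (e : Ed) {t : ℝ} (ht : t ∈ Icc (0:ℝ) 1) : (0:ℝ) < e.j + 1 + e.b * t := by
  have := mul_nonneg (Nat.cast_nonneg (α := ℝ) e.b) ht.1
  positivity

/-- Main geometric lemma. -/
lemma meet {e f : Ed} (he : e.Valid) (hf : f.Valid) (hne : e ≠ f) {t s : ℝ}
    (ht : t ∈ Icc (0:ℝ) 1) (hs : s ∈ Icc (0:ℝ) 1) (h : e.arc t = f.arc s) :
    ((t = 0 ∨ t = 1) ∧ (s = 0 ∨ s = 1)) ∨ (t = 1/2 ∧ s = 1/2 ∧ (CP e f ∨ CP f e)) := by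
  obtain ⟨hr, k, hk⟩ := P_eq (arc_pos e ht) (arc_pos f hs) h
  clear h
  obtain ⟨i, j, a, b⟩ := e
  obtain ⟨i', j', a', b'⟩ := f
  simp only [Ed.Valid, ne_eq, Ed.mk.injEq, CP] at *
  obtain ⟨hi, he⟩ := he
  obtain ⟨hi', hf⟩ := hf
  rcases he with ⟨rfl, rfl⟩ | ⟨rfl, rfl⟩ | ⟨rfl, rfl, hi2, hj2⟩ <;>
  rcases hf with ⟨rfl, rfl⟩ | ⟨rfl, rfl⟩ | ⟨rfl, rfl, hi2', hj2'⟩ <;>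
  push_cast at hr hk
  · -- HH
    have h1 : j = j' := by
      have : (j:ℝ) = j' := by linarith
      exact_mod_cast this
    rcases intdiff (z := i' - i + 4 * k) (by push_cast; linarith) ht hs with h | h
    · omega
    · exact .inl h
  · -- HR
    exact .inl ⟨int01 (z := i' - i + 4 * k) (by push_cast; linarith) ht,
      int01 (z := j - j') (by push_cast; linarith) hs⟩
  · -- HC
    exact .inl ⟨int01 (z := i' - i + 4 * k + 2 * (j - j')) (by push_cast; linarith) ht,
      int01 (z := j - j') (by push_cast; linarith) hs⟩
  · exact .inl ⟨int01 (z := j' - j) (by push_cast; linarith) ht,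
      int01 (z := i - i' - 4 * k) (by push_cast; linarith) hs⟩
  · have h1 : (i:ℤ) = i' + 4 * k := by
      have : (i:ℝ) = i' + 4 * k := by linarith
      exact_mod_cast this
    rcases intdiff (z := j' - j) (by push_cast; linarith) ht hs with h | h
    · omega
    · exact .inl h
  · -- RC
    have h2 : 2 * s = ((i - i' - 4 * k : ℤ) : ℝ) := by push_cast; linarith
    have b0 : (0:ℤ) ≤ i - i' - 4 * k := by
      have : (0:ℝ) ≤ ((i - i' - 4 * k : ℤ) : ℝ) := by linarith [hs.1]
      exact_mod_cast this
    have b1 : (i:ℤ) - i' - 4 * k ≤ 2 := by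
      have : ((i - i' - 4 * k : ℤ) : ℝ) ≤ 2 := by linarith [hs.2]
      exact_mod_cast this
    rcases (by omega : (i:ℤ) - i' - 4 * k = 0 ∨ (i:ℤ) - i' - 4 * k = 1 ∨ (i:ℤ) - i' - 4 * k = 2)
      with h | h | h <;> rw [h] at h2 <;> push_cast at h2
    · exact .inl ⟨int01 (z := j' - j) (by push_cast; linarith) ht, .inl (by linarith)⟩
    · right
      rcases intdiff (z := j' - j) (by push_cast; linarith) ht hs with h' | h'
      · have h3 : j = j' := by omega
        subst h3
        refine ⟨by linarith, by linarith, .inr ⟨rfl, rfl, rfl, by omega⟩⟩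
      · exfalso
        rcases h'.2 with h' | h' <;> linarith
    · exact .inl ⟨int01 (z := j' - j + 1) (by push_cast; linarith) ht, .inr (by linarith)⟩
  · exact .inl ⟨int01 (z := j' - j) (by push_cast; linarith) ht,
      int01 (z := i - i' - 4 * k + 2 * (j' - j)) (by push_cast; linarith) hs⟩
  · -- CR
    have h2 : 2 * t = ((i' - i + 4 * k : ℤ) : ℝ) := by push_cast; linarith
    have b0 : (0:ℤ) ≤ i' - i + 4 * k := by
      have : (0:ℝ) ≤ ((i' - i + 4 * k : ℤ) : ℝ) := by linarith [ht.1]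
      exact_mod_cast this
    have b1 : (i':ℤ) - i + 4 * k ≤ 2 := by
      have : ((i' - i + 4 * k : ℤ) : ℝ) ≤ 2 := by linarith [ht.2]
      exact_mod_cast this
    rcases (by omega : (i':ℤ) - i + 4 * k = 0 ∨ (i':ℤ) - i + 4 * k = 1 ∨ (i':ℤ) - i + 4 * k = 2)
      with h | h | h <;> rw [h] at h2 <;> push_cast at h2
    · exact .inl ⟨.inl (by linarith), int01 (z := j - j') (by push_cast; linarith) hs⟩
    · right
      rcases intdiff (z := j' - j) (by push_cast; linarith) ht hs with h' | h'
      · have h3 : j = j' := by omega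
        subst h3
        refine ⟨by linarith, by linarith, .inl ⟨rfl, rfl, rfl, by omega⟩⟩
      · exfalso
        rcases h'.1 with h' | h' <;> linarith
    · exact .inl ⟨.inr (by linarith), int01 (z := j - j' + 1) (by push_cast; linarith) hs⟩
  · -- CC
    have h1 : (i:ℤ) + 2 * (j' - j) = i' + 4 * k := by
      have : (i:ℝ) + 2 * (j' - j) = i' + 4 * k := by linarith
      exact_mod_cast this
    rcases intdiff (z := j' - j) (by push_cast; linarith) ht hs with h | h
    · omega
    · exact .inl h

lemma arc_zero {e : Ed} (he : e.Valid) : e.arc 0 = vt e.src := by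
  obtain ⟨hi, -⟩ := he
  have h1 : e.src % 4 = e.i := by unfold Ed.src; omega
  have h2 : e.src / 4 = e.j := by unfold Ed.src; omega
  simp [Ed.arc, vt, h1, h2]

lemma P_add (θ r : ℝ) : P (θ + 4) r = P θ r := by
  have : Real.pi / 2 * (θ + 4) = Real.pi / 2 * θ + 2 * Real.pi := by ring
  simp [P, this]

lemma arc_one {e : Ed} (he : e.Valid) : e.arc 1 = vt e.tgt := by
  obtain ⟨hi, hh⟩ := he
  have h1 : e.tgt % 4 = (e.i + e.a) % 4 := by unfold Ed.tgt; omega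
  have h2 : e.tgt / 4 = e.j + e.b := by unfold Ed.tgt; omega
  have ha : e.a ≤ 2 := by omega
  have h3 : ((e.i : ℝ) + e.a = ((e.i + e.a) % 4 : ℕ)) ∨
      ((e.i : ℝ) + e.a = ((e.i + e.a) % 4 : ℕ) + 4) := by
    have : (e.i + e.a = (e.i + e.a) % 4) ∨ (e.i + e.a = (e.i + e.a) % 4 + 4) := by omega
    exact_mod_cast this
  have h4 : (e.j : ℝ) + 1 + e.b = e.j + e.b + 1 := by ring
  simp only [Ed.arc, vt, h1, h2, mul_one, h4]
  push_cast only [Nat.cast_add]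
  rcases h3 with h3 | h3 <;> rw [h3]
  rw [P_add]

lemma vt_inj {v w : ℕ} (h : vt v = vt w) : v = w := by
  obtain ⟨hr, k, hk⟩ := P_eq (by positivity) (by positivity) h
  have h1 : v / 4 = w / 4 := by
    have : ((v / 4 : ℕ) : ℝ) = (w / 4 : ℕ) := by linarith
    exact_mod_cast this
  have h2 : ((v % 4 : ℕ) : ℤ) = (w % 4 : ℕ) + 4 * k := by
    have : (((v % 4 : ℕ) : ℤ) : ℝ) = (((w % 4 : ℕ) + 4 * k : ℤ) : ℝ) := by
      rw [Int.cast_add, Int.cast_mul, Int.cast_natCast, Int.cast_natCast, hk]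
      norm_num
    exact_mod_cast this
  omega

lemma arc_vt {e : Ed} (he : e.Valid) {t : ℝ} (ht : t ∈ Icc (0:ℝ) 1) {w : ℕ}
    (h : e.arc t = vt w) : w = e.src ∨ w = e.tgt := by
  have key : t = 0 ∨ t = 1 := by
    obtain ⟨hr, k, hk⟩ := P_eq (arc_pos e ht) (by positivity) h
    generalize w / 4 = y at *
    generalize w % 4 = x at *
    obtain ⟨hi, he⟩ := he
    rcases he with ⟨h1, h2⟩ | ⟨h1, h2⟩ | ⟨h1, h2, -⟩ <;> rw [h1] at hk <;> rw [h2] at hr <;>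
      push_cast at hr hk
    · exact int01 (z := x + 4 * k - e.i) (by push_cast; linarith) ht
    · exact int01 (z := y - e.j) (by push_cast; linarith) ht
    · exact int01 (z := y - e.j) (by push_cast; linarith) ht
  rcases key with rfl | rfl
  · left; rw [arc_zero he] at h; exact (vt_inj h).symm
  · right; rw [arc_one he] at h; exact (vt_inj h).symm

lemma arc_injOn {e : Ed} (he : e.Valid) : InjOn e.arc (Icc 0 1) := by
  intro t ht s hs h
  obtain ⟨hr, k, hk⟩ := P_eq (arc_pos e ht) (arc_pos e hs) h
  obtain ⟨hi, he⟩ := he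
  rcases he with ⟨h1, h2⟩ | ⟨h1, h2⟩ | ⟨h1, h2, -⟩ <;> rw [h1] at hk <;> rw [h2] at hr <;>
      push_cast at hr hk
  · have h1 : (-1:ℝ) ≤ 4 * k := by linarith [ht.1, ht.2, hs.1, hs.2]
    have h2 : 4 * k ≤ (1:ℝ) := by linarith [ht.1, ht.2, hs.1, hs.2]
    have h1' : (-1:ℤ) ≤ 4 * k := by exact_mod_cast h1
    have h2' : 4 * k ≤ (1:ℤ) := by exact_mod_cast h2
    have : k = 0 := by omega
    subst this
    push_cast at hk
    linarith
  · linarith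
  · linarith

lemma arc_continuous (e : Ed) : Continuous e.arc := by
  unfold Ed.arc P
  fun_prop

/-- The endpoints determine the edge. -/
lemma ed_ext {e f : Ed} (he : e.Valid) (hf : f.Valid)
    (h : (e.src = f.src ∧ e.tgt = f.tgt) ∨ (e.src = f.tgt ∧ e.tgt = f.src)) : e = f := by
  obtain ⟨i, j, a, b⟩ := e
  obtain ⟨i', j', a', b'⟩ := f
  simp only [Ed.Valid, Ed.src, Ed.tgt, Ed.mk.injEq] at *
  obtain ⟨hi, he⟩ := he
  obtain ⟨hi', hf⟩ := hf
  rcases he with ⟨rfl, rfl⟩ | ⟨rfl, rfl⟩ | ⟨rfl, rfl, hi2, hj2⟩ <;>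
  rcases hf with ⟨rfl, rfl⟩ | ⟨rfl, rfl⟩ | ⟨rfl, rfl, hi2', hj2'⟩ <;> omega

def Inc (w : ℕ) (e : Ed) : Prop := w = e.src ∨ w = e.tgt

/-- Each vertex lies on at most one crossed edge. -/
lemma cp_indep {e f g h : Ed} (he : e.Valid) (hf : f.Valid) (hg : g.Valid) (hh : h.Valid)
    (h1 : CP e g ∨ CP g e) (h2 : CP f h ∨ CP h f) {w : ℕ} (hwe : Inc w e) (hwf : Inc w f) :
    e = f := by
  have aux : ∀ {e g : Ed}, e.Valid → g.Valid → (CP e g ∨ CP g e) →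
      (e.a = 2 ∧ e.b = 1 ∧ e.i % 2 = 0 ∧ e.j % 2 = 0) ∨
      (e.a = 0 ∧ e.b = 1 ∧ e.i % 2 = 1 ∧ e.j % 2 = 0) := by
    intro e g he hg h
    unfold CP at h
    unfold Ed.Valid at he hg
    omega
  replace h1 := aux he hg h1
  replace h2 := aux hf hh h2
  have hi := he.1
  have hi' := hf.1
  clear aux he hf hg hh g h
  obtain ⟨i, j, a, b⟩ := e
  obtain ⟨i', j', a', b'⟩ := f
  simp only [Inc, Ed.src, Ed.tgt, Ed.mk.injEq] at *
  rcases h1 with ⟨rfl, rfl, h1, h3⟩ | ⟨rfl, rfl, h1, h3⟩ <;>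
  rcases h2 with ⟨rfl, rfl, h2, h4⟩ | ⟨rfl, rfl, h2, h4⟩ <;>
  rcases hwe with hwe | hwe <;> rcases hwf with hwf | hwf <;> omega

lemma cp_unique {e f g : Ed} (hf : f.Valid) (hg : g.Valid)
    (h1 : CP e f ∨ CP f e) (h2 : CP e g ∨ CP g e) : f = g := by
  obtain ⟨i, j, a, b⟩ := f
  obtain ⟨i', j', a', b'⟩ := g
  simp only [CP, Ed.Valid, Ed.mk.injEq] at *
  omega

lemma cp_not_adj {e f : Ed} (he : e.Valid) (hf : f.Valid)
    (h : CP e f ∨ CP f e) {w : ℕ} (h1 : Inc w e) (h2 : Inc w f) : False := by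
  have := cp_indep he hf hf he h h.symm h1 h2
  subst this
  unfold CP at h
  omega

/-- Edge index type. -/
abbrev E (m : ℕ) := Fin (8 * m + 8) ⊕ Fin (8 * m + 4) ⊕ Fin (2 * m + 2)

def ed {m : ℕ} : E m → Ed
  | .inl v => ⟨v % 4, v / 4, 1, 0⟩
  | .inr (.inl v) => ⟨v % 4, v / 4, 0, 1⟩
  | .inr (.inr c) => ⟨2 * (c % 2), 2 * (c / 2), 2, 1⟩

lemma ed_valid {m : ℕ} (x : E m) : (ed x).Valid := by
  rcases x with v | v | c <;> simp [ed, Ed.Valid] <;> omega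

lemma ed_inj {m : ℕ} : Function.Injective (ed (m := m)) := by
  rintro (v | v | c) (v' | v' | c') h <;> simp only [ed, Ed.mk.injEq, and_true] at h <;>
    first
    | (exfalso; omega)
    | (simp only [Sum.inl.injEq, Sum.inr.injEq, Fin.ext_iff]; omega)

lemma src_lt {m : ℕ} (x : E m) : (ed x).src < 8 * m + 8 := by
  rcases x with v | v | c <;> simp only [ed, Ed.src] <;> omega

lemma tgt_lt {m : ℕ} (x : E m) : (ed x).tgt < 8 * m + 8 := by
  rcases x with v | v | c <;> simp only [ed, Ed.tgt] <;> omega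

def sy {m : ℕ} (x : E m) : Sym2 (Fin (8 * m + 8)) :=
  s(⟨(ed x).src, src_lt x⟩, ⟨(ed x).tgt, tgt_lt x⟩)

lemma mem_sy {m : ℕ} (x : E m) (w : Fin (8 * m + 8)) : w ∈ sy x ↔ Inc w (ed x) := by
  simp [sy, Inc, Fin.ext_iff]

lemma sy_inj {m : ℕ} : Function.Injective (sy (m := m)) := by
  intro x y h
  apply ed_inj
  apply ed_ext (ed_valid x) (ed_valid y)
  simpa [sy, Fin.ext_iff] using h

lemma color {e : Ed} (he : e.Valid) :
    (e.src % 4 + e.src / 4) % 2 ≠ (e.tgt % 4 + e.tgt / 4) % 2 := by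
  unfold Ed.Valid at he
  unfold Ed.src Ed.tgt
  omega

def G (m : ℕ) : SimpleGraph (Fin (8 * m + 8)) := SimpleGraph.fromEdgeSet (range sy)

lemma edgeSet_G (m : ℕ) : (G m).edgeSet = range sy := by
  rw [G, SimpleGraph.edgeSet_fromEdgeSet, sdiff_eq_left]
  rw [Set.disjoint_left]
  rintro _ ⟨x, rfl⟩ h
  have h' : (ed x).src = (ed x).tgt := by
    simpa [sy] using h
  exact color (ed_valid x) (by rw [h'])

lemma ex_ix {m : ℕ} (e : (G m).edgeSet) : ∃ x : E m, sy x = e := by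
  obtain ⟨e, h⟩ := e
  have h' := h
  rw [edgeSet_G] at h'
  exact h'

noncomputable def ix {m : ℕ} (e : (G m).edgeSet) : E m :=
  Classical.choose (ex_ix e)

lemma sy_ix {m : ℕ} (e : (G m).edgeSet) : sy (ix e) = e :=
  Classical.choose_spec (ex_ix e)

lemma ix_inj {m : ℕ} {e f : (G m).edgeSet} (h : ed (ix e) = ed (ix f)) : e = f := by
  have := ed_inj h
  apply Subtype.ext
  rw [← sy_ix e, ← sy_ix f, this]

lemma mem_e {m : ℕ} (e : (G m).edgeSet) (w : Fin (8 * m + 8)) :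
    w ∈ (e : Sym2 _) ↔ Inc w (ed (ix e)) := by
  rw [← mem_sy, sy_ix]

lemma end_vt {m : ℕ} (x : E m) {t : ℝ} (h : t = 0 ∨ t = 1) :
    ∃ w : Fin (8 * m + 8), Inc w (ed x) ∧ (ed x).arc t = vt w := by
  rcases h with rfl | rfl
  · exact ⟨⟨_, src_lt x⟩, .inl rfl, arc_zero (ed_valid x)⟩
  · exact ⟨⟨_, tgt_lt x⟩, .inr rfl, arc_one (ed_valid x)⟩

/-- Two arcs meet in a common vertex or in a crossing. -/
lemma meet' {m : ℕ} {x y : E m} (hne : ed x ≠ ed y) {t s : ℝ}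
    (ht : t ∈ Icc (0:ℝ) 1) (hs : s ∈ Icc (0:ℝ) 1) (h : (ed x).arc t = (ed y).arc s) :
    (∃ w : Fin (8 * m + 8), Inc w (ed x) ∧ Inc w (ed y) ∧ (ed x).arc t = vt w) ∨
    (t = 1/2 ∧ (CP (ed x) (ed y) ∨ CP (ed y) (ed x))) := by
  rcases meet (ed_valid x) (ed_valid y) hne ht hs h with ⟨h1, h2⟩ | ⟨h1, h2, h3⟩
  · obtain ⟨w, hw, e1⟩ := end_vt x h1
    obtain ⟨w', hw', e2⟩ := end_vt y h2
    have : (w : ℕ) = w' := vt_inj (by rw [← e1, ← e2, h])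
    exact .inl ⟨w, hw, this ▸ hw', e1⟩
  · exact .inr ⟨h1, h3⟩

noncomputable def D (m : ℕ) : Drawing (G m) where
  vert v := vt v
  vert_inj := fun v w h => Fin.ext (vt_inj h)
  arc e := (ed (ix e)).arc
  arc_cont e := (arc_continuous _).continuousOn
  arc_inj e := arc_injOn (ed_valid _)
  arc_ends := by
    intro e u v h
    rw [arc_zero (ed_valid _), arc_one (ed_valid _)]
    rw [← sy_ix e, sy, Sym2.eq_iff] at h
    rcases h with ⟨rfl, rfl⟩ | ⟨rfl, rfl⟩
    · rfl
    · exact Set.pair_comm _ _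
  arc_vertex := by
    intro e t ht w h
    rw [mem_e]
    exact arc_vt (ed_valid _) ht h
  adj_meet := by
    rintro e f hne ⟨w, hwe, hwf⟩ p ⟨t, ht, rfl⟩ ⟨s, hs, h⟩
    rw [mem_e] at hwe hwf
    rcases meet' (fun h => hne (ix_inj h)) ht hs h.symm with ⟨w, h1, h2, h3⟩ | ⟨-, h2⟩
    · exact ⟨w, (mem_e _ _).2 h1, (mem_e _ _).2 h2, h3⟩
    · exact (cp_not_adj (ed_valid _) (ed_valid _) h2 hwe hwf).elim
  nonadj_meet := by
    rintro e f hna p ⟨⟨t, ht, rfl⟩, ⟨s, hs, h⟩⟩ q ⟨⟨t', ht', rfl⟩, ⟨s', hs', h'⟩⟩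
    have hne : ed (ix e) ≠ ed (ix f) := by
      intro h
      have := ix_inj h
      subst this
      exact hna ⟨_, (mem_e _ ⟨_, src_lt (ix e)⟩).2 (.inl rfl), (mem_e _ _).2 (.inl rfl)⟩
    rcases meet' hne ht hs h.symm with ⟨w, h1, h2, h3⟩ | ⟨h1, -⟩
    · exact (hna ⟨w, (mem_e _ _).2 h1, (mem_e _ _).2 h2⟩).elim
    rcases meet' hne ht' hs' h'.symm with ⟨w, h1, h2, h3⟩ | ⟨h2, -⟩
    · exact (hna ⟨w, (mem_e _ _).2 h1, (mem_e _ _).2 h2⟩).elim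
    rw [h1, h2]

lemma cp_of_crosses {m : ℕ} {e f : (G m).edgeSet} (h : (D m).Crosses e f) :
    CP (ed (ix e)) (ed (ix f)) ∨ CP (ed (ix f)) (ed (ix e)) := by
  obtain ⟨hne, p, ⟨⟨t, ht, rfl⟩, ⟨s, hs, h⟩⟩, hp⟩ := h
  rcases meet' (fun h => hne (ix_inj h)) ht hs h.symm with ⟨w, h1, h2, h3⟩ | ⟨-, h2⟩
  · exact (hp w h3.symm).elim
  · exact h2

end ICB

/-- For infinitely many values of `n`, there exists a bipartite
IC-planar graph with `n` vertices and exactly `2.25 n - 4` edges. -/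
theorem bipartite_icplanar_density_lower_bound :
    ∀ N : ℕ, ∃ n : ℕ, N ≤ n ∧ ∃ G : SimpleGraph (Fin n),
      IsBipartite G ∧ IsICPlanar G ∧
      (G.edgeSet.ncard : ℝ) = 2.25 * n - 4 := by
  intro m
  refine ⟨8 * m + 8, by omega, ICB.G m, ?_, ⟨ICB.D m, ?_, ?_⟩, ?_⟩
  · refine ⟨fun v => decide (((v : ℕ) % 4 + (v : ℕ) / 4) % 2 = 0), ?_⟩
    intro u v h
    have h' : s(u, v) ∈ (ICB.G m).edgeSet := h
    rw [ICB.edgeSet_G] at h'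
    obtain ⟨x, hx⟩ := h'
    have hc := ICB.color (ICB.ed_valid x)
    rw [ICB.sy, Sym2.eq_iff] at hx
    have : ((u : ℕ) % 4 + (u : ℕ) / 4) % 2 ≠ ((v : ℕ) % 4 + (v : ℕ) / 4) % 2 := by
      rcases hx with ⟨rfl, rfl⟩ | ⟨rfl, rfl⟩
      · exact hc
      · exact hc.symm
    simp only [ne_eq, decide_eq_decide]
    omega
  · intro e
    rw [Set.ncard_le_one (Set.toFinite _)]
    intro f hf g hg
    exact ICB.ix_inj (ICB.cp_unique (ICB.ed_valid _) (ICB.ed_valid _)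
      (ICB.cp_of_crosses hf) (ICB.cp_of_crosses hg))
  · rintro e f ⟨g, hg⟩ ⟨h, hh⟩ hne w hwe hwf
    rw [ICB.mem_e] at hwe hwf
    exact hne (ICB.ix_inj (ICB.cp_indep (ICB.ed_valid _) (ICB.ed_valid _) (ICB.ed_valid _)
      (ICB.ed_valid _) (ICB.cp_of_crosses hg) (ICB.cp_of_crosses hh) hwe hwf))
  · rw [ICB.edgeSet_G, ← Set.image_univ, Set.ncard_image_of_injective _ ICB.sy_inj,
      Set.ncard_univ, Nat.card_eq_fintype_card]
    simp only [ICB.E, Fintype.card_sum, Fintype.card_fin]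
    push_cast
    ring
end

section
/- For infinitely many values of n, there exists a bipartite NIC-planar graph with n vertices and exactly 2.5n − 5 edges. -/
open Set

/-- A graph is NIC-planar if it admits a drawing in which every edge is crossed at most
once and no two distinct pairs of crossing edges share two endpoints. -/
def IsNICPlanar {V : Type*} (G : SimpleGraph V) : Prop :=
  ∃ D : Drawing G, D.AtMostKCrossings 1 ∧
    ∀ e f e' f' : G.edgeSet, D.Crosses e f → D.Crosses e' f' →
      ({e, f} : Set G.edgeSet) ≠ {e', f'} →
      {w : V | (w ∈ (e : Sym2 V) ∨ w ∈ (f : Sym2 V)) ∧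
               (w ∈ (e' : Sym2 V) ∨ w ∈ (f' : Sym2 V))}.ncard ≤ 1

/-- The cylinder chart: `(x, y)` with `x` modulo `6` is mapped injectively to the plane. -/
noncomputable def nicPhi (x y : ℝ) : ℝ × ℝ :=
  (Real.exp y * Real.cos (Real.pi / 3 * x), Real.exp y * Real.sin (Real.pi / 3 * x))

theorem nicPhi_eq {x y x' y' : ℝ} (h : nicPhi x y = nicPhi x' y') :
    y = y' ∧ ∃ m : ℤ, x = x' + 6 * m := by
  have hc : Complex.exp ⟨y, Real.pi / 3 * x⟩ = Complex.exp ⟨y', Real.pi / 3 * x'⟩ := by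
    apply Complex.ext
    · rw [Complex.exp_re, Complex.exp_re]
      exact congrArg Prod.fst h
    · rw [Complex.exp_im, Complex.exp_im]
      exact congrArg Prod.snd h
  rw [Complex.exp_eq_exp_iff_exists_int] at hc
  obtain ⟨m, hm⟩ := hc
  have h1 := congrArg Complex.re hm
  have h2 := congrArg Complex.im hm
  simp at h1 h2
  refine ⟨h1, m, ?_⟩
  have hp := Real.pi_pos
  have : Real.pi * (x - (x' + 6 * m)) = 0 := by linarith
  rcases mul_eq_zero.1 this with h | h
  · exact absurd h hp.ne'
  · linarith

theorem nicPhi_period (x y : ℝ) (m : ℤ) : nicPhi (x + 6 * m) y = nicPhi x y := by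
  unfold nicPhi
  have : Real.pi / 3 * (x + 6 * m) = Real.pi / 3 * x + m * (2 * Real.pi) := by ring
  rw [this, Real.cos_add_int_mul_two_pi, Real.sin_add_int_mul_two_pi]

theorem nicPhi_mod (x l : ℕ) : nicPhi ((x % 6 : ℕ) : ℝ) l = nicPhi x l := by
  have h : (x : ℝ) = ((x % 6 : ℕ) : ℝ) + 6 * ((x / 6 : ℕ) : ℤ) := by
    have h2 : x = x % 6 + 6 * (x / 6) := (Nat.mod_add_div x 6).symm
    have h3 : (x : ℝ) = ((x % 6 + 6 * (x / 6) : ℕ) : ℝ) := congrArg Nat.cast h2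
    rw [Nat.cast_add, Nat.cast_mul] at h3
    simpa only [Int.cast_natCast, Nat.cast_ofNat] using h3
  conv_rhs => rw [h]
  rw [nicPhi_period]

/-- Abstract criterion: a family of arcs whose interiors meet only in designated mates. -/
theorem nic_framework {V ι : Type} [Fintype ι] (a b : ι → V)
    (hinj : Function.Injective (fun e => s(a e, b e)))
    (col : V → Bool) (hcol : ∀ e, col (a e) ≠ col (b e))
    (vert : V → ℝ × ℝ) (hvert : Function.Injective vert)
    (P : ι → ℝ → ℝ × ℝ) (hcont : ∀ e, Continuous (P e))
    (hPinj : ∀ e, Set.InjOn (P e) (Set.Icc 0 1))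
    (h0 : ∀ e, P e 0 = vert (a e)) (h1 : ∀ e, P e 1 = vert (b e))
    (hv : ∀ e t w, 0 < t → t < 1 → P e t ≠ vert w)
    (mate : ι → ι) (τ : ι → ℝ)
    (hcr : ∀ e f s t, e ≠ f → 0 < s → s < 1 → 0 < t → t < 1 → P e s = P f t →
      f = mate e ∧ s = τ e)
    (hdis : ∀ e, mate e ≠ e → ∀ w, ¬ (w ∈ s(a e, b e) ∧ w ∈ s(a (mate e), b (mate e))))
    (hnic : ∀ e e', mate e ≠ e → mate e' ≠ e' → e' ≠ e → e' ≠ mate e → ∀ w w',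
      (w ∈ s(a e, b e) ∨ w ∈ s(a (mate e), b (mate e))) →
      (w ∈ s(a e', b e') ∨ w ∈ s(a (mate e'), b (mate e'))) →
      (w' ∈ s(a e, b e) ∨ w' ∈ s(a (mate e), b (mate e))) →
      (w' ∈ s(a e', b e') ∨ w' ∈ s(a (mate e'), b (mate e'))) → w = w') :
    ∃ G : SimpleGraph V, IsBipartite G ∧ IsNICPlanar G ∧
      G.edgeSet.ncard = Fintype.card ι := by
  classical
  let G : SimpleGraph V := SimpleGraph.fromEdgeSet (Set.range (fun e => s(a e, b e)))
  have hES : G.edgeSet = Set.range (fun e => s(a e, b e)) := by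
    simp only [G, SimpleGraph.edgeSet_fromEdgeSet]
    ext x
    simp only [Set.mem_sdiff, Set.mem_range]
    constructor
    · exact fun h => h.1
    · rintro ⟨e, rfl⟩
      refine ⟨⟨e, rfl⟩, ?_⟩
      intro h
      have h' : a e = b e := by simpa using h
      exact hcol e (by rw [h'])
  have hex : ∀ e : G.edgeSet, ∃ i : ι, s(a i, b i) = (e : Sym2 V) := by
    intro e
    have h : (e : Sym2 V) ∈ Set.range (fun e => s(a e, b e)) := hES ▸ e.2
    exact h
  choose ix hix using hex
  have ixinj : ∀ e f, ix e = ix f → e = f := by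
    intro e f h
    apply Subtype.ext
    rw [← hix e, ← hix f, h]
  -- points of arcs at vertices
  have hend : ∀ i t, 0 ≤ t → t ≤ 1 → (0 < t ∧ t < 1) ∨ ∃ w ∈ s(a i, b i), P i t = vert w := by
    intro i t ht0 ht1
    rcases ht0.eq_or_lt with h | h
    · right; exact ⟨a i, by simp, by rw [← h, h0]⟩
    · rcases ht1.eq_or_lt with h' | h'
      · right; exact ⟨b i, by simp, by rw [h', h1]⟩
      · left; exact ⟨h, h'⟩
  have hvx : ∀ i t, 0 ≤ t → t ≤ 1 → ∀ w, P i t = vert w → w ∈ s(a i, b i) := by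
    intro i t ht0 ht1 w hw
    rcases hend i t ht0 ht1 with h | ⟨w', hw', h⟩
    · exact absurd hw (hv i t w h.1 h.2)
    · have := hvert (hw.symm.trans h)
      rw [this]; exact hw'
  -- main meeting lemma
  have hmeet : ∀ i j p, i ≠ j → p ∈ P i '' Set.Icc (0:ℝ) 1 → p ∈ P j '' Set.Icc (0:ℝ) 1 →
      (∃ w, w ∈ s(a i, b i) ∧ w ∈ s(a j, b j) ∧ p = vert w) ∨
      (j = mate i ∧ p = P i (τ i) ) := by
    rintro i j p hij ⟨s, hs, rfl⟩ ⟨t, ht, hst⟩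
    rcases hend i s hs.1 hs.2 with h | ⟨w, hw, h⟩
    · rcases hend j t ht.1 ht.2 with h' | ⟨w, hw, h'⟩
      · right
        obtain ⟨e1, e2⟩ := hcr i j s t hij h.1 h.2 h'.1 h'.2 hst.symm
        exact ⟨e1, by rw [← e2]⟩
      · left
        exact ⟨w, hvx i s hs.1 hs.2 w (hst.symm.trans h'), hw, hst.symm.trans h'⟩
    · left
      exact ⟨w, hw, hvx j t ht.1 ht.2 w (hst.trans h), h⟩
  let D : Drawing G :=
    { vert := vert
      vert_inj := hvert
      arc := fun e => P (ix e)
      arc_cont := fun e => (hcont _).continuousOn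
      arc_inj := fun e => hPinj _
      arc_ends := by
        intro e u v huv
        rw [← hix e] at huv
        rw [h0, h1]
        rcases Sym2.eq_iff.1 huv with ⟨h, h'⟩ | ⟨h, h'⟩
        · rw [h, h']
        · rw [h, h', Set.pair_comm]
      arc_vertex := by
        intro e t ht w hw
        rw [← hix e]
        exact hvx _ t ht.1 ht.2 w hw
      adj_meet := by
        rintro e f hef ⟨w, hw, hw'⟩ p hp hp'
        have hne : ix e ≠ ix f := fun h => hef (ixinj _ _ h)
        rw [← hix e] at hw ⊢
        rw [← hix f] at hw' ⊢
        rcases hmeet _ _ p hne hp hp' with h | ⟨h, _⟩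
        · exact h
        · exfalso
          rw [h] at hw'
          exact hdis (ix e) (by rw [← h]; exact hne.symm) w ⟨hw, hw'⟩
      nonadj_meet := by
        intro e f hno
        rw [← hix e, ← hix f] at hno
        have hne : ix e ≠ ix f := by
          intro h
          exact hno ⟨a (ix e), by simp, by rw [h]; simp⟩
        have key : ∀ p, p ∈ P (ix e) '' Set.Icc (0:ℝ) 1 → p ∈ P (ix f) '' Set.Icc (0:ℝ) 1 →
            p = P (ix e) (τ (ix e)) := by
          intro p hp hp'
          rcases hmeet _ _ p hne hp hp' with ⟨w, h, h', _⟩ | ⟨_, h⟩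
          · exact absurd ⟨w, h, h'⟩ hno
          · exact h
        rintro p ⟨hp, hp'⟩ q ⟨hq, hq'⟩
        rw [key p hp hp', key q hq hq'] }
  have hcross : ∀ e f, D.Crosses e f → ix f = mate (ix e) ∧ ix f ≠ ix e := by
    rintro e f ⟨hef, p, ⟨hp, hp'⟩, hpw⟩
    have hne : ix e ≠ ix f := fun h => hef (ixinj _ _ h)
    rcases hmeet _ _ p hne hp hp' with ⟨w, _, _, h⟩ | ⟨h, _⟩
    · exact absurd h.symm (hpw w)
    · exact ⟨h, hne.symm⟩
  refine ⟨G, ⟨col, ?_⟩, ⟨D, ?_, ?_⟩, ?_⟩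
  · intro u v huv
    have : s(u, v) ∈ G.edgeSet := huv
    rw [hES] at this
    obtain ⟨e, he⟩ := this
    rcases Sym2.eq_iff.1 he with ⟨h, h'⟩ | ⟨h, h'⟩
    · rw [← h, ← h']; exact hcol e
    · rw [← h, ← h']; exact (hcol e).symm
  · intro e
    have hfin : Finite G.edgeSet := Finite.of_injective ix (fun e f h => ixinj e f h)
    apply Set.ncard_le_one_iff_subsingleton.2
    intro f hf g hg
    exact ixinj _ _ ((hcross e f hf).1.trans (hcross e g hg).1.symm)
  · intro e f e' f' h h' hne
    obtain ⟨hf, hfe⟩ := hcross e f h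
    obtain ⟨hf', hfe'⟩ := hcross e' f' h'
    obtain ⟨hsf, -⟩ := hcross f e ⟨h.1.symm, by
      obtain ⟨p, hp, hw⟩ := h.2
      exact ⟨p, ⟨hp.2, hp.1⟩, hw⟩⟩
    have n1 : ix e' ≠ ix e := by
      intro hh
      apply hne
      have e1 := ixinj _ _ hh
      have e2 : f' = f := ixinj _ _ (by rw [hf, hf', hh])
      rw [e1, e2]
    have n2 : ix e' ≠ mate (ix e) := by
      intro hh
      rw [← hf] at hh
      apply hne
      have e1 := ixinj _ _ hh
      have e2 : f' = e := ixinj _ _ (by rw [hf', hh, ← hsf])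
      rw [e1, e2, Set.pair_comm]
    have key := hnic (ix e) (ix e') (by rw [← hf]; exact hfe) (by rw [← hf']; exact hfe') n1 n2
    rw [← hf, ← hf', hix, hix, hix, hix] at key
    have hsub : {w : V | (w ∈ (e : Sym2 V) ∨ w ∈ (f : Sym2 V)) ∧
               (w ∈ (e' : Sym2 V) ∨ w ∈ (f' : Sym2 V))}.Subsingleton := by
      intro w hw w' hw'
      exact key w w' hw.1 hw.2 hw'.1 hw'.2
    have hfin := hsub.finite.to_subtype
    exact Set.ncard_le_one_iff_subsingleton.2 hsub
  · rw [hES, ← Set.image_univ, Set.ncard_image_of_injective _ hinj, Set.ncard_univ,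
      Nat.card_eq_fintype_card]

/-- Index type of the edges: ring edges, band edges (rung and two diagonals per face), caps. -/
abbrev NicE (k : ℕ) : Type :=
  (Fin (k + 1) × Fin 6) ⊕ (Fin k × Fin 3 × Fin 3) ⊕ (Bool × Bool)

/-- Leftmost column of face `c` in a band of the given parity. -/
def nicJ (o : Bool) (c : Fin 3) : ℕ := if o then 2 * c.val else 2 * c.val + 1

/-- Upper column of a band edge. -/
def nicT (o : Bool) (c r : Fin 3) : ℕ :=
  if r = 0 then nicJ o c
  else if r = 1 then (if o ∨ c = 2 then nicJ o c else nicJ o c + 1)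
  else (if o then nicJ o c + 1 else nicJ o c + 2)

/-- Lower column of a band edge. -/
def nicB (o : Bool) (c r : Fin 3) : ℕ :=
  if r = 0 then nicJ o c
  else if r = 1 then (if o ∨ c = 2 then nicJ o c + 2 else nicJ o c + 1)
  else (if o then nicJ o c + 1 else nicJ o c)

/-- Start column of a cap edge. -/
def nicC (s r : Bool) : ℕ := if r then (if s then 5 else 1) else 0

/-- Parity of a band. -/
def nicO (i : ℕ) : Bool := i % 2 == 1

/-- The other diagonal of a face. -/
def nicM (r : Fin 3) : Fin 3 := if r = 0 then 0 else if r = 1 then 2 else 1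

def nicX0 (k : ℕ) : NicE k → ℕ
  | Sum.inl (_, j) => j.val
  | Sum.inr (Sum.inl (i, c, r)) => nicT (nicO i.val) c r
  | Sum.inr (Sum.inr (s, r)) => nicC s r

def nicX1 (k : ℕ) : NicE k → ℕ
  | Sum.inl (_, j) => j.val + 1
  | Sum.inr (Sum.inl (i, c, r)) => nicB (nicO i.val) c r
  | Sum.inr (Sum.inr (s, r)) => nicC s r + 3

def nicY0 (k : ℕ) : NicE k → ℕ
  | Sum.inl (i, _) => i.val
  | Sum.inr (Sum.inl (i, _, _)) => i.val
  | Sum.inr (Sum.inr (s, _)) => if s then k else 0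

def nicY1 (k : ℕ) : NicE k → ℕ
  | Sum.inl (i, _) => i.val
  | Sum.inr (Sum.inl (i, _, _)) => i.val + 1
  | Sum.inr (Sum.inr (s, _)) => if s then k else 0

def nicBump (k : ℕ) : NicE k → ℝ
  | Sum.inl _ => 0
  | Sum.inr (Sum.inl _) => 0
  | Sum.inr (Sum.inr (s, _)) => if s then 1 else -1

def nicMate (k : ℕ) : NicE k → NicE k
  | Sum.inl p => Sum.inl p
  | Sum.inr (Sum.inl (i, c, r)) => Sum.inr (Sum.inl (i, c, nicM r))
  | Sum.inr (Sum.inr (s, r)) => Sum.inr (Sum.inr (s, !r))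

noncomputable def nicTau (k : ℕ) : NicE k → ℝ
  | Sum.inl _ => 0
  | Sum.inr (Sum.inl _) => 1 / 2
  | Sum.inr (Sum.inr (s, r)) => if s = r then 2 / 3 else 1 / 3

def nicV (k y x : ℕ) : Fin (k + 1) × Fin 6 := (Fin.ofNat (k + 1) y, Fin.ofNat 6 x)

noncomputable def nicVert (k : ℕ) (w : Fin (k + 1) × Fin 6) : ℝ × ℝ := nicPhi (w.2.val : ℝ) (w.1.val : ℝ)

noncomputable def nicP (k : ℕ) (e : NicE k) (t : ℝ) : ℝ × ℝ :=
  nicPhi ((nicX0 k e : ℝ) + ((nicX1 k e : ℝ) - nicX0 k e) * t)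
    ((nicY0 k e : ℝ) + ((nicY1 k e : ℝ) - nicY0 k e) * t + nicBump k e * (t * (1 - t)))

theorem nicV_eq {k y x : ℕ} (hy : y ≤ k) (w : Fin (k + 1) × Fin 6) :
    w = nicV k y x ↔ w.1.val = y ∧ w.2.val = x % 6 := by
  have : y % (k + 1) = y := Nat.mod_eq_of_lt (by omega)
  simp [nicV, Prod.ext_iff, Fin.ext_iff, Fin.ofNat, this]

theorem nicY0_le (k : ℕ) (e : NicE k) : nicY0 k e ≤ k := by
  rcases e with ⟨i, j⟩ | ⟨i, c, r⟩ | ⟨s, r⟩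
  · simp only [nicY0]; omega
  · simp only [nicY0]; omega
  · cases s <;> simp [nicY0]

theorem nicY1_le (k : ℕ) (e : NicE k) : nicY1 k e ≤ k := by
  rcases e with ⟨i, j⟩ | ⟨i, c, r⟩ | ⟨s, r⟩
  · simp only [nicY1]; omega
  · simp only [nicY1]; omega
  · cases s <;> simp [nicY1]

theorem nicVert_nicV {k y : ℕ} (hy : y ≤ k) (x : ℕ) :
    nicVert k (nicV k y x) = nicPhi (x : ℝ) (y : ℝ) := by
  obtain ⟨h1, h2⟩ := (nicV_eq (x := x) hy (nicV k y x)).1 rfl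
  rw [nicVert, h1, h2, nicPhi_mod]

theorem nicVert_inj (k : ℕ) : Function.Injective (nicVert k) := by
  rintro ⟨l, p⟩ ⟨l', p'⟩ h
  obtain ⟨h1, m, h2⟩ := nicPhi_eq h
  have h1' : l.val = l'.val := by exact_mod_cast h1
  have h2' : (p.val : ℤ) = p'.val + 6 * m := by exact_mod_cast h2
  have : p.val = p'.val := by omega
  exact Prod.ext (Fin.ext h1') (Fin.ext this)

theorem nic_combo {s : ℝ} (h0 : 0 < s) (h1 : s < 1) {u v : ℤ}
    (h : (u : ℝ) + ((v : ℝ) - u) * s = 0) :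
    (u = 0 ∧ v = 0) ∨ (0 < u ∧ v < 0) ∨ (u < 0 ∧ 0 < v) := by
  have h' : (u : ℝ) * (1 - s) + v * s = 0 := by linarith
  have hs : 0 < 1 - s := by linarith
  rcases lt_trichotomy u 0 with hu | hu | hu
  · right; right
    refine ⟨hu, ?_⟩
    by_contra hv
    have hu' : (u : ℝ) < 0 := by exact_mod_cast hu
    have hv' : (v : ℝ) ≤ 0 := by exact_mod_cast not_lt.1 hv
    nlinarith [mul_neg_of_neg_of_pos hu' hs, mul_nonpos_of_nonpos_of_nonneg hv' h0.le]
  · left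
    refine ⟨hu, ?_⟩
    subst hu
    simp at h'
    rcases h' with h' | h'
    · exact h'
    · linarith
  · right; left
    refine ⟨hu, ?_⟩
    by_contra hv
    have hu' : 0 < (u : ℝ) := by exact_mod_cast hu
    have hv' : 0 ≤ (v : ℝ) := by exact_mod_cast not_lt.1 hv
    nlinarith [mul_pos hu' hs, mul_nonneg hv' h0.le]

theorem nic_no_int {s : ℝ} (h0 : 0 < s) (h1 : s < 1) {u : ℤ} (h : s = u) : False := by
  rw [h] at h0 h1
  have a : 0 < u := by exact_mod_cast h0
  have b : u < 1 := by exact_mod_cast h1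
  omega

theorem nicT_le : ∀ o c r, nicT o c r ≤ 7 := by decide
theorem nicB_le : ∀ o c r, nicB o c r ≤ 7 := by decide

theorem nic_band_dec : ∀ (o : Bool) (c r c' r' : Fin 3) (m : Fin 3), (c, r) ≠ (c', r') →
    ∀ u v : ℤ, u = (nicT o c r : ℤ) - nicT o c' r' - 6 * ((m.val : ℤ) - 1) →
      v = (nicB o c r : ℤ) - nicB o c' r' - 6 * ((m.val : ℤ) - 1) →
      ((u = 0 ∧ v = 0) ∨ (0 < u ∧ v < 0) ∨ (u < 0 ∧ 0 < v)) →
      c' = c ∧ r' = nicM r ∧ v = -u ∧ u ≠ 0 := by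
  have key : ∀ (o : Bool) (c r c' r' : Fin 3) (m : Fin 3), (c, r) ≠ (c', r') →
      (((nicT o c r : ℤ) - nicT o c' r' - 6 * ((m.val : ℤ) - 1) = 0 ∧
        (nicB o c r : ℤ) - nicB o c' r' - 6 * ((m.val : ℤ) - 1) = 0) ∨
       (0 < (nicT o c r : ℤ) - nicT o c' r' - 6 * ((m.val : ℤ) - 1) ∧
        (nicB o c r : ℤ) - nicB o c' r' - 6 * ((m.val : ℤ) - 1) < 0) ∨
       ((nicT o c r : ℤ) - nicT o c' r' - 6 * ((m.val : ℤ) - 1) < 0 ∧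
        0 < (nicB o c r : ℤ) - nicB o c' r' - 6 * ((m.val : ℤ) - 1))) →
      c' = c ∧ r' = nicM r ∧
       (nicB o c r : ℤ) - nicB o c' r' - 6 * ((m.val : ℤ) - 1) =
         -((nicT o c r : ℤ) - nicT o c' r' - 6 * ((m.val : ℤ) - 1)) ∧
       (nicT o c r : ℤ) - nicT o c' r' - 6 * ((m.val : ℤ) - 1) ≠ 0 := by
    decide +kernel
  intro o c r c' r' m hne u v hu hv h
  subst hu hv
  exact key o c r c' r' m hne h

theorem nic_band_cross {o : Bool} {c r c' r' : Fin 3} {s : ℝ} {m : ℤ} (h0 : 0 < s) (h1 : s < 1)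
    (hne : (c, r) ≠ (c', r'))
    (h : (nicT o c r : ℝ) + ((nicB o c r : ℝ) - nicT o c r) * s =
      (nicT o c' r' : ℝ) + ((nicB o c' r' : ℝ) - nicT o c' r') * s + 6 * m) :
    c' = c ∧ r' = nicM r ∧ s = 1 / 2 := by
  have hc := nic_combo h0 h1 (u := (nicT o c r : ℤ) - nicT o c' r' - 6 * m)
    (v := (nicB o c r : ℤ) - nicB o c' r' - 6 * m) (by push_cast; linarith)
  have b1 := nicT_le o c r
  have b2 := nicT_le o c' r'
  have b3 := nicB_le o c r
  have b4 := nicB_le o c' r'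
  have hm : -1 ≤ m ∧ m ≤ 1 := by omega
  have hmm : m = (((⟨(m + 1).toNat, by omega⟩ : Fin 3).val : ℤ) - 1) := by
    simp only; omega
  obtain ⟨h2, h3, h4, h5⟩ := nic_band_dec o c r c' r' ⟨(m + 1).toNat, by omega⟩ hne _ _
    (by rw [← hmm]) (by rw [← hmm]) hc
  refine ⟨h2, h3, ?_⟩
  generalize hu : (nicT o c r : ℤ) - nicT o c' r' - 6 * m = u at h4 h5
  have hu' : (nicT o c r : ℝ) - nicT o c' r' - 6 * m = u := by exact_mod_cast hu
  have hv' : (nicB o c r : ℝ) - nicB o c' r' - 6 * m = -u := by exact_mod_cast h4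
  have h6 : (u : ℝ) ≠ 0 := by exact_mod_cast h5
  have h7 : (u : ℝ) * (1 - 2 * s) = 0 := by
    have : (u : ℝ) + (-u - u) * s = 0 := by
      have e1 : (-(u : ℝ) - u) = ((nicB o c r : ℝ) - nicT o c r) - ((nicB o c' r' : ℝ) - nicT o c' r') := by linarith
      rw [e1]; linarith
    linarith
  rcases mul_eq_zero.1 h7 with h8 | h8
  · exact absurd h8 h6
  · linarith

theorem nicP_interior {k : ℕ} (e : NicE k) (t : ℝ) (w : Fin (k + 1) × Fin 6) (h0 : 0 < t)
    (h1 : t < 1) : nicP k e t ≠ nicVert k w := by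
  intro h
  obtain ⟨hy, m, hx⟩ := nicPhi_eq h
  have hb : 0 < t * (1 - t) := mul_pos h0 (by linarith)
  have hw : (w.1.val : ℝ) ≤ k := by
    have : w.1.val ≤ k := by omega
    exact_mod_cast this
  have hw0 : (0 : ℝ) ≤ w.1.val := Nat.cast_nonneg _
  rcases e with ⟨i, j⟩ | ⟨i, c, r⟩ | ⟨s, r⟩
  · simp only [nicX0, nicX1] at hx
    push_cast at hx
    exact nic_no_int h0 h1 (u := w.2.val + 6 * m - j.val) (by push_cast; linarith)
  · simp only [nicY0, nicY1, nicBump] at hy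
    push_cast at hy
    exact nic_no_int h0 h1 (u := (w.1.val : ℤ) - i.val) (by push_cast; linarith)
  · cases s <;> simp [nicY0, nicY1, nicBump] at hy <;> linarith

theorem nicP_inj {k : ℕ} (e : NicE k) : Set.InjOn (nicP k e) (Set.Icc 0 1) := by
  intro s hs t ht h
  obtain ⟨hy, m, hx⟩ := nicPhi_eq h
  obtain ⟨hs0, hs1⟩ := hs
  obtain ⟨ht0, ht1⟩ := ht
  rcases e with ⟨i, j⟩ | ⟨i, c, r⟩ | ⟨q, r⟩
  · simp only [nicX0, nicX1] at hx
    push_cast at hx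
    have a1 : (m : ℝ) < 1 := by linarith
    have a2 : (-1 : ℝ) < m := by linarith
    have a1' : m < 1 := by exact_mod_cast a1
    have a2' : -1 < m := by exact_mod_cast a2
    have : m = 0 := by omega
    subst this
    push_cast at hx
    linarith
  · simp only [nicY0, nicY1, nicBump] at hy
    push_cast at hy
    linarith
  · simp only [nicX0, nicX1] at hx
    push_cast at hx
    have a1 : (m : ℝ) < 1 := by linarith
    have a2 : (-1 : ℝ) < m := by linarith
    have a1' : m < 1 := by exact_mod_cast a1
    have a2' : -1 < m := by exact_mod_cast a2
    have : m = 0 := by omega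
    subst this
    push_cast at hx
    linarith

theorem nic_cap_cross {q r r' : Bool} {s t : ℝ} {m : ℤ} (hs0 : 0 < s) (hs1 : s < 1)
    (ht0 : 0 < t) (ht1 : t < 1) (hr : r ≠ r') (hy : s * (1 - s) = t * (1 - t))
    (hx : (nicC q r : ℝ) + 3 * s = nicC q r' + 3 * t + 6 * m) :
    s = if q = r then 2 / 3 else 1 / 3 := by
  have hst : (s - t) * (1 - s - t) = 0 := by linarith
  have a1 : (m : ℝ) < 2 := by
    cases q <;> cases r <;> cases r' <;> simp [nicC] at hx hr ⊢ <;> linarith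
  have a2 : (-2 : ℝ) < m := by
    cases q <;> cases r <;> cases r' <;> simp [nicC] at hx hr ⊢ <;> linarith
  have a1' : m < 2 := by exact_mod_cast a1
  have a2' : -2 < m := by exact_mod_cast a2
  have hm : m = -1 ∨ m = 0 ∨ m = 1 := by omega
  rcases mul_eq_zero.1 hst with h | h
  · have : t = s := by linarith
    subst this
    rcases hm with rfl | rfl | rfl <;> cases q <;> cases r <;> cases r' <;>
      simp [nicC] at hx hr ⊢ <;> linarith
  · have : t = 1 - s := by linarith
    subst this
    rcases hm with rfl | rfl | rfl <;> cases q <;> cases r <;> cases r' <;>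
      simp [nicC] at hx hr ⊢ <;> linarith

theorem nicP_cross {k : ℕ} (e f : NicE k) (s t : ℝ) (hne : e ≠ f) (hs0 : 0 < s) (hs1 : s < 1)
    (ht0 : 0 < t) (ht1 : t < 1) (h : nicP k e s = nicP k f t) :
    f = nicMate k e ∧ s = nicTau k e := by
  obtain ⟨hy, m, hx⟩ := nicPhi_eq h
  have hbs : 0 < s * (1 - s) := mul_pos hs0 (by linarith)
  have hbt : 0 < t * (1 - t) := mul_pos ht0 (by linarith)
  have hfin : ∀ {n : ℕ} (i : Fin n), (i.val : ℝ) + 1 ≤ n ∧ (0 : ℝ) ≤ i.val := by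
    intro n i
    refine ⟨?_, Nat.cast_nonneg _⟩
    have : i.val + 1 ≤ n := i.2
    exact_mod_cast this
  rcases e with ⟨i, j⟩ | ⟨i, c, r⟩ | ⟨q, r⟩ <;> rcases f with ⟨i', j'⟩ | ⟨i', c', r'⟩ | ⟨q', r'⟩
  · exfalso
    simp only [nicX0, nicX1, nicY0, nicY1, nicBump] at hx hy
    push_cast at hx hy
    have hi : (i.val : ℝ) = i'.val := by linarith
    have hi' : i.val = i'.val := by exact_mod_cast hi
    have hz : s - t = ((j'.val + 6 * m - j.val : ℤ) : ℝ) := by push_cast; linarith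
    have a1 : ((j'.val + 6 * m - j.val : ℤ) : ℝ) < 1 := by linarith
    have a2 : (-1 : ℝ) < ((j'.val + 6 * m - j.val : ℤ) : ℝ) := by linarith
    have a1' : (j'.val + 6 * m - j.val : ℤ) < 1 := by exact_mod_cast a1
    have a2' : -1 < (j'.val + 6 * m - j.val : ℤ) := by exact_mod_cast a2
    have : j.val = j'.val := by omega
    exact hne (by rw [Fin.ext hi', Fin.ext this])
  · exfalso
    simp only [nicY0, nicY1, nicBump] at hy
    push_cast at hy
    exact nic_no_int ht0 ht1 (u := (i.val : ℤ) - i'.val) (by push_cast; linarith)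
  · exfalso
    have := hfin i
    push_cast at this
    cases q' <;> simp [nicY0, nicY1, nicBump] at hy <;> linarith
  · exfalso
    simp only [nicY0, nicY1, nicBump] at hy
    push_cast at hy
    exact nic_no_int hs0 hs1 (u := (i'.val : ℤ) - i.val) (by push_cast; linarith)
  · simp only [nicY0, nicY1, nicBump] at hy
    push_cast at hy
    have hz : s - t = ((i'.val - i.val : ℤ) : ℝ) := by push_cast; linarith
    have a1 : ((i'.val - i.val : ℤ) : ℝ) < 1 := by linarith
    have a2 : (-1 : ℝ) < ((i'.val - i.val : ℤ) : ℝ) := by linarith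
    have a1' : (i'.val - i.val : ℤ) < 1 := by exact_mod_cast a1
    have a2' : -1 < (i'.val - i.val : ℤ) := by exact_mod_cast a2
    have hii : i = i' := Fin.ext (by omega)
    subst hii
    have hst : t = s := by linarith
    subst hst
    simp only [nicX0, nicX1] at hx
    have hne' : (c, r) ≠ (c', r') := by
      intro h
      apply hne
      rw [h]
    obtain ⟨e1, e2, e3⟩ := nic_band_cross hs0 hs1 hne' hx
    subst e1 e2
    exact ⟨rfl, e3⟩
  · exfalso
    have := hfin i
    cases q' <;> simp [nicY0, nicY1, nicBump] at hy <;> linarith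
  · exfalso
    have := hfin i'
    push_cast at this
    cases q <;> simp [nicY0, nicY1, nicBump] at hy <;> linarith
  · exfalso
    have := hfin i'
    cases q <;> simp [nicY0, nicY1, nicBump] at hy <;> linarith
  · have hk : (0 : ℝ) ≤ k := Nat.cast_nonneg _
    have hq : q = q' := by
      cases q <;> cases q' <;> simp [nicY0, nicY1, nicBump] at hy ⊢ <;> linarith
    subst hq
    have hy' : s * (1 - s) = t * (1 - t) := by
      cases q <;> simp [nicY0, nicY1, nicBump] at hy ⊢ <;> linarith
    have hr : r ≠ r' := by
      intro h
      exact hne (by rw [h])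
    simp only [nicX0, nicX1] at hx
    push_cast at hx
    refine ⟨?_, ?_⟩
    · simp only [nicMate]
      have : r' = !r := by cases r <;> cases r' <;> simp at hr ⊢
      rw [this]
    · simp only [nicTau]
      exact nic_cap_cross hs0 hs1 ht0 ht1 hr hy' (by linarith)

def nicA (k : ℕ) (e : NicE k) : Fin (k + 1) × Fin 6 := nicV k (nicY0 k e) (nicX0 k e)

def nicZ (k : ℕ) (e : NicE k) : Fin (k + 1) × Fin 6 := nicV k (nicY1 k e) (nicX1 k e)

theorem nic_mem {k : ℕ} (e : NicE k) (w : Fin (k + 1) × Fin 6) :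
    w ∈ s(nicA k e, nicZ k e) ↔
      (w.1.val = nicY0 k e ∧ w.2.val = nicX0 k e % 6) ∨
      (w.1.val = nicY1 k e ∧ w.2.val = nicX1 k e % 6) := by
  rw [Sym2.mem_iff, nicA, nicZ, nicV_eq (nicY0_le k e), nicV_eq (nicY1_le k e)]

theorem nic_par_T : ∀ o c r, (nicT o c r + nicB o c r) % 2 = 0 := by decide

def nicCol (k : ℕ) (w : Fin (k + 1) × Fin 6) : Bool := (w.1.val + w.2.val) % 2 == 0

theorem nicCol_V {k y x : ℕ} (hy : y ≤ k) : nicCol k (nicV k y x) = ((y + x) % 2 == 0) := by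
  obtain ⟨h1, h2⟩ := (nicV_eq (x := x) hy (nicV k y x)).1 rfl
  rw [nicCol, h1, h2]
  congr 1
  omega

theorem nicCol_ne (k : ℕ) (e : NicE k) : nicCol k (nicA k e) ≠ nicCol k (nicZ k e) := by
  rw [nicA, nicZ, nicCol_V (nicY0_le k e), nicCol_V (nicY1_le k e)]
  have : (nicY0 k e + nicX0 k e) % 2 ≠ (nicY1 k e + nicX1 k e) % 2 := by
    rcases e with ⟨i, j⟩ | ⟨i, c, r⟩ | ⟨q, r⟩
    · simp only [nicX0, nicX1, nicY0, nicY1]; omega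
    · have := nic_par_T (nicO i.val) c r
      simp only [nicX0, nicX1, nicY0, nicY1]; omega
    · simp only [nicX0, nicX1, nicY0, nicY1]; omega
  intro h
  apply this
  have h' : ((nicY0 k e + nicX0 k e) % 2 = 0) ↔ ((nicY1 k e + nicX1 k e) % 2 = 0) := by
    rw [← beq_iff_eq, h, beq_iff_eq]
  omega

theorem nic_band_inj : ∀ o c r c' r', nicT o c r % 6 = nicT o c' r' % 6 →
    nicB o c r % 6 = nicB o c' r' % 6 → c = c' ∧ r = r' := by decide +kernel

theorem nic_cap_inj : ∀ q r r', r ≠ r' → nicC q r % 6 ≠ nicC q r' % 6 ∧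
    nicC q r % 6 ≠ (nicC q r' + 3) % 6 := by decide

theorem nic_pair_inj (k : ℕ) (hk : 0 < k) :
    Function.Injective (fun e : NicE k => s(nicA k e, nicZ k e)) := by
  intro e f h
  have h' : s(nicA k e, nicZ k e) = s(nicA k f, nicZ k f) := h
  rw [Sym2.eq_iff] at h'
  simp only [nicA, nicZ] at h'
  rw [nicV_eq (nicY0_le k f), nicV_eq (nicY1_le k f), nicV_eq (nicY1_le k f),
    nicV_eq (nicY0_le k f)] at h'
  obtain ⟨h1, h2⟩ := (nicV_eq (nicY0_le k e) (nicV k (nicY0 k e) (nicX0 k e))).1 rfl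
  obtain ⟨h3, h4⟩ := (nicV_eq (nicY1_le k e) (nicV k (nicY1 k e) (nicX1 k e))).1 rfl
  rw [h1, h2, h3, h4] at h'
  clear h h1 h2 h3 h4
  rcases e with ⟨i, j⟩ | ⟨i, c, r⟩ | ⟨q, r⟩ <;> rcases f with ⟨i', j'⟩ | ⟨i', c', r'⟩ | ⟨q', r'⟩ <;>
    simp only [nicX0, nicX1, nicY0, nicY1] at h'
  · have a1 : i = i' := Fin.ext (by omega)
    have a2 : j = j' := Fin.ext (by omega)
    rw [a1, a2]
  · exfalso; omega
  · exfalso; omega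
  · exfalso; omega
  · have a1 : i = i' := Fin.ext (by omega)
    subst a1
    obtain ⟨b1, b2⟩ := nic_band_inj (nicO i.val) c r c' r' (by omega) (by omega)
    rw [b1, b2]
  · exfalso; omega
  · exfalso; omega
  · exfalso; omega
  · have hq : q = q' := by
      cases q <;> cases q' <;> simp at h' ⊢ <;> omega
    subst hq
    by_cases hr : r = r'
    · rw [hr]
    · exfalso
      have := nic_cap_inj q r r' hr
      omega

theorem nic_mate_band : ∀ o c r, r ≠ nicM r → nicT o c r % 6 ≠ nicT o c (nicM r) % 6 ∧
    nicB o c r % 6 ≠ nicB o c (nicM r) % 6 := by decide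

theorem nic_mate_cap : ∀ q r, nicC q r % 6 ≠ nicC q (!r) % 6 ∧
    nicC q r % 6 ≠ (nicC q (!r) + 3) % 6 := by decide

theorem nic_disj {k : ℕ} (e : NicE k) (hm : nicMate k e ≠ e) (w : Fin (k + 1) × Fin 6) :
    ¬ (w ∈ s(nicA k e, nicZ k e) ∧ w ∈ s(nicA k (nicMate k e), nicZ k (nicMate k e))) := by
  rw [nic_mem, nic_mem]
  rcases e with ⟨i, j⟩ | ⟨i, c, r⟩ | ⟨q, r⟩
  · exact absurd rfl hm
  · have hr : r ≠ nicM r := by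
      intro h
      apply hm
      simp only [nicMate]
      rw [← h]
    have := nic_mate_band (nicO i.val) c r hr
    simp only [nicMate, nicX0, nicX1, nicY0, nicY1]
    omega
  · have h1 := nic_mate_cap q r
    simp only [nicMate, nicX0, nicX1, nicY0, nicY1]
    omega

/-- Upper quadruple columns of a face. -/
def nicTop (o : Bool) (c : Fin 3) (p : Fin 6) : Bool :=
  p.val == nicT o c 1 % 6 || p.val == nicT o c 2 % 6

/-- Lower quadruple columns of a face. -/
def nicBot (o : Bool) (c : Fin 3) (p : Fin 6) : Bool :=
  p.val == nicB o c 1 % 6 || p.val == nicB o c 2 % 6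

/-- Quadruple columns of a cap. -/
def nicCap (q : Bool) (p : Fin 6) : Bool :=
  p.val == nicC q false % 6 || p.val == (nicC q false + 3) % 6 ||
  p.val == nicC q true % 6 || p.val == (nicC q true + 3) % 6

theorem nic_M_cases : ∀ r : Fin 3, r ≠ nicM r →
    (r = 1 ∧ nicM r = 2) ∨ (r = 2 ∧ nicM r = 1) := by decide

theorem nic_quad_band {k : ℕ} {i : Fin k} {c r : Fin 3} (hr : r ≠ nicM r)
    {w : Fin (k + 1) × Fin 6}
    (h : w ∈ s(nicA k (Sum.inr (Sum.inl (i, c, r))), nicZ k (Sum.inr (Sum.inl (i, c, r)))) ∨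
      w ∈ s(nicA k (nicMate k (Sum.inr (Sum.inl (i, c, r)))),
        nicZ k (nicMate k (Sum.inr (Sum.inl (i, c, r)))))) :
    (w.1.val = i.val ∧ nicTop (nicO i.val) c w.2 = true) ∨
    (w.1.val = i.val + 1 ∧ nicBot (nicO i.val) c w.2 = true) := by
  rw [nic_mem, nic_mem] at h
  simp only [nicMate, nicX0, nicX1, nicY0, nicY1] at h
  have hr' : (r = 1 ∧ nicM r = 2) ∨ (r = 2 ∧ nicM r = 1) := by
    exact nic_M_cases r hr
  simp only [nicTop, nicBot, Bool.or_eq_true, beq_iff_eq]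
  rcases hr' with ⟨h1, h2⟩ | ⟨h1, h2⟩ <;> rw [h2] at h <;> rw [h1] at h <;> tauto

theorem nic_quad_cap {k : ℕ} {q r : Bool}
    {w : Fin (k + 1) × Fin 6}
    (h : w ∈ s(nicA k (Sum.inr (Sum.inr (q, r))), nicZ k (Sum.inr (Sum.inr (q, r)))) ∨
      w ∈ s(nicA k (nicMate k (Sum.inr (Sum.inr (q, r)))),
        nicZ k (nicMate k (Sum.inr (Sum.inr (q, r)))))) :
    w.1.val = (if q then k else 0) ∧ nicCap q w.2 = true := by
  rw [nic_mem, nic_mem] at h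
  simp only [nicMate, nicX0, nicX1, nicY0, nicY1] at h
  simp only [nicCap, Bool.or_eq_true, beq_iff_eq]
  cases r <;> simp only [Bool.not_true, Bool.not_false] at h <;> tauto

theorem nic_q1 : ∀ o c c', c ≠ c' → ∀ p p', nicTop o c p = true → nicTop o c' p = true →
    nicTop o c p' = true → nicTop o c' p' = true → p = p' := by decide +kernel
theorem nic_q2 : ∀ o c c', c ≠ c' → ∀ p p', nicBot o c p = true → nicBot o c' p = true →
    nicBot o c p' = true → nicBot o c' p' = true → p = p' := by decide +kernel
theorem nic_q3 : ∀ o c c', c ≠ c' → ∀ p p', nicTop o c p = true → nicTop o c' p = true →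
    nicBot o c p' = true → nicBot o c' p' = true → False := by decide +kernel
theorem nic_q4 : ∀ o c c' p p', nicBot o c p = true → nicTop (!o) c' p = true →
    nicBot o c p' = true → nicTop (!o) c' p' = true → p = p' := by decide +kernel
theorem nic_q5 : ∀ c p p', nicTop false c p = true → nicCap false p = true →
    nicTop false c p' = true → nicCap false p' = true → p = p' := by decide +kernel
theorem nic_q6 : ∀ c p p', nicBot false c p = true → nicCap true p = true →
    nicBot false c p' = true → nicCap true p' = true → p = p' := by decide +kernel

theorem nicO_succ (i : ℕ) : nicO (i + 1) = !(nicO i) := by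
  unfold nicO
  rcases Nat.mod_two_eq_zero_or_one i with h | h
  · have : (i + 1) % 2 = 1 := by omega
    rw [h, this]; rfl
  · have : (i + 1) % 2 = 0 := by omega
    rw [h, this]; rfl

/-- Quadruples of two distinct band faces. -/
theorem nic_bb {k : ℕ} {i i' : Fin k} {c c' : Fin 3} (hne : (i, c) ≠ (i', c'))
    {w w' : Fin (k + 1) × Fin 6}
    (h1 : (w.1.val = i.val ∧ nicTop (nicO i.val) c w.2 = true) ∨
      (w.1.val = i.val + 1 ∧ nicBot (nicO i.val) c w.2 = true))
    (h2 : (w.1.val = i'.val ∧ nicTop (nicO i'.val) c' w.2 = true) ∨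
      (w.1.val = i'.val + 1 ∧ nicBot (nicO i'.val) c' w.2 = true))
    (h3 : (w'.1.val = i.val ∧ nicTop (nicO i.val) c w'.2 = true) ∨
      (w'.1.val = i.val + 1 ∧ nicBot (nicO i.val) c w'.2 = true))
    (h4 : (w'.1.val = i'.val ∧ nicTop (nicO i'.val) c' w'.2 = true) ∨
      (w'.1.val = i'.val + 1 ∧ nicBot (nicO i'.val) c' w'.2 = true)) : w = w' := by
  by_cases hi : i = i'
  · subst hi
    have hc : c ≠ c' := fun h => hne (by rw [h])
    rcases h1 with ⟨a1, b1⟩ | ⟨a1, b1⟩ <;> rcases h2 with ⟨a2, b2⟩ | ⟨a2, b2⟩ <;>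
      rcases h3 with ⟨a3, b3⟩ | ⟨a3, b3⟩ <;> rcases h4 with ⟨a4, b4⟩ | ⟨a4, b4⟩ <;>
      first
      | (exfalso; omega)
      | exact Prod.ext (Fin.ext (by omega)) (nic_q1 _ _ _ hc _ _ b1 b2 b3 b4)
      | exact Prod.ext (Fin.ext (by omega)) (nic_q2 _ _ _ hc _ _ b1 b2 b3 b4)
      | exact (nic_q3 _ _ _ hc _ _ b1 b2 b3 b4).elim
      | exact (nic_q3 _ _ _ hc _ _ b3 b4 b1 b2).elim
  · have hi' : i.val ≠ i'.val := fun h => hi (Fin.ext h)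
    rcases h1 with ⟨a1, b1⟩ | ⟨a1, b1⟩ <;> rcases h2 with ⟨a2, b2⟩ | ⟨a2, b2⟩ <;>
      rcases h3 with ⟨a3, b3⟩ | ⟨a3, b3⟩ <;> rcases h4 with ⟨a4, b4⟩ | ⟨a4, b4⟩ <;>
      try (exfalso; omega)
    · have hs : i.val = i'.val + 1 := by omega
      rw [hs, nicO_succ] at b1 b3
      exact Prod.ext (Fin.ext (by omega)) (nic_q4 _ _ _ _ _ b2 b1 b4 b3)
    · have hs : i'.val = i.val + 1 := by omega
      rw [hs, nicO_succ] at b2 b4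
      exact Prod.ext (Fin.ext (by omega)) (nic_q4 _ _ _ _ _ b1 b2 b3 b4)

/-- Quadruples of a band face and a cap. -/
theorem nic_bc {k : ℕ} (hk : k % 2 = 1) {i : Fin k} {c : Fin 3} {q : Bool}
    {w w' : Fin (k + 1) × Fin 6}
    (h1 : (w.1.val = i.val ∧ nicTop (nicO i.val) c w.2 = true) ∨
      (w.1.val = i.val + 1 ∧ nicBot (nicO i.val) c w.2 = true))
    (h2 : w.1.val = (if q then k else 0) ∧ nicCap q w.2 = true)
    (h3 : (w'.1.val = i.val ∧ nicTop (nicO i.val) c w'.2 = true) ∨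
      (w'.1.val = i.val + 1 ∧ nicBot (nicO i.val) c w'.2 = true))
    (h4 : w'.1.val = (if q then k else 0) ∧ nicCap q w'.2 = true) : w = w' := by
  have hi := i.2
  obtain ⟨a2, b2⟩ := h2
  obtain ⟨a4, b4⟩ := h4
  cases q
  · simp only [Bool.false_eq_true, if_false] at a2 a4
    rcases h1 with ⟨a1, b1⟩ | ⟨a1, b1⟩ <;> rcases h3 with ⟨a3, b3⟩ | ⟨a3, b3⟩ <;>
      try (exfalso; omega)
    have ho : nicO i.val = false := by
      have : i.val = 0 := by omega
      rw [this]; rfl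
    rw [ho] at b1 b3
    exact Prod.ext (Fin.ext (by omega)) (nic_q5 _ _ _ b1 b2 b3 b4)
  · simp only [if_true] at a2 a4
    rcases h1 with ⟨a1, b1⟩ | ⟨a1, b1⟩ <;> rcases h3 with ⟨a3, b3⟩ | ⟨a3, b3⟩ <;>
      try (exfalso; omega)
    have ho : nicO i.val = false := by
      have : i.val % 2 = 0 := by omega
      unfold nicO
      rw [this]; rfl
    rw [ho] at b1 b3
    exact Prod.ext (Fin.ext (by omega)) (nic_q6 _ _ _ b1 b2 b3 b4)

theorem nic_two : ∀ r r' : Fin 3, r ≠ nicM r → r' ≠ nicM r' → r' ≠ r → r' ≠ nicM r → False := by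
  decide

theorem nic_nic {k : ℕ} (hk : k % 2 = 1) (e e' : NicE k) (hm : nicMate k e ≠ e)
    (hm' : nicMate k e' ≠ e') (hn : e' ≠ e) (hn' : e' ≠ nicMate k e) (w w' : Fin (k + 1) × Fin 6)
    (h1 : w ∈ s(nicA k e, nicZ k e) ∨ w ∈ s(nicA k (nicMate k e), nicZ k (nicMate k e)))
    (h2 : w ∈ s(nicA k e', nicZ k e') ∨ w ∈ s(nicA k (nicMate k e'), nicZ k (nicMate k e')))
    (h3 : w' ∈ s(nicA k e, nicZ k e) ∨ w' ∈ s(nicA k (nicMate k e), nicZ k (nicMate k e)))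
    (h4 : w' ∈ s(nicA k e', nicZ k e') ∨ w' ∈ s(nicA k (nicMate k e'), nicZ k (nicMate k e'))) :
    w = w' := by
  have hband : ∀ {i : Fin k} {c r : Fin 3},
      nicMate k (Sum.inr (Sum.inl (i, c, r))) ≠ Sum.inr (Sum.inl (i, c, r)) → r ≠ nicM r := by
    intro i c r h h'
    apply h
    simp only [nicMate]
    rw [← h']
  rcases e with ⟨i, j⟩ | ⟨i, c, r⟩ | ⟨q, r⟩
  · exact absurd rfl hm
  · have hr := hband hm
    rcases e' with ⟨i', j'⟩ | ⟨i', c', r'⟩ | ⟨q', r'⟩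
    · exact absurd rfl hm'
    · have hr' := hband hm'
      refine nic_bb (i := i) (i' := i') (c := c) (c' := c') ?_ (nic_quad_band hr h1)
        (nic_quad_band hr' h2) (nic_quad_band hr h3) (nic_quad_band hr' h4)
      intro h
      obtain ⟨e1, e2⟩ := Prod.ext_iff.1 h
      simp only at e1 e2
      subst e1 e2
      refine nic_two r r' hr hr' ?_ ?_
      · intro h; exact hn (by rw [h])
      · intro h; exact hn' (by rw [h]; rfl)
    · exact nic_bc hk (nic_quad_band hr h1) (nic_quad_cap h2) (nic_quad_band hr h3)
        (nic_quad_cap h4)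
  · rcases e' with ⟨i', j'⟩ | ⟨i', c', r'⟩ | ⟨q', r'⟩
    · exact absurd rfl hm'
    · have hr' := hband hm'
      exact nic_bc hk (nic_quad_band hr' h2) (nic_quad_cap h1) (nic_quad_band hr' h4)
        (nic_quad_cap h3)
    · exfalso
      have a1 := (nic_quad_cap h1).1
      have a2 := (nic_quad_cap h2).1
      have hq : q = q' := by
        rw [a1] at a2
        cases q <;> cases q' <;> simp at a2 ⊢ <;> omega
      subst hq
      cases r <;> cases r' <;> simp [nicMate] at hn hn'

theorem nic_fin_exists (k : ℕ) (hk : k % 2 = 1) : ∃ G : SimpleGraph (Fin ((k + 1) * 6)),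
    IsBipartite G ∧ IsNICPlanar G ∧ G.edgeSet.ncard = 15 * k + 10 := by
  let φ : Fin (k + 1) × Fin 6 ≃ Fin ((k + 1) * 6) := finProdFinEquiv
  have hmem : ∀ (e : NicE k) w, w ∈ s(φ (nicA k e), φ (nicZ k e)) ↔
      φ.symm w ∈ s(nicA k e, nicZ k e) := by
    intro e w
    simp only [Sym2.mem_iff, Equiv.symm_apply_eq]
  have key := nic_framework (V := Fin ((k + 1) * 6)) (ι := NicE k)
    (fun e => φ (nicA k e)) (fun e => φ (nicZ k e)) ?_
    (fun w => nicCol k (φ.symm w)) ?_ (fun w => nicVert k (φ.symm w)) ?_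
    (nicP k) ?_ nicP_inj ?_ ?_ ?_ (nicMate k) (nicTau k) nicP_cross ?_ ?_
  · obtain ⟨G, h1, h2, h3⟩ := key
    refine ⟨G, h1, h2, ?_⟩
    rw [h3]
    simp only [Fintype.card_sum, Fintype.card_prod, Fintype.card_fin, Fintype.card_bool]
    ring
  · intro e f h
    apply nic_pair_inj k (by omega)
    have h' : s(φ (nicA k e), φ (nicZ k e)) = s(φ (nicA k f), φ (nicZ k f)) := h
    rw [Sym2.eq_iff] at h'
    simp only [φ.injective.eq_iff] at h'
    exact Sym2.eq_iff.2 h'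
  · intro e
    simp only [Equiv.symm_apply_apply]
    exact nicCol_ne k e
  · exact (nicVert_inj k).comp φ.symm.injective
  · intro e
    unfold nicP nicPhi
    fun_prop
  · intro e
    simp only [Equiv.symm_apply_apply]
    rw [nicA, nicVert_nicV (nicY0_le k e), nicP]
    congr 1 <;> ring
  · intro e
    simp only [Equiv.symm_apply_apply]
    rw [nicZ, nicVert_nicV (nicY1_le k e), nicP]
    congr 1 <;> ring
  · intro e t w h0 h1
    exact nicP_interior e t _ h0 h1
  · intro e he w
    rw [hmem, hmem]
    exact nic_disj e he _
  · intro e e' a1 a2 a3 a4 w w' b1 b2 b3 b4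
    simp only [hmem] at b1 b2 b3 b4
    exact φ.symm.injective (nic_nic hk e e' a1 a2 a3 a4 _ _ b1 b2 b3 b4)

/-- For infinitely many values of `n`, there exists a bipartite
NIC-planar graph with `n` vertices and exactly `2.5 n - 5` edges. -/
theorem bipartite_nicplanar_density_lower_bound :
    ∀ N : ℕ, ∃ n : ℕ, N ≤ n ∧ ∃ G : SimpleGraph (Fin n),
      IsBipartite G ∧ IsNICPlanar G ∧
      (G.edgeSet.ncard : ℝ) = 2.5 * n - 5 := by
  intro N
  obtain ⟨G, h1, h2, h3⟩ := nic_fin_exists (2 * N + 1) (by omega)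
  refine ⟨_, ?_, G, h1, h2, ?_⟩
  · omega
  · rw [h3]
    push_cast
    ring
end

section
/- For infinitely many values of n, there exists a bipartite fan-planar simple graph with n vertices and exactly 4n − 16 edges. -/
open Set

/-- A graph is fan-planar if it admits a drawing in which, for every edge `e`, all
edges crossing `e` have a common endpoint (forming a fan at that vertex, which lies on
one side of `e`). -/
def IsFanPlanar {V : Type*} (G : SimpleGraph V) : Prop :=
  ∃ D : Drawing G, ∀ e : G.edgeSet, (∃ f, D.Crosses e f) →
    ∃ v : V, ∀ f : G.edgeSet, D.Crosses e f → v ∈ (f : Sym2 V)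

/-- The complete bipartite graph `K_{4,m}` on `Fin (4 + m)`. -/
def kGraph (m : ℕ) : SimpleGraph (Fin (4 + m)) where
  Adj u v := ¬ ((u : ℕ) < 4 ↔ (v : ℕ) < 4)
  symm := ⟨fun u v h => by rw [iff_comm]; exact h⟩
  loopless := ⟨fun u h => h Iff.rfl⟩

/-- Horizontal coordinate of the four special vertices. -/
noncomputable def kX (k : ℕ) : ℝ := if k = 0 ∨ k = 2 then 0 else 1

/-- Vertical coordinate of the four special vertices. -/
noncomputable def kS (k : ℕ) : ℝ := if k < 2 then 1 else -1

/-- Vertex placement. -/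
noncomputable def kVert (k : ℕ) : ℝ × ℝ := if k < 4 then (kX k, kS k) else ((k : ℝ), 0)

/-- Straight segment from special vertex `k` to the vertex `i` on the axis. -/
noncomputable def kArc (k i : ℕ) (t : ℝ) : ℝ × ℝ :=
  ((1 - t) * kX k + t * i, (1 - t) * kS k)

lemma kS_cases (k : ℕ) : kS k = 1 ∨ kS k = -1 := by
  unfold kS; split_ifs <;> simp

lemma kX_kS_inj {k l : ℕ} (hk : k < 4) (hl : l < 4) (hX : kX k = kX l) (hS : kS k = kS l) :
    k = l := by
  interval_cases k <;> interval_cases l <;> norm_num [kX, kS] at *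

lemma kS_third {k l l' : ℕ} (hk : k < 4) (hl : l < 4) (hl' : l' < 4) (h1 : l ≠ k) (h2 : l' ≠ k)
    (hS : kS l = kS k) (hS' : kS l' = kS k) : l = l' := by
  interval_cases k <;> interval_cases l <;> interval_cases l' <;> norm_num [kS] at *

lemma kVert_inj {k l : ℕ} (h : kVert k = kVert l) : k = l := by
  unfold kVert at h
  split_ifs at h with h1 h2 h2
  · simp only [Prod.mk.injEq] at h
    exact kX_kS_inj h1 h2 h.1 h.2
  · simp only [Prod.mk.injEq] at h
    rcases kS_cases k with h' | h' <;> rw [h'] at h <;> norm_num at h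
  · simp only [Prod.mk.injEq] at h
    rcases kS_cases l with h' | h' <;> rw [h'] at h <;> norm_num at h
  · simp only [Prod.mk.injEq] at h
    exact_mod_cast h.1

lemma kArc_zero {k : ℕ} (i : ℕ) (hk : k < 4) : kArc k i 0 = kVert k := by
  simp [kArc, kVert, hk]

lemma kArc_one (k : ℕ) {i : ℕ} (hi : 4 ≤ i) : kArc k i 1 = kVert i := by
  simp [kArc, kVert, Nat.not_lt.mpr hi]

/-- How two segments of the drawing can meet. -/
lemma kArc_meet {k l i j : ℕ} {t s : ℝ} (hk : k < 4) (hl : l < 4)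
    (ht : t ≤ 1) (hs : s ≤ 1) (h : kArc k i t = kArc l j s) :
    t = s ∧ ((t = 1 ∧ i = j) ∨ (t = 0 ∧ k = l) ∨ (k = l ∧ i = j) ∨
      (k ≠ l ∧ i ≠ j ∧ kS k = kS l ∧
        ((kX l - kX k) + ((i : ℝ) - j)) ≠ 0 ∧
        t * ((kX l - kX k) + ((i : ℝ) - j)) = kX l - kX k)) := by
  simp only [kArc, Prod.mk.injEq] at h
  obtain ⟨hx, hy⟩ := h
  have hts : t = s := by
    rcases kS_cases k with h1 | h1 <;> rcases kS_cases l with h2 | h2 <;>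
      rw [h1, h2] at hy <;> linarith
  subst hts
  refine ⟨rfl, ?_⟩
  by_cases t1 : t = 1
  · subst t1
    left
    exact ⟨rfl, by have : (i : ℝ) = j := by linarith
                   exact_mod_cast this⟩
  have hS : kS k = kS l := mul_left_cancel₀ (sub_ne_zero.mpr (Ne.symm t1)) hy
  by_cases hkl : k = l
  · subst hkl
    have h0 : t * ((i : ℝ) - j) = 0 := by linarith
    rcases mul_eq_zero.mp h0 with h0 | h0
    · exact Or.inr (Or.inl ⟨h0, rfl⟩)
    · exact Or.inr (Or.inr (Or.inl ⟨rfl, by exact_mod_cast sub_eq_zero.mp h0⟩))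
  have hX : kX k ≠ kX l := fun hX => hkl (kX_kS_inj hk hl hX hS)
  have hE : t * ((kX l - kX k) + ((i : ℝ) - j)) = kX l - kX k := by linarith
  refine Or.inr (Or.inr (Or.inr ⟨hkl, ?_, hS, ?_, hE⟩))
  · rintro rfl
    have h0 : (1 - t) * (kX k - kX l) = 0 := by linarith
    rcases mul_eq_zero.mp h0 with h0 | h0
    · exact t1 (by linarith)
    · exact hX (by linarith)
  · intro h0
    rw [h0, mul_zero] at hE
    exact hX (by linarith)

lemma kGraph_edge (m : ℕ) (e : (kGraph m).edgeSet) :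
    ∃ k i : Fin (4 + m), (k : ℕ) < 4 ∧ 4 ≤ (i : ℕ) ∧ (e : Sym2 (Fin (4 + m))) = s(k, i) := by
  obtain ⟨e, he⟩ := e
  induction e using Sym2.ind with
  | _ u v =>
    have h : ¬ ((u : ℕ) < 4 ↔ (v : ℕ) < 4) := he
    by_cases hu : (u : ℕ) < 4
    · exact ⟨u, v, hu, by simpa [hu] using h, rfl⟩
    · exact ⟨v, u, by simpa [hu] using h, by omega, Sym2.eq_swap⟩

lemma kGraph_fanPlanar (m : ℕ) : IsFanPlanar (kGraph m) := by
  choose K I hK hI hE using kGraph_edge m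
  have hext : ∀ e f, K e = K f → I e = I f → e = f := by
    intro e f h1 h2
    apply Subtype.ext
    rw [hE e, hE f, h1, h2]
  have hadj : ∀ e f : (kGraph m).edgeSet, (∃ w, w ∈ (e : Sym2 (Fin (4 + m))) ∧ w ∈ (f : Sym2 (Fin (4 + m)))) →
      K e = K f ∨ I e = I f := by
    rintro e f ⟨w, h1, h2⟩
    rw [hE, Sym2.mem_iff] at h1 h2
    rcases h1 with h1 | h1 <;> rcases h2 with h2 | h2
    · exact Or.inl (h1.symm.trans h2)
    · have := hK e; have := hI f; rw [← h1] at *; rw [← h2] at *; omega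
    · have := hK f; have := hI e; rw [← h1] at *; rw [← h2] at *; omega
    · exact Or.inr (h1.symm.trans h2)
  have memK : ∀ e : (kGraph m).edgeSet, K e ∈ (e : Sym2 (Fin (4 + m))) := fun e => by rw [hE]; simp
  have memI : ∀ e : (kGraph m).edgeSet, I e ∈ (e : Sym2 (Fin (4 + m))) := fun e => by rw [hE]; simp
  let D : Drawing (kGraph m) :=
    { vert := fun v => kVert v
      vert_inj := fun u v h => Fin.ext (kVert_inj h)
      arc := fun e => kArc (K e) (I e)
      arc_cont := fun e => by
        apply Continuous.continuousOn
        unfold kArc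
        fun_prop
      arc_inj := fun e t ht s hs h => (kArc_meet (hK e) (hK e) ht.2 hs.2 h).1
      arc_ends := fun e u v h => by
        rw [kArc_zero _ (hK e), kArc_one _ (hI e)]
        rw [hE, Sym2.eq_iff] at h
        rcases h with ⟨h1, h2⟩ | ⟨h1, h2⟩
        · rw [h1, h2]
        · rw [h1, h2, Set.pair_comm]
      arc_vertex := fun e t ht w h => by
        by_cases hw : (w : ℕ) < 4
        · rw [← kArc_zero (I e) hw] at h
          obtain ⟨h0, h⟩ := kArc_meet (hK e) hw ht.2 zero_le_one h
          subst h0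
          have : K e = w := by
            rcases h with h | h | h | h
            · exact absurd h.1 (by norm_num)
            · exact Fin.ext h.2
            · exact Fin.ext h.1
            · exact absurd rfl h.2.1
          exact this ▸ memK e
        · rw [← kArc_one (K e) (Nat.not_lt.mp hw)] at h
          obtain ⟨h0, h⟩ := kArc_meet (hK e) (hK e) ht.2 le_rfl h
          subst h0
          have : I e = w := by
            rcases h with h | h | h | h
            · exact Fin.ext h.2
            · exact absurd h.1 (by norm_num)
            · exact Fin.ext h.2
            · exact absurd rfl h.1
          exact this ▸ memI e
      adj_meet := by
        rintro e f hne hw p ⟨t, ht, rfl⟩ ⟨s, hs, hm⟩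
        obtain ⟨-, h⟩ := kArc_meet (hK e) (hK f) ht.2 hs.2 hm.symm
        rcases h with ⟨h1, h2⟩ | ⟨h1, h2⟩ | ⟨h1, h2⟩ | h
        · refine ⟨I e, memI e, ?_, ?_⟩
          · rw [Fin.ext h2]; exact memI f
          · rw [h1, kArc_one _ (hI e)]
        · refine ⟨K e, memK e, ?_, ?_⟩
          · rw [Fin.ext h2]; exact memK f
          · rw [h1, kArc_zero _ (hK e)]
        · exact absurd (hext e f (Fin.ext h1) (Fin.ext h2)) hne
        · rcases hadj e f hw with h' | h'
          · exact absurd (congrArg Fin.val h') h.1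
          · exact absurd (congrArg Fin.val h') h.2.1
      nonadj_meet := by
        rintro e f hw p ⟨⟨t, ht, rfl⟩, ⟨s, hs, h⟩⟩ q ⟨⟨t', ht', rfl⟩, ⟨s', hs', h'⟩⟩
        have hKn : (K e : ℕ) ≠ K f := fun hh => hw ⟨K e, memK e, by rw [Fin.ext hh]; exact memK f⟩
        have hIn : (I e : ℕ) ≠ I f := fun hh => hw ⟨I e, memI e, by rw [Fin.ext hh]; exact memI f⟩
        obtain ⟨-, h⟩ := kArc_meet (hK e) (hK f) ht.2 hs.2 h.symm
        obtain ⟨-, h'⟩ := kArc_meet (hK e) (hK f) ht'.2 hs'.2 h'.symm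
        simp only [hKn, hIn, and_false, false_or] at h h'
        have := mul_right_cancel₀ h.2.2.2.1 (h.2.2.2.2.trans h'.2.2.2.2.symm)
        rw [this] }
  have key : ∀ e f, D.Crosses e f → (K f : ℕ) ≠ K e ∧ kS (K f) = kS (K e) := by
    rintro e f ⟨hne, p, ⟨⟨t, ht, rfl⟩, ⟨s, hs, h⟩⟩, hp⟩
    have h : kArc (K f) (I f) s = kArc (K e) (I e) t := h
    have hp : ∀ w : Fin (4 + m), kVert w ≠ kArc (K e) (I e) t := hp
    obtain ⟨h0, h⟩ := kArc_meet (hK e) (hK f) ht.2 hs.2 h.symm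
    rcases h with ⟨h1, h2⟩ | ⟨h1, h2⟩ | ⟨h1, h2⟩ | h
    · exact absurd (by rw [h1, kArc_one _ (hI e)]) (hp (I e))
    · exact absurd (by rw [h1, kArc_zero _ (hK e)]) (hp (K e))
    · exact absurd (hext e f (Fin.ext h1) (Fin.ext h2)) hne
    · exact ⟨h.1.symm, h.2.2.1.symm⟩
  refine ⟨D, fun e ⟨f₀, hf₀⟩ => ⟨K f₀, fun f hf => ?_⟩⟩
  have h1 := key e f₀ hf₀
  have h2 := key e f hf
  have : K f₀ = K f := Fin.ext (kS_third (hK e) (hK f₀) (hK f) h1.1 h2.1 h1.2 h2.2)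
  rw [this]
  exact memK f

lemma kGraph_card (m : ℕ) : (kGraph m).edgeSet.ncard = 4 * m := by
  have h : (kGraph m).edgeSet =
      Set.range (fun x : Fin 4 × Fin m => s(Fin.castAdd m x.1, Fin.natAdd 4 x.2)) := by
    ext e
    constructor
    · intro he
      obtain ⟨k, i, hk, hi, h⟩ := kGraph_edge m ⟨e, he⟩
      refine ⟨(⟨k, hk⟩, ⟨i - 4, by omega⟩), ?_⟩
      simp only at h
      rw [h]
      have h2 : Fin.natAdd 4 (⟨i - 4, by omega⟩ : Fin m) = i := by
        apply Fin.ext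
        simp only [Fin.val_natAdd]
        omega
      simp only [h2]
      rfl
    · rintro ⟨⟨k, i⟩, rfl⟩
      change ¬ ((Fin.castAdd m k : ℕ) < 4 ↔ (Fin.natAdd 4 i : ℕ) < 4)
      simp
  rw [h, Set.ncard_range_of_injective]
  · simp
  · rintro ⟨k, i⟩ ⟨l, j⟩ h
    simp only [Sym2.eq_iff, Fin.ext_iff, Fin.val_castAdd, Fin.val_natAdd] at h
    have := k.2
    have := l.2
    ext <;> simp <;> omega

/-- For infinitely many values of `n`, there exists a bipartite
fan-planar simple graph with `n` vertices and exactly `4 n - 16` edges. -/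
theorem bipartite_fanplanar_simple_density_lower_bound :
    ∀ N : ℕ, ∃ n : ℕ, N ≤ n ∧ ∃ G : SimpleGraph (Fin n),
      IsBipartite G ∧ IsFanPlanar G ∧
      (G.edgeSet.ncard : ℝ) = 4 * n - 16 := by
  intro N
  refine ⟨4 + N, by omega, kGraph N, ⟨fun v => decide ((v : ℕ) < 4), ?_⟩,
    kGraph_fanPlanar N, ?_⟩
  · intro u v h h'
    exact h (by simpa using h')
  · rw [kGraph_card]
    push_cast
    ring
end

section
/- For infinitely many values of n, there exists a bipartite fan-planar multigraph with n vertices and exactly 4n − 12 edges. -/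
open Set

/-- A topological drawing in the plane of a multigraph with vertex set `V`, edge index
set `E`, and endpoint map `ends` (so parallel edges are allowed): vertices are mapped
to distinct points, each edge to a Jordan arc (parametrized over `[0,1]`) connecting
its two endpoints; no arc passes through a vertex other than its endpoints; edges
sharing an endpoint meet only at images of shared endpoints (adjacent edges do not
cross); independent edges meet in at most one point (no edge crosses another more than
once); and no two parallel edges are homotopic: both regions determined by two
parallel edges contain the image of some vertex. -/
structure MultiDrawing {V E : Type*} (ends : E → Sym2 V) where
  vert : V → ℝ × ℝ
  vert_inj : Function.Injective vert
  arc : E → ℝ → ℝ × ℝ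
  arc_cont : ∀ e, ContinuousOn (arc e) (Set.Icc 0 1)
  arc_inj : ∀ e, Set.InjOn (arc e) (Set.Icc 0 1)
  arc_ends : ∀ (e : E) (u v : V), ends e = s(u, v) →
      ({arc e 0, arc e 1} : Set (ℝ × ℝ)) = {vert u, vert v}
  arc_vertex : ∀ (e : E), ∀ t ∈ Set.Icc (0:ℝ) 1, ∀ w : V,
      arc e t = vert w → w ∈ ends e
  adj_meet : ∀ e f : E, e ≠ f →
      (∃ w : V, w ∈ ends e ∧ w ∈ ends f) →
      ∀ p ∈ arc e '' Set.Icc (0:ℝ) 1, p ∈ arc f '' Set.Icc (0:ℝ) 1 →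
        ∃ w : V, w ∈ ends e ∧ w ∈ ends f ∧ p = vert w
  nonadj_meet : ∀ e f : E,
      (¬ ∃ w : V, w ∈ ends e ∧ w ∈ ends f) →
      ((arc e '' Set.Icc (0:ℝ) 1) ∩ (arc f '' Set.Icc (0:ℝ) 1)).Subsingleton
  parallel_nonhomotopic : ∀ e f : E, e ≠ f → ends e = ends f →
      ∀ p : ℝ × ℝ, p ∉ (arc e '' Set.Icc (0:ℝ) 1) ∪ (arc f '' Set.Icc (0:ℝ) 1) →
        ∃ w : V, vert w ∈
          connectedComponentIn ((arc e '' Set.Icc (0:ℝ) 1) ∪ (arc f '' Set.Icc (0:ℝ) 1))ᶜ p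

/-- The image (point set) of an edge in a drawing of a multigraph. -/
def MultiDrawing.img {V E : Type*} {ends : E → Sym2 V} (D : MultiDrawing ends) (e : E) :
    Set (ℝ × ℝ) :=
  D.arc e '' Set.Icc (0:ℝ) 1

/-- Two edges of a multigraph cross in a drawing if they are distinct and meet at a
point that is not the image of any vertex. -/
def MultiDrawing.Crosses {V E : Type*} {ends : E → Sym2 V} (D : MultiDrawing ends)
    (e f : E) : Prop :=
  e ≠ f ∧ ∃ p ∈ D.img e ∩ D.img f, ∀ w : V, D.vert w ≠ p

/-- In the drawing `D`, every edge is crossed at most `k` times. -/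
def MultiDrawing.AtMostKCrossings {V E : Type*} {ends : E → Sym2 V}
    (D : MultiDrawing ends) (k : ℕ) : Prop :=
  ∀ e : E, {f : E | D.Crosses e f}.ncard ≤ k

/-- A multigraph (given by its endpoint map) is bipartite: its vertices can be split in
two parts such that every edge joins the two parts. -/
def MultiIsBipartite {V E : Type*} (ends : E → Sym2 V) : Prop :=
  ∃ c : V → Bool, ∀ (e : E) (u v : V), ends e = s(u, v) → c u ≠ c v

/-- A multigraph has no self-loops. -/
def NoLoops {V E : Type*} (ends : E → Sym2 V) : Prop :=
  ∀ e : E, ¬ (ends e).IsDiag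

/-- A multigraph is fan-planar if it admits a drawing in which, for every edge `e`, all
edges crossing `e` have a common endpoint (forming a fan at that vertex, which lies on
one side of `e`). -/
def MultiIsFanPlanar {V E : Type*} (ends : E → Sym2 V) : Prop :=
  ∃ D : MultiDrawing ends, ∀ e : E, (∃ f, D.Crosses e f) →
    ∃ v : V, ∀ f : E, D.Crosses e f → v ∈ ends f

namespace FanConstr

/-- Sign of a Boolean. -/
noncomputable def sg (b : Bool) : ℝ := if b then 1 else -1

/-- The abscissa of the `i`-th vertex on the axis. -/
noncomputable def ax (N : ℕ) (i : Fin (N + 2)) : ℝ := 2 * (i : ℕ) / ((N : ℝ) + 1) - 1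

abbrev VV (N : ℕ) := (Bool × Bool) ⊕ Fin (N + 2)
abbrev EE (N : ℕ) := (Bool × Bool) × Option (Fin (N + 2))

def foot {N : ℕ} : EE N → Fin (N + 2)
  | (_, some i) => i
  | ((true, _), none) => 0
  | ((false, _), none) => Fin.last (N + 1)

noncomputable def vt {N : ℕ} : VV N → ℝ × ℝ
  | Sum.inl (a, b) => (sg a, sg b)
  | Sum.inr i => (ax N i, 0)

noncomputable def ar {N : ℕ} : EE N → ℝ → ℝ × ℝ
  | ((a, b), some i), t => (sg a * (1 - t) + t * ax N i, sg b * (1 - t))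
  | ((a, b), none), t => (sg a * max (1 - 8 * t) (4 * t - 5), sg b * min (1 + 4 * t) (6 - 6 * t))

def en {N : ℕ} (e : EE N) : Sym2 (VV N) := s(Sum.inl e.1, Sum.inr (foot e))

lemma ax_inj {N : ℕ} {i j : Fin (N + 2)} (h : ax N i = ax N j) : i = j := by
  unfold ax at h
  have hN : (0:ℝ) < (N:ℝ) + 1 := by positivity
  have h2 : (2 * (i : ℕ) / ((N : ℝ) + 1)) = 2 * (j : ℕ) / ((N : ℝ) + 1) := by linarith
  rw [div_left_inj' hN.ne'] at h2
  have h3 : ((i : ℕ) : ℝ) = (j : ℕ) := by linarith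
  exact Fin.ext (by exact_mod_cast h3)

lemma ax_lo {N : ℕ} (i : Fin (N + 2)) : -1 ≤ ax N i := by
  unfold ax
  have : 0 ≤ 2 * ((i : ℕ) : ℝ) / ((N : ℝ) + 1) := by positivity
  linarith

lemma ax_hi {N : ℕ} (i : Fin (N + 2)) : ax N i ≤ 1 := by
  unfold ax
  have hN : (0:ℝ) < (N:ℝ) + 1 := by positivity
  have h1 : ((i : ℕ) : ℝ) ≤ (N : ℝ) + 1 := by
    have := i.2
    exact_mod_cast (by omega : (i : ℕ) ≤ N + 1)
  have : 2 * ((i : ℕ) : ℝ) / ((N : ℝ) + 1) ≤ 2 := by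
    rw [div_le_iff₀ hN]; linarith
  linarith

lemma ax_zero {N : ℕ} : ax N 0 = -1 := by simp [ax]

lemma ax_last {N : ℕ} : ax N (Fin.last (N + 1)) = 1 := by
  unfold ax
  have hN : (N:ℝ) + 1 ≠ 0 := by positivity
  simp only [Fin.val_last]
  push_cast
  field_simp
  norm_num

lemma leg (t : ℝ) :
    (t ≤ 1 / 2 ∧ max (1 - 8 * t) (4 * t - 5) = 1 - 8 * t ∧ min (1 + 4 * t) (6 - 6 * t) = 1 + 4 * t) ∨
    (1 / 2 ≤ t ∧ max (1 - 8 * t) (4 * t - 5) = 4 * t - 5 ∧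
      min (1 + 4 * t) (6 - 6 * t) = 6 - 6 * t) := by
  rcases le_total t (1 / 2) with h | h
  · left; exact ⟨h, max_eq_left (by linarith), min_eq_left (by linarith)⟩
  · right; exact ⟨h, max_eq_right (by linarith), min_eq_right (by linarith)⟩

@[simp] lemma sg_true : sg true = 1 := by simp [sg]
@[simp] lemma sg_false : sg false = -1 := by simp [sg]

lemma sg_inj {a b : Bool} (h : sg a = sg b) : a = b := by
  cases a <;> cases b <;> simp at h ⊢ <;> linarith

lemma vt_inj {N : ℕ} : Function.Injective (vt (N := N)) := by
  rintro (⟨a, b⟩ | i) (⟨c, d⟩ | j) h <;> simp only [vt, Prod.mk.injEq] at h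
  · rw [sg_inj h.1, sg_inj h.2]
  · exfalso; cases b <;> simp at h
  · exfalso; cases d <;> simp at h
  · rw [ax_inj h.1]

lemma ar_zero {N : ℕ} (e : EE N) : ar e 0 = vt (N := N) (Sum.inl e.1) := by
  rcases e with ⟨⟨a, b⟩, _ | i⟩ <;> simp [ar, vt] <;> norm_num

lemma ar_one {N : ℕ} (e : EE N) : ar e 1 = vt (Sum.inr (foot e)) := by
  rcases e with ⟨⟨a, b⟩, _ | i⟩
  · cases a <;> simp [ar, vt, foot, ax_zero, ax_last] <;> norm_num
  · simp [ar, vt, foot]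

lemma ar_cont {N : ℕ} (e : EE N) : Continuous (ar e) := by
  rcases e with ⟨⟨a, b⟩, _ | i⟩ <;> unfold ar <;> fun_prop

/-- height of an arc -/
lemma ar_height {N : ℕ} (e : EE N) (t : ℝ) (h0 : 0 ≤ t) (h1 : t ≤ 1) :
    ∃ y : ℝ, 0 ≤ y ∧ (ar e t).2 = sg e.1.2 * y ∧ (y = 0 → t = 1) := by
  rcases e with ⟨⟨a, b⟩, _ | i⟩
  · refine ⟨_, ?_, rfl, ?_⟩ <;> rcases leg t with ⟨h, h2, h3⟩ | ⟨h, h2, h3⟩ <;> rw [h3]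
    · linarith
    · linarith
    · intro; linarith
    · intro; linarith
  · exact ⟨1 - t, by linarith, rfl, by intro; linarith⟩

lemma ar_inj {N : ℕ} (e : EE N) : Set.InjOn (ar e) (Set.Icc 0 1) := by
  rintro t ⟨t0, t1⟩ u ⟨u0, u1⟩ h
  rcases e with ⟨⟨a, b⟩, _ | i⟩
  · simp only [ar, Prod.mk.injEq] at h
    obtain ⟨hx, hy⟩ := h
    rcases leg t with ⟨h, h2, h3⟩ | ⟨h, h2, h3⟩ <;>
    rcases leg u with ⟨h', h2', h3'⟩ | ⟨h', h2', h3'⟩ <;>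
    rw [h2, h2'] at hx <;> rw [h3, h3'] at hy <;>
    cases a <;> cases b <;> simp only [sg_true, sg_false] at hx hy <;> linarith
  · simp only [ar, Prod.mk.injEq] at h
    obtain ⟨hx, hy⟩ := h
    cases b <;> simp only [sg_true, sg_false] at hx hy <;> linarith

lemma ar_vertex {N : ℕ} (e : EE N) (t : ℝ) (h0 : 0 ≤ t) (h1 : t ≤ 1) (w : VV N)
    (h : ar e t = vt w) : w ∈ en e := by
  simp only [en, Sym2.mem_iff]
  rcases w with ⟨c, d⟩ | j
  · left
    congr 1
    rcases e with ⟨⟨a, b⟩, _ | i⟩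
    · simp only [ar, vt, Prod.mk.injEq] at h ⊢
      obtain ⟨hx, hy⟩ := h
      rcases leg t with ⟨h, h2, h3⟩ | ⟨h, h2, h3⟩ <;> rw [h2] at hx <;> rw [h3] at hy <;>
      cases a <;> cases b <;> cases c <;> cases d <;>
      simp only [sg_true, sg_false] at hx hy <;> first | exact ⟨rfl, rfl⟩ | (exfalso; linarith)
    · simp only [ar, vt, Prod.mk.injEq] at h ⊢
      obtain ⟨hx, hy⟩ := h
      have ht : t = 0 := by
        cases b <;> cases d <;> simp only [sg_true, sg_false] at hy <;> linarith
      subst ht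
      constructor
      · exact (sg_inj (by linarith)).symm
      · exact (sg_inj (by linarith)).symm
  · right
    congr 1
    obtain ⟨y, hy0, hy, hy1⟩ := ar_height e t h0 h1
    have : t = 1 := by
      apply hy1
      rw [h] at hy
      simp only [vt] at hy
      cases hb : e.1.2 <;> rw [hb] at hy <;> simp at hy <;> linarith
    subst this
    rw [ar_one] at h
    exact Sum.inr_injective (vt_inj h).symm

/-- Edges whose hubs are on different sides of the axis. -/
lemma meet_diff {N : ℕ} (e f : EE N) (hs : e.1.2 ≠ f.1.2) (t u : ℝ) (t0 : 0 ≤ t) (t1 : t ≤ 1)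
    (u0 : 0 ≤ u) (u1 : u ≤ 1) (h : ar e t = ar f u) : t = 1 ∧ u = 1 ∧ foot e = foot f := by
  obtain ⟨y, hy0, hy, hy1⟩ := ar_height e t t0 t1
  obtain ⟨z, hz0, hz, hz1⟩ := ar_height f u u0 u1
  rw [h, hz] at hy
  have : y = 0 ∧ z = 0 := by
    cases hb : e.1.2 <;> cases hc : f.1.2 <;> rw [hb, hc] at hy <;> rw [hb, hc] at hs <;>
      simp at hy hs <;> constructor <;> linarith
  have ht := hy1 this.1
  have hu := hz1 this.2
  refine ⟨ht, hu, ?_⟩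
  rw [ht, hu, ar_one, ar_one] at h
  exact Sum.inr_injective (vt_inj h)

lemma str_str {N : ℕ} (a b : Bool) (i j : Fin (N + 2)) (hij : i ≠ j) (t u : ℝ)
    (h : ar ((a, b), some i) t = ar ((a, b), some j) u) : t = 0 ∧ u = 0 := by
  simp only [ar, Prod.mk.injEq] at h
  obtain ⟨hx, hy⟩ := h
  have : t = u := by cases b <;> simp only [sg_true, sg_false] at hy <;> linarith
  subst this
  have h2 : t * (ax N i - ax N j) = 0 := by linarith
  have h3 : ax N i - ax N j ≠ 0 := fun h => hij (ax_inj (by linarith))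
  have := (mul_eq_zero.1 h2).resolve_right h3
  exact ⟨this, this⟩

lemma str_ext {N : ℕ} (a b : Bool) (i : Fin (N + 2)) (t u : ℝ) (t0 : 0 ≤ t) (t1 : t ≤ 1)
    (u0 : 0 ≤ u) (u1 : u ≤ 1)
    (h : ar ((a, b), some i) t = ar (((a, b), none) : EE N) u) : (t = 0 ∧ u = 0) ∨ (t = 1 ∧ u = 1) := by
  simp only [ar, Prod.mk.injEq] at h
  obtain ⟨hx, hy⟩ := h
  have l1 := mul_nonneg t0 (by linarith [ax_lo i] : 0 ≤ ax N i + 1)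
  have l2 := mul_nonneg t0 (by linarith [ax_hi i] : 0 ≤ 1 - ax N i)
  rcases leg u with ⟨h, h2, h3⟩ | ⟨h, h2, h3⟩ <;> rw [h2] at hx <;> rw [h3] at hy
  · left
    cases b <;> simp only [sg_true, sg_false] at hy <;> constructor <;> linarith
  · right
    cases a <;> cases b <;> simp only [sg_true, sg_false] at hx hy <;> constructor <;> nlinarith

lemma str_ext' {N : ℕ} (a b : Bool) (i : Fin (N + 2)) (t u : ℝ) (t0 : 0 ≤ t) (t1 : t ≤ 1)
    (u0 : 0 ≤ u) (u1 : u ≤ 1)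
    (h : ar ((!a, b), some i) t = ar (((a, b), none) : EE N) u) : t = 1 ∧ u = 1 := by
  simp only [ar, Prod.mk.injEq] at h
  obtain ⟨hx, hy⟩ := h
  have l1 := mul_nonneg t0 (by linarith [ax_lo i] : 0 ≤ ax N i + 1)
  have l2 := mul_nonneg t0 (by linarith [ax_hi i] : 0 ≤ 1 - ax N i)
  rcases leg u with ⟨h, h2, h3⟩ | ⟨h, h2, h3⟩ <;> rw [h2] at hx <;> rw [h3] at hy
  · exfalso
    have hu : u = 0 := by
      cases b <;> simp only [sg_true, sg_false] at hy <;> linarith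
    have ht : t = 0 := by
      cases b <;> simp only [sg_true, sg_false] at hy <;> linarith
    subst hu ht
    cases a <;> simp at hx <;> linarith
  · cases a <;> cases b <;> simp only [Bool.not_true, Bool.not_false, sg_true, sg_false] at hx hy <;>
      constructor <;> nlinarith

/-- Distinct edges at the same hub. -/
lemma meet_same {N : ℕ} (e f : EE N) (hef : e ≠ f) (hh : e.1 = f.1) (t u : ℝ) (t0 : 0 ≤ t)
    (t1 : t ≤ 1) (u0 : 0 ≤ u) (u1 : u ≤ 1) (h : ar e t = ar f u) :
    (t = 0 ∧ u = 0) ∨ (t = 1 ∧ u = 1 ∧ foot e = foot f) := by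
  have key : (t = 0 ∧ u = 0) ∨ (t = 1 ∧ u = 1) := by
    rcases e with ⟨⟨a, b⟩, _ | i⟩ <;> rcases f with ⟨⟨c, d⟩, _ | j⟩ <;>
      simp only [Prod.mk.injEq] at hh <;> obtain ⟨rfl, rfl⟩ := hh
    · exact absurd rfl hef
    · rcases str_ext a b j u t u0 u1 t0 t1 h.symm with ⟨h, h'⟩ | ⟨h, h'⟩
      · exact Or.inl ⟨h', h⟩
      · exact Or.inr ⟨h', h⟩
    · exact str_ext a b i t u t0 t1 u0 u1 h
    · refine Or.inl (str_str a b i j ?_ t u h)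
      rintro rfl
      exact hef rfl
  rcases key with h' | ⟨ht, hu⟩
  · exact Or.inl h'
  · rw [ht, hu, ar_one, ar_one] at h
    exact Or.inr ⟨ht, hu, Sum.inr_injective (vt_inj h)⟩

/-- Edges at opposite hubs on the same side of the axis. -/
lemma meet_opp {N : ℕ} (e f : EE N) (hs : e.1.2 = f.1.2) (hh : e.1.1 ≠ f.1.1) (t u : ℝ)
    (t0 : 0 ≤ t) (t1 : t ≤ 1) (u0 : 0 ≤ u) (u1 : u ≤ 1) (h : ar e t = ar f u)
    (hf : foot e = foot f) : t = 1 ∧ u = 1 := by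
  rcases e with ⟨⟨a, b⟩, _ | i⟩ <;> rcases f with ⟨⟨c, d⟩, _ | j⟩ <;>
    simp only at hh hs <;> subst hs
  · exfalso
    cases a <;> cases c <;> simp [foot, Fin.ext_iff] at hh hf
  · obtain rfl : c = !a := by cases a <;> cases c <;> simp at hh ⊢
    exact (str_ext' a b j u t u0 u1 t0 t1 h.symm).symm
  · obtain rfl : a = !c := by cases a <;> cases c <;> simp at hh ⊢
    exact (str_ext' c b i t u t0 t1 u0 u1 h)
  · simp only [foot] at hf
    subst hf
    simp only [ar, Prod.mk.injEq] at h
    obtain ⟨hx, hy⟩ := h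
    have : t = u := by cases b <;> simp only [sg_true, sg_false] at hy <;> linarith
    subst this
    cases a <;> cases c <;> simp only [sg_true, sg_false] at hx hh <;>
      first | exact absurd rfl hh | (constructor <;> linarith)

lemma meet_unique {N : ℕ} (e f : EE N) (hs : e.1.2 = f.1.2) (hh : e.1.1 ≠ f.1.1) (t u t' u' : ℝ)
    (t0 : 0 ≤ t) (t1 : t ≤ 1) (u0 : 0 ≤ u) (u1 : u ≤ 1) (h : ar e t = ar f u)
    (t0' : 0 ≤ t') (t1' : t' ≤ 1) (u0' : 0 ≤ u') (u1' : u' ≤ 1) (h' : ar e t' = ar f u') :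
    t = t' := by
  rcases e with ⟨⟨a, b⟩, _ | i⟩ <;> rcases f with ⟨⟨c, d⟩, _ | j⟩ <;>
    simp only at hh hs <;> subst hs
  · have key : ∀ t u : ℝ, 0 ≤ t → t ≤ 1 → 0 ≤ u → u ≤ 1 →
        ar (((a, b), none) : EE N) t = ar (((c, b), none) : EE N) u → t = 1 / 8 := by
      intro t u t0 t1 u0 u1 h
      simp only [ar, Prod.mk.injEq] at h
      obtain ⟨hx, hy⟩ := h
      rcases leg t with ⟨h, h2, h3⟩ | ⟨h, h2, h3⟩ <;>
      rcases leg u with ⟨h', h2', h3'⟩ | ⟨h', h2', h3'⟩ <;>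
      rw [h2, h2'] at hx <;> rw [h3, h3'] at hy <;>
      cases a <;> cases c <;> cases b <;> simp only [sg_true, sg_false] at hx hy hh <;>
      first | exact absurd rfl hh | linarith
    rw [key t u t0 t1 u0 u1 h, key t' u' t0' t1' u0' u1' h']
  · obtain rfl : c = !a := by cases a <;> cases c <;> simp at hh ⊢
    rw [(str_ext' a b j u t u0 u1 t0 t1 h.symm).2, (str_ext' a b j u' t' u0' u1' t0' t1' h'.symm).2]
  · obtain rfl : a = !c := by cases a <;> cases c <;> simp at hh ⊢
    rw [(str_ext' c b i t u t0 t1 u0 u1 h).1, (str_ext' c b i t' u' t0' t1' u0' u1' h').1]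
  · simp only [ar, Prod.mk.injEq] at h h'
    obtain ⟨hx, hy⟩ := h
    obtain ⟨hx', hy'⟩ := h'
    have e1 : t = u := by cases b <;> simp only [sg_true, sg_false] at hy <;> linarith
    have e2 : t' = u' := by cases b <;> simp only [sg_true, sg_false] at hy' <;> linarith
    subst e1 e2
    have hc : sg a - sg c ≠ 0 := fun h => hh (sg_inj (by linarith))
    have E1 : t * (ax N j - ax N i + (sg a - sg c)) = sg a - sg c := by linarith
    have E2 : t' * (ax N j - ax N i + (sg a - sg c)) = sg a - sg c := by linarith
    have hne : ax N j - ax N i + (sg a - sg c) ≠ 0 := by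
      intro h
      rw [h] at E1
      exact hc (by linarith)
    exact mul_right_cancel₀ hne (E1.trans E2.symm)

/-- The open triangle / half planes argument for the parallel pair. -/
lemma par_aux {N : ℕ} (a b : Bool) (i : Fin (N + 2)) (hi : i = foot (((a, b), none) : EE N))
    (p : ℝ × ℝ)
    (hp : p ∉ (ar (((a, b), some i) : EE N) '' Set.Icc (0:ℝ) 1) ∪
      (ar (((a, b), none) : EE N) '' Set.Icc (0:ℝ) 1)) :
    ∃ w : VV N, vt w ∈ connectedComponentIn
      ((ar (((a, b), some i) : EE N) '' Set.Icc (0:ℝ) 1) ∪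
        (ar (((a, b), none) : EE N) '' Set.Icc (0:ℝ) 1))ᶜ p := by
  have hai : ax N i = - sg a := by
    subst hi; cases a <;> simp [foot, ax_zero, ax_last]
  have sa : sg a * sg a = 1 := by cases a <;> simp
  have sb : sg b * sg b = 1 := by cases b <;> simp
  -- three linear functionals, nonnegative exactly on the triangle
  let X : ℝ × ℝ → ℝ := fun q => sg a * q.1
  let Y : ℝ × ℝ → ℝ := fun q => sg b * q.2
  let f1 : ℝ × ℝ → ℝ := fun q => 2 * Y q - X q - 1
  let f2 : ℝ × ℝ → ℝ := fun q => 3 - X q - 2 * Y q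
  let f3 : ℝ × ℝ → ℝ := fun q => 3 * X q + 2 * Y q + 3
  set S := (ar (((a, b), some i) : EE N) '' Set.Icc (0:ℝ) 1) ∪
        (ar (((a, b), none) : EE N) '' Set.Icc (0:ℝ) 1) with hS
  -- points of the arcs
  have hin : ∀ q ∈ S, 0 ≤ f1 q ∧ 0 ≤ f2 q ∧ 0 ≤ f3 q ∧ (f1 q = 0 ∨ f2 q = 0 ∨ f3 q = 0) := by
    rintro q (⟨t, ⟨t0, t1⟩, rfl⟩ | ⟨t, ⟨t0, t1⟩, rfl⟩)
    · have hX : X (ar (((a, b), some i) : EE N) t) = 1 - 2 * t := by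
        simp only [X, ar, hai]; linear_combination (1 - 2 * t) * sa
      have hY : Y (ar (((a, b), some i) : EE N) t) = 1 - t := by
        simp only [Y, ar]; linear_combination (1 - t) * sb
      simp only [f1, f2, f3, hX, hY]
      exact ⟨by linarith, by linarith, by linarith, Or.inl (by ring)⟩
    · have hX : X (ar (((a, b), none) : EE N) t) = max (1 - 8 * t) (4 * t - 5) := by
        simp only [X, ar, ← mul_assoc, sa, one_mul]
      have hY : Y (ar (((a, b), none) : EE N) t) = min (1 + 4 * t) (6 - 6 * t) := by
        simp only [Y, ar, ← mul_assoc, sb, one_mul]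
      simp only [f1, f2, f3, hX, hY]
      rcases leg t with ⟨h, h2, h3⟩ | ⟨h, h2, h3⟩ <;> rw [h2, h3]
      · exact ⟨by linarith, by linarith, by linarith, Or.inr (Or.inl (by ring))⟩
      · exact ⟨by linarith, by linarith, by linarith, Or.inr (Or.inr (by ring))⟩
  have back : ∀ q : ℝ × ℝ, q = (sg a * X q, sg b * Y q) := by
    intro q
    ext
    · simp only [X]; linear_combination -q.1 * sa
    · simp only [Y]; linear_combination -q.2 * sb
  have hbd : ∀ q, 0 ≤ f1 q → 0 ≤ f2 q → 0 ≤ f3 q → (f1 q = 0 ∨ f2 q = 0 ∨ f3 q = 0) → q ∈ S := by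
    intro q h1 h2 h3 h
    simp only [f1, f2, f3] at h1 h2 h3 h
    rcases h with h | h | h
    · left
      refine ⟨1 - Y q, ⟨by linarith, by linarith⟩, ?_⟩
      rw [back q]
      have hX : X q = 2 * Y q - 1 := by linarith
      simp only [ar, hai, Prod.mk.injEq]
      rw [← back q, hX]
      constructor <;> ring
    · right
      refine ⟨(Y q - 1) / 4, ⟨by linarith, by linarith⟩, ?_⟩
      have hX : X q = 3 - 2 * Y q := by linarith
      refine Eq.trans ?_ (back q).symm
      simp only [ar, Prod.mk.injEq]
      rcases leg ((Y q - 1) / 4) with ⟨h, h2, h3⟩ | ⟨h, h2, h3⟩ <;> rw [h2, h3, hX]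
      · constructor <;> ring
      · have : Y q = 3 := by linarith
        rw [this]; norm_num
    · right
      refine ⟨(6 - Y q) / 6, ⟨by linarith, by linarith⟩, ?_⟩
      have hX : X q = - 1 - 2 / 3 * Y q := by linarith
      refine Eq.trans ?_ (back q).symm
      simp only [ar, Prod.mk.injEq]
      rcases leg ((6 - Y q) / 6) with ⟨h, h2, h3⟩ | ⟨h, h2, h3⟩ <;> rw [h2, h3, hX]
      · have : Y q = 3 := by linarith
        rw [this]; norm_num
      · constructor <;> ring
  have conv : ∀ (α β γ : ℝ), Convex ℝ {q : ℝ × ℝ | α * q.1 + β * q.2 < γ} := by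
    intro α β γ
    have : IsLinearMap ℝ (fun q : ℝ × ℝ => α * q.1 + β * q.2) :=
      ⟨fun x y => by simp; ring, fun c x => by simp; ring⟩
    exact convex_halfSpace_lt this γ
  have c1 : Convex ℝ {q | f1 q < 0} := by
    convert conv (- sg a) (2 * sg b) 1 using 3 with q
    simp only [f1, X, Y]; constructor <;> intro h <;> linarith
  have c2 : Convex ℝ {q | f2 q < 0} := by
    convert conv (- sg a) (- 2 * sg b) (-3) using 3 with q
    simp only [f2, X, Y]; constructor <;> intro h <;> linarith
  have c3 : Convex ℝ {q | f3 q < 0} := by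
    convert conv (3 * sg a) (2 * sg b) (-3) using 3 with q
    simp only [f3, X, Y]; constructor <;> intro h <;> linarith
  have d1 : Convex ℝ {q | 0 < f1 q} := by
    convert conv (sg a) (- 2 * sg b) (-1) using 3 with q
    simp only [f1, X, Y]; constructor <;> intro h <;> linarith
  have d2 : Convex ℝ {q | 0 < f2 q} := by
    convert conv (sg a) (2 * sg b) (3) using 3 with q
    simp only [f2, X, Y]; constructor <;> intro h <;> linarith
  have d3 : Convex ℝ {q | 0 < f3 q} := by
    convert conv (- 3 * sg a) (- 2 * sg b) (3) using 3 with q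
    simp only [f3, X, Y]; constructor <;> intro h <;> linarith
  have hXY : ∀ x y : ℝ, X (sg a * x, sg b * y) = x ∧ Y (sg a * x, sg b * y) = y := by
    intro x y
    simp only [X, Y, ← mul_assoc, sa, sb, one_mul, and_self]
  by_cases hp' : 0 ≤ f1 p ∧ 0 ≤ f2 p ∧ 0 ≤ f3 p
  · obtain ⟨h1, h2, h3⟩ := hp'
    have hn : ¬ (f1 p = 0 ∨ f2 p = 0 ∨ f3 p = 0) := fun h => hp (hbd p h1 h2 h3 h)
    push Not at hn
    have k1 := lt_of_le_of_ne h1 (Ne.symm hn.1)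
    have k2 := lt_of_le_of_ne h2 (Ne.symm hn.2.1)
    have k3 := lt_of_le_of_ne h3 (Ne.symm hn.2.2)
    have hc : IsPreconnected ({q | 0 < f1 q} ∩ ({q | 0 < f2 q} ∩ {q | 0 < f3 q})) :=
      (d1.inter (d2.inter d3)).isPreconnected
    refine ⟨Sum.inl (!a, b), hc.subset_connectedComponentIn ⟨k1, k2, k3⟩ ?_ ?_⟩
    · rintro q ⟨q1, q2, q3⟩ hq
      simp only [Set.mem_ofPred_eq] at q1 q2 q3
      rcases (hin q hq).2.2.2 with h | h | h <;> linarith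
    · have hv : (vt (Sum.inl (!a, b)) : ℝ × ℝ) = vt (N := N) (Sum.inl (!a, b)) := rfl
      have e1 : X (vt (N := N) (Sum.inl (!a, b))) = -1 := by cases a <;> simp [X, vt]
      have e2 : Y (vt (N := N) (Sum.inl (!a, b))) = 1 := by simp only [Y, vt, sb]
      simp only [Set.mem_inter_iff, Set.mem_ofPred_eq, f1, f2, f3, e1, e2]
      norm_num
  · have hor : p ∈ {q | f1 q < 0} ∪ {q | f2 q < 0} ∪ {q | f3 q < 0} := by
      by_contra hcon
      simp only [Set.mem_union, Set.mem_ofPred_eq, not_or, not_lt] at hcon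
      exact hp' ⟨hcon.1.1, hcon.1.2, hcon.2⟩
    have hc12 : IsPreconnected ({q | f1 q < 0} ∪ {q | f2 q < 0}) := by
      refine IsPreconnected.union (sg a * 10, sg b * 0) ?_ ?_ c1.isPreconnected c2.isPreconnected <;>
      · simp only [Set.mem_ofPred_eq, f1, f2, (hXY 10 0).1, (hXY 10 0).2]; norm_num
    have hc : IsPreconnected ({q | f1 q < 0} ∪ {q | f2 q < 0} ∪ {q | f3 q < 0}) := by
      refine IsPreconnected.union (sg a * 0, sg b * (-10)) ?_ ?_ hc12 c3.isPreconnected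
      · left
        simp only [Set.mem_ofPred_eq, f1, (hXY 0 (-10)).1, (hXY 0 (-10)).2]; norm_num
      · simp only [Set.mem_ofPred_eq, f3, (hXY 0 (-10)).1, (hXY 0 (-10)).2]; norm_num
    refine ⟨Sum.inl (a, !b), hc.subset_connectedComponentIn hor ?_ ?_⟩
    · rintro q hq' hq
      obtain ⟨q1, q2, q3, -⟩ := hin q hq
      simp only [Set.mem_union, Set.mem_ofPred_eq] at hq'
      rcases hq' with (h | h) | h <;> linarith
    · left; left
      have e1 : X (vt (N := N) (Sum.inl (a, !b))) = 1 := by simp only [X, vt, sa]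
      have e2 : Y (vt (N := N) (Sum.inl (a, !b))) = -1 := by cases b <;> simp [Y, vt]
      simp only [Set.mem_ofPred_eq, f1, e1, e2]
      norm_num

lemma shared {N : ℕ} (e f : EE N) (hef : e ≠ f) (t u : ℝ) (t0 : 0 ≤ t) (t1 : t ≤ 1)
    (u0 : 0 ≤ u) (u1 : u ≤ 1) (h : ar e t = ar f u) :
    (∃ w, w ∈ en e ∧ w ∈ en f ∧ ar e t = vt w) ∨
      (e.1.2 = f.1.2 ∧ e.1.1 ≠ f.1.1 ∧ foot e ≠ foot f) := by
  have F : t = 1 → foot e = foot f → ∃ w, w ∈ en e ∧ w ∈ en f ∧ ar e t = vt w := by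
    intro ht hf
    refine ⟨Sum.inr (foot e), by simp [en], by simp [en, hf], ?_⟩
    rw [ht, ar_one]
  by_cases hs : e.1.2 = f.1.2
  · by_cases hh : e.1.1 = f.1.1
    · left
      have he : e.1 = f.1 := Prod.ext hh hs
      rcases meet_same e f hef he t u t0 t1 u0 u1 h with ⟨ht, hu⟩ | ⟨ht, hu, hf⟩
      · refine ⟨Sum.inl e.1, by simp [en], by simp [en, he], ?_⟩
        rw [ht, ar_zero]
      · exact F ht hf
    · by_cases hf : foot e = foot f
      · left
        exact F (meet_opp e f hs hh t u t0 t1 u0 u1 h hf).1 hf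
      · exact Or.inr ⟨hs, hh, hf⟩
  · left
    obtain ⟨ht, hu, hf⟩ := meet_diff e f hs t u t0 t1 u0 u1 h
    exact F ht hf

lemma mem_en {N : ℕ} (e : EE N) (w : VV N) :
    w ∈ en e ↔ w = Sum.inl e.1 ∨ w = Sum.inr (foot e) := by simp [en]

/-- The drawing. -/
noncomputable def drawing (N : ℕ) : MultiDrawing (en (N := N)) where
  vert := vt
  vert_inj := vt_inj
  arc := ar
  arc_cont e := (ar_cont e).continuousOn
  arc_inj := ar_inj
  arc_ends e u v h := by
    rw [ar_zero, ar_one]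
    simp only [en, Sym2.eq_iff] at h
    rcases h with ⟨rfl, rfl⟩ | ⟨rfl, rfl⟩
    · rfl
    · exact Set.pair_comm _ _
  arc_vertex e t ht w h := ar_vertex e t ht.1 ht.2 w h
  adj_meet := by
    rintro e f hef ⟨w, hwe, hwf⟩ p ⟨t, ⟨t0, t1⟩, rfl⟩ ⟨u, ⟨u0, u1⟩, h⟩
    rcases shared e f hef t u t0 t1 u0 u1 h.symm with h | ⟨-, hh, hf⟩
    · exact h
    · exfalso
      rw [mem_en] at hwe hwf
      rcases hwe with rfl | rfl <;> rcases hwf with h | h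
      · exact hh (congrArg Prod.fst (Sum.inl_injective h))
      · cases h
      · cases h
      · exact hf (Sum.inr_injective h)
  nonadj_meet := by
    rintro e f hna p ⟨⟨t, ⟨t0, t1⟩, rfl⟩, ⟨u, ⟨u0, u1⟩, h⟩⟩ q ⟨⟨t', ⟨t0', t1'⟩, rfl⟩, ⟨u', ⟨u0', u1'⟩, h'⟩⟩
    have hef : e ≠ f := by
      rintro rfl
      exact hna ⟨Sum.inl e.1, by simp [en], by simp [en]⟩
    rcases shared e f hef t u t0 t1 u0 u1 h.symm with ⟨w, h1, h2, -⟩ | ⟨hs, hh, -⟩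
    · exact absurd ⟨w, h1, h2⟩ hna
    · rw [meet_unique e f hs hh t u t' u' t0 t1 u0 u1 h.symm t0' t1' u0' u1' h'.symm]
  parallel_nonhomotopic := by
    rintro e f hef hee p hp
    simp only [en, Sym2.eq_iff, reduceCtorEq, false_and, and_false, or_false, Sum.inl.injEq,
      Sum.inr.injEq] at hee
    obtain ⟨h1, h2⟩ := hee
    rcases e with ⟨⟨a, b⟩, _ | i⟩ <;> rcases f with ⟨⟨c, d⟩, _ | j⟩ <;>
      simp only [Prod.mk.injEq] at h1 <;> obtain ⟨rfl, rfl⟩ := h1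
    · exact absurd rfl hef
    · rw [Set.union_comm] at hp ⊢
      exact par_aux a b j h2.symm p hp
    · exact par_aux a b i h2 p hp
    · exfalso
      simp only [foot] at h2
      subst h2
      exact hef rfl

lemma fan (N : ℕ) : MultiIsFanPlanar (en (N := N)) := by
  refine ⟨drawing N, fun e _ => ⟨Sum.inl (!e.1.1, e.1.2), ?_⟩⟩
  rintro f ⟨hef, p, ⟨⟨t, ⟨t0, t1⟩, rfl⟩, ⟨u, ⟨u0, u1⟩, h⟩⟩, hv⟩
  rcases shared e f hef t u t0 t1 u0 u1 h.symm with ⟨w, -, -, h1⟩ | ⟨hs, hh, -⟩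
  · exact absurd h1.symm (hv w)
  · rw [mem_en]
    left
    congr 1
    refine Prod.ext ?_ hs
    simp only
    cases h1 : e.1.1 <;> cases h2 : f.1.1 <;> simp [h1, h2] at hh ⊢

/-- Transport of a drawing along bijections. -/
def transport {V E V' E' : Type*} {ends : E → Sym2 V} (D : MultiDrawing ends) (σ : V' ≃ V)
    (τ : E' ≃ E) : MultiDrawing (fun e => (ends (τ e)).map σ.symm) where
  vert := D.vert ∘ σ
  vert_inj := D.vert_inj.comp σ.injective
  arc := D.arc ∘ τ
  arc_cont e := D.arc_cont _
  arc_inj e := D.arc_inj _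
  arc_ends e u v h := by
    refine D.arc_ends (τ e) (σ u) (σ v) ?_
    have := congrArg (Sym2.map σ) h
    simpa [Sym2.map_map] using this
  arc_vertex e t ht w h := by
    rw [Sym2.mem_map]
    exact ⟨σ w, D.arc_vertex (τ e) t ht (σ w) h, by simp⟩
  adj_meet := by
    rintro e f hef ⟨w, h1, h2⟩ p hp hq
    rw [Sym2.mem_map] at h1 h2
    obtain ⟨x, hx, rfl⟩ := h1
    obtain ⟨y, hy, hxy⟩ := h2
    obtain rfl := σ.symm.injective hxy
    obtain ⟨w, hw1, hw2, hw⟩ := D.adj_meet (τ e) (τ f) (τ.injective.ne hef) ⟨y, hx, hy⟩ p hp hq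
    exact ⟨σ.symm w, Sym2.mem_map.2 ⟨w, hw1, rfl⟩, Sym2.mem_map.2 ⟨w, hw2, rfl⟩, by simpa using hw⟩
  nonadj_meet := by
    intro e f h
    refine D.nonadj_meet (τ e) (τ f) ?_
    rintro ⟨w, h1, h2⟩
    exact h ⟨σ.symm w, Sym2.mem_map.2 ⟨w, h1, rfl⟩, Sym2.mem_map.2 ⟨w, h2, rfl⟩⟩
  parallel_nonhomotopic := by
    intro e f hef h p hp
    obtain ⟨w, hw⟩ := D.parallel_nonhomotopic (τ e) (τ f) (τ.injective.ne hef)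
      (Sym2.map.injective σ.symm.injective h) p hp
    exact ⟨σ.symm w, by simpa using hw⟩

lemma fan_transport {V E V' E' : Type*} {ends : E → Sym2 V} (h : MultiIsFanPlanar ends)
    (σ : V' ≃ V) (τ : E' ≃ E) : MultiIsFanPlanar (fun e => (ends (τ e)).map σ.symm) := by
  obtain ⟨D, hD⟩ := h
  have key : ∀ e f, (transport D σ τ).Crosses e f → D.Crosses (τ e) (τ f) := by
    rintro e f ⟨hef, p, hp, hv⟩
    refine ⟨τ.injective.ne hef, p, hp, fun w hw => hv (σ.symm w) ?_⟩
    simpa [transport] using hw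
  refine ⟨transport D σ τ, ?_⟩
  rintro e ⟨f, hf⟩
  obtain ⟨v, hv⟩ := hD (τ e) ⟨τ f, key e f hf⟩
  exact ⟨σ.symm v, fun g hg => Sym2.mem_map.2 ⟨v, hv _ (key e g hg), rfl⟩⟩

end FanConstr

/-- For infinitely many values of `n`, there exists a bipartite
fan-planar multigraph with `n` vertices and exactly `4 n - 12` edges. -/
theorem bipartite_fanplanar_multigraph_density_lower_bound :
    ∀ N : ℕ, ∃ n : ℕ, N ≤ n ∧ ∃ (m : ℕ) (ends : Fin m → Sym2 (Fin n)),
      NoLoops ends ∧ MultiIsBipartite ends ∧ MultiIsFanPlanar ends ∧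
      (m : ℝ) = 4 * n - 12 := by
  intro N
  have cV : Fintype.card (FanConstr.VV N) = N + 6 := by simp; omega
  have cE : Fintype.card (FanConstr.EE N) = 4 * N + 12 := by simp; omega
  let σ : Fin (N + 6) ≃ FanConstr.VV N := (Fintype.equivFinOfCardEq cV).symm
  let τ : Fin (4 * N + 12) ≃ FanConstr.EE N := (Fintype.equivFinOfCardEq cE).symm
  refine ⟨N + 6, by omega, 4 * N + 12, fun e => (FanConstr.en (τ e)).map σ.symm, ?_, ?_,
    FanConstr.fan_transport (FanConstr.fan N) σ τ, by push_cast; ring⟩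
  · intro e h
    simp [FanConstr.en] at h
  · refine ⟨fun v => (σ v).isLeft, ?_⟩
    intro e u v h
    simp only [FanConstr.en, Sym2.map_mk, Sym2.eq_iff] at h
    rcases h with ⟨rfl, rfl⟩ | ⟨rfl, rfl⟩ <;> simp
end

section
/- For infinitely many values of n, there exists a bipartite 2-planar simple graph with n vertices and exactly 3.5n − 12 edges. -/
open Set

/-- A graph is 2-planar if it admits a drawing in which every edge is crossed at most
2 times. -/
def IsTwoPlanar {V : Type*} (G : SimpleGraph V) : Prop :=
  ∃ D : Drawing G, D.AtMostKCrossings 2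


namespace TwoPl

/-- Integer points. -/
abbrev IP := ℤ × ℤ

/-- Local edges: two local vertex numbers and a shape code (`0` is straight). -/
abbrev LE := ℕ × ℕ × ℕ

/-- Base positions of the 16 vertices (two rings) of a block. -/
def base : ℕ → IP
  | 0 => (3, 0) | 1 => (1, 1) | 2 => (0, 3) | 3 => (-1, 1)
  | 4 => (-3, 0) | 5 => (-1, -1) | 6 => (0, -3) | 7 => (1, -1)
  | 8 => (4, 0) | 9 => (5, 5) | 10 => (0, 4) | 11 => (-5, 5)
  | 12 => (-4, 0) | 13 => (-5, -5) | 14 => (0, -4) | 15 => (5, -5)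
  | _ => (0, 0)

def scl (d : ℕ) (p : IP) : IP := (6 ^ d * p.1, 6 ^ d * p.2)

def pos (j : ℕ) : IP := scl (j / 16) (base (j % 16))

def eH : List LE := [
  (1, 2, 0), (3, 4, 0), (5, 6, 0), (7, 0, 0), (9, 10, 0), (11, 12, 0), (13, 14, 0), (15, 8, 0)]

def eR : List LE := [
  (0, 2, 0), (8, 10, 0), (2, 4, 0), (10, 12, 0), (4, 6, 0), (12, 14, 0), (6, 0, 0), (14, 8, 0),
  (0, 8, 0), (1, 9, 0), (2, 10, 0), (3, 11, 0), (4, 12, 0), (5, 13, 0), (6, 14, 0), (7, 15, 0),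
  (0, 9, 0), (1, 8, 0), (2, 11, 0), (3, 10, 0), (4, 13, 0), (5, 12, 0), (6, 15, 0), (7, 14, 0),
  (9, 11, 0), (17, 19, 0), (11, 13, 0), (19, 21, 0), (13, 15, 0), (21, 23, 0), (15, 9, 0),
  (23, 17, 0), (8, 16, 0), (9, 17, 0), (10, 18, 0), (11, 19, 0), (12, 20, 0), (13, 21, 0),
  (14, 22, 0), (15, 23, 0), (8, 17, 0), (9, 16, 0), (10, 19, 0), (11, 18, 0), (12, 21, 0),
  (13, 20, 0), (14, 23, 0), (15, 22, 0)]

def eBot : List LE := [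
  (1, 3, 0), (3, 5, 0), (5, 7, 0), (7, 1, 0), (0, 3, 0), (4, 7, 0)]

def eTH : List LE := [
  (1, 2, 0), (3, 4, 0), (5, 6, 0), (7, 0, 0)]

def eTR : List LE := [
  (0, 2, 0), (2, 4, 0), (4, 6, 0), (6, 0, 0), (0, 3, 1), (4, 7, 2)]

def eB : List LE := eH ++ eR
def eLow : List LE := eB ++ eBot
def eTop : List LE := eTH ++ eTR
def eUp : List LE := eB ++ eTop

/-- The segments making up a local edge. -/
def segs (e : LE) : List (IP × IP) :=
  match e.2.2 with
  | 0 => [(pos e.1, pos e.2.1)]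
  | 1 => [((3, 0), (0, 4)), ((0, 4), (-1, 1))]
  | _ => [((-3, 0), (0, -4)), ((0, -4), (1, -1))]

def lin (l p : IP) : ℤ := l.1 * p.1 + l.2 * p.2

def cands (s t : IP × IP) : List IP :=
  let u : IP := (s.2.1 - s.1.1, s.2.2 - s.1.2)
  let v : IP := (t.2.1 - t.1.1, t.2.2 - t.1.2)
  [(-u.2, u.1), (u.2, -u.1), (-v.2, v.1), (v.2, -v.1), u, (-u.1, -u.2), v, (-v.1, -v.2)]

def sepT (s t : IP × IP) (l : IP) : Bool :=
  decide (lin l s.1 < lin l t.1) && decide (lin l s.1 < lin l t.2) &&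
  decide (lin l s.2 < lin l t.1) && decide (lin l s.2 < lin l t.2)

def disjT (s t : IP × IP) : Bool := (cands s t).any (sepT s t)

def halfT (w : IP) (s t : IP × IP) (l : IP) : Bool :=
  ((decide (s.1 = w) && decide (lin l w < lin l s.2)) ||
    (decide (s.2 = w) && decide (lin l w < lin l s.1))) &&
  decide (lin l t.1 ≤ lin l w) && decide (lin l t.2 ≤ lin l w)

def onlyT (w : IP) (s t : IP × IP) : Bool :=
  disjT s t || (cands s t).any (fun l => halfT w s t l || halfT w t s l)

def detT (s t : IP × IP) : Bool :=
  decide ((s.2.1 - s.1.1) * (t.2.2 - t.1.2) - (s.2.2 - s.1.2) * (t.2.1 - t.1.1) ≠ 0)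

def sclS (d : ℕ) (S : List (IP × IP)) : List (IP × IP) := S.map fun s => (scl d s.1, scl d s.2)

def allT (S S' : List (IP × IP)) (P : IP × IP → IP × IP → Bool) : Bool :=
  S.all fun s => S'.all fun t => P s t

def crossT (S S' : List (IP × IP)) : Bool :=
  match S, S' with
  | [s], [t] => detT s t
  | [s], [t, t'] => (detT s t && disjT s t') || (detT s t' && disjT s t)
  | [s, s'], [t] => (detT s t && disjT s' t) || (detT s' t && disjT s t)
  | _, _ => false

def noShare (a b a' b' : ℕ) : Bool :=
  decide (a ≠ a') && decide (a ≠ b') && decide (b ≠ a') && decide (b ≠ b')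

def bad (e f : LE) : Bool :=
  noShare e.1 e.2.1 f.1 f.2.1 && !(allT (segs e) (segs f) disjT)

/-- Compatibility of the edge `e` with the edge `f` lying `d` blocks further. -/
def chk (d : ℕ) (e f : LE) : Bool :=
  let a := e.1
  let b := e.2.1
  let a' := f.1 + 16 * d
  let b' := f.2.1 + 16 * d
  let S := segs e
  let S' := sclS d (segs f)
  if a = a' then decide (b ≠ b') && allT S S' (onlyT (pos a))
  else if a = b' then decide (b ≠ a') && allT S S' (onlyT (pos a))
  else if b = a' then allT S S' (onlyT (pos b))
  else if b = b' then allT S S' (onlyT (pos b))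
  else allT S S' disjT || (decide (d = 0) && crossT S (segs f))

def dirs : List IP := [(1, 0), (-1, 0), (0, 1), (0, -1), (1, 1), (1, -1), (-1, 1), (-1, -1)]

def farT (f : LE) : Bool :=
  (segs f).all fun t => dirs.any fun l =>
    decide (0 < lin l t.1) && decide (0 < lin l t.2) &&
    (List.range 24).all fun j =>
      decide (lin l (pos j) < 36 * lin l t.1) && decide (lin l (pos j) < 36 * lin l t.2)

theorem c00 : (eLow.all fun e => eLow.all fun f => decide (e = f) || chk 0 e f) = true := by
  decide +kernel
theorem cTT : (eTop.all fun e => eTop.all fun f => decide (e = f) || chk 0 e f) = true := by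
  decide +kernel
theorem c01 : (eLow.all fun e => eUp.all fun f => chk 1 e f) = true := by
  decide +kernel
theorem cbad : (eLow.all fun e => decide ((eLow.filter (bad e)).length ≤ 2)) = true := by
  decide +kernel
theorem cbadT : (eTop.all fun e => decide ((eTop.filter (bad e)).length ≤ 2)) = true := by
  decide +kernel
theorem cH : (eH.all fun e => eLow.all fun f => !bad e f) = true := by decide +kernel
theorem cTH : (eTH.all fun e => eTop.all fun f => !bad e f) = true := by decide +kernel
theorem cfar : (eUp.all farT) = true := by decide +kernel
theorem cLow : (eLow.all fun e => decide (e.2.2 = 0) && decide (e.1 < 24) &&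
    decide (e.2.1 < 24) && decide (pos e.1 ≠ pos e.2.1)) = true := by decide +kernel
theorem cTop : (eTop.all fun e => decide (e.1 < 8) && decide (e.2.1 < 8) &&
    decide (pos e.1 ≠ pos e.2.1)) = true := by decide +kernel
theorem ccov : ((List.range 16).all fun j => eH.any fun e =>
    decide (e.1 = j) || decide (e.2.1 = j)) = true := by decide +kernel
theorem ccovT : ((List.range 8).all fun j => eTH.any fun e =>
    decide (e.1 = j) || decide (e.2.1 = j)) = true := by decide +kernel
theorem cbot : (eBot.all fun e => decide (e.1 < 8) && decide (e.2.1 < 8)) = true := by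
  decide +kernel
theorem cshape : (eTop.all fun e => decide (e.2.2 = 0) || decide (e = (0, 3, 1)) ||
    decide (e = (4, 7, 2))) = true := by decide +kernel
def colr (j : ℕ) : Bool := xor (decide (j % 4 < 2)) (decide (j / 8 % 2 = 0))
theorem ccol : ((eLow ++ eTop).all fun e => decide (colr e.1 ≠ colr e.2.1)) = true := by
  decide +kernel
theorem cnodB : eB.Nodup := by decide +kernel
theorem cnodBot : eBot.Nodup := by decide +kernel
theorem cnodT : eTop.Nodup := by decide +kernel
theorem cdjB : (eB.all fun e => !eBot.contains e) = true := by decide +kernel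

noncomputable def R (k : ℕ) (p : IP) : ℝ × ℝ := (6 ^ k * (p.1 : ℝ), 6 ^ k * (p.2 : ℝ))

noncomputable def L (l : IP) (x : ℝ × ℝ) : ℝ := l.1 * x.1 + l.2 * x.2

theorem L_R (l : IP) (k : ℕ) (p : IP) : L l (R k p) = 6 ^ k * (lin l p : ℝ) := by
  simp only [L, R, lin]; push_cast; ring

theorem R_scl (k d : ℕ) (p : IP) : R k (scl d p) = R (k + d) p := by
  simp only [R, scl]; push_cast; ext <;> simp only [] <;> ring

theorem R_inj {k : ℕ} {p q : IP} (h : R k p = R k q) : p = q := by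
  have h6 : (6 : ℝ) ^ k ≠ 0 := by positivity
  simp only [R, Prod.mk.injEq] at h
  obtain ⟨h1, h2⟩ := h
  have h1 := mul_left_cancel₀ h6 h1
  have h2 := mul_left_cancel₀ h6 h2
  exact Prod.ext (by exact_mod_cast h1) (by exact_mod_cast h2)

def sg (k : ℕ) (s : IP × IP) : Set (ℝ × ℝ) := segment ℝ (R k s.1) (R k s.2)

theorem L_mem {l : IP} {k : ℕ} {s : IP × IP} {x : ℝ × ℝ} (h : x ∈ sg k s) :
    ∃ a b : ℝ, 0 ≤ a ∧ 0 ≤ b ∧ a + b = 1 ∧ x = a • R k s.1 + b • R k s.2 ∧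
      L l x = 6 ^ k * (a * lin l s.1 + b * lin l s.2) := by
  obtain ⟨a, b, ha, hb, hab, rfl⟩ := h
  refine ⟨a, b, ha, hb, hab, rfl, ?_⟩
  simp only [L, R, lin, Prod.fst_add, Prod.snd_add, Prod.smul_fst, Prod.smul_snd, smul_eq_mul]
  push_cast; ring

theorem L_lt {l : IP} {k : ℕ} {s : IP × IP} {x : ℝ × ℝ} (h : x ∈ sg k s) (c : ℝ)
    (h1 : 6 ^ k * (lin l s.1 : ℝ) < c) (h2 : 6 ^ k * (lin l s.2 : ℝ) < c) : L l x < c := by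
  obtain ⟨a, b, ha, hb, hab, -, hx⟩ := L_mem (l := l) h
  rw [hx]
  have hc : c = a * c + b * c := by rw [← add_mul, hab, one_mul]
  rcases ha.eq_or_lt with h0 | h0
  · subst h0
    have : b = 1 := by linarith
    subst this; linarith
  · have q1 := mul_lt_mul_of_pos_left h1 h0
    have q2 := mul_le_mul_of_nonneg_left h2.le hb
    linarith

theorem L_gt {l : IP} {k : ℕ} {s : IP × IP} {x : ℝ × ℝ} (h : x ∈ sg k s) (c : ℝ)
    (h1 : c < 6 ^ k * (lin l s.1 : ℝ)) (h2 : c < 6 ^ k * (lin l s.2 : ℝ)) : c < L l x := by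
  obtain ⟨a, b, ha, hb, hab, -, hx⟩ := L_mem (l := l) h
  rw [hx]
  have hc : c = a * c + b * c := by rw [← add_mul, hab, one_mul]
  rcases ha.eq_or_lt with h0 | h0
  · subst h0
    have : b = 1 := by linarith
    subst this; linarith
  · have q1 := mul_lt_mul_of_pos_left h1 h0
    have q2 := mul_le_mul_of_nonneg_left h2.le hb
    linarith

theorem L_le {l : IP} {k : ℕ} {s : IP × IP} {x : ℝ × ℝ} (h : x ∈ sg k s) (c : ℝ)
    (h1 : 6 ^ k * (lin l s.1 : ℝ) ≤ c) (h2 : 6 ^ k * (lin l s.2 : ℝ) ≤ c) : L l x ≤ c := by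
  obtain ⟨a, b, ha, hb, hab, -, hx⟩ := L_mem (l := l) h
  rw [hx]
  have hc : c = a * c + b * c := by rw [← add_mul, hab, one_mul]
  have q1 := mul_le_mul_of_nonneg_left h1 ha
  have q2 := mul_le_mul_of_nonneg_left h2 hb
  linarith

theorem disjT_sound {s t : IP × IP} (h : disjT s t = true) (k : ℕ) {x : ℝ × ℝ}
    (hs : x ∈ sg k s) (ht : x ∈ sg k t) : False := by
  simp only [disjT, List.any_eq_true] at h
  obtain ⟨l, -, h⟩ := h
  simp only [sepT, Bool.and_eq_true, decide_eq_true_eq] at h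
  obtain ⟨⟨⟨h1, h2⟩, h3⟩, h4⟩ := h
  have h6 : (0 : ℝ) < 6 ^ k := by positivity
  have key : ∀ {a b : ℤ}, a < b → (6 : ℝ) ^ k * a < 6 ^ k * b := fun h =>
    mul_lt_mul_of_pos_left (by exact_mod_cast h) h6
  have e1 : L l x < 6 ^ k * (lin l t.1 : ℝ) := L_lt hs _ (key h1) (key h3)
  have e2 : L l x < 6 ^ k * (lin l t.2 : ℝ) := L_lt hs _ (key h2) (key h4)
  exact lt_irrefl _ (L_gt ht _ e1 e2)

theorem halfT_sound {w : IP} {s t : IP × IP} {l : IP} (h : halfT w s t l = true) (k : ℕ)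
    {x : ℝ × ℝ} (hs : x ∈ sg k s) (ht : x ∈ sg k t) : x = R k w := by
  simp only [halfT, Bool.and_eq_true, Bool.or_eq_true, decide_eq_true_eq] at h
  obtain ⟨⟨h1, h2⟩, h3⟩ := h
  have h6 : (0 : ℝ) < 6 ^ k := by positivity
  have hle : L l x ≤ 6 ^ k * (lin l w : ℝ) := L_le ht _
    (mul_le_mul_of_nonneg_left (by exact_mod_cast h2) h6.le)
    (mul_le_mul_of_nonneg_left (by exact_mod_cast h3) h6.le)
  obtain ⟨a, b, ha, hb, hab, hxx, hx⟩ := L_mem (l := l) hs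
  rw [hx] at hle
  have hle := le_of_mul_le_mul_left hle h6
  rcases h1 with ⟨h1, h4⟩ | ⟨h1, h4⟩
  · have h4 : (lin l w : ℝ) < lin l s.2 := by exact_mod_cast h4
    rw [h1] at hle hxx
    have : b = 0 := by
      by_contra hne
      have : 0 < b := lt_of_le_of_ne hb (Ne.symm hne)
      have ha' : a = 1 - b := by linarith
      subst ha'; nlinarith
    subst this
    have : a = 1 := by linarith
    subst this
    simpa using hxx
  · have h4 : (lin l w : ℝ) < lin l s.1 := by exact_mod_cast h4
    rw [h1] at hle hxx
    have : a = 0 := by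
      by_contra hne
      have : 0 < a := lt_of_le_of_ne ha (Ne.symm hne)
      have ha' : b = 1 - a := by linarith
      subst ha'; nlinarith
    subst this
    have : b = 1 := by linarith
    subst this
    simpa using hxx

theorem onlyT_sound {w : IP} {s t : IP × IP} (h : onlyT w s t = true) (k : ℕ)
    {x : ℝ × ℝ} (hs : x ∈ sg k s) (ht : x ∈ sg k t) : x = R k w := by
  simp only [onlyT, Bool.or_eq_true, List.any_eq_true] at h
  rcases h with h | ⟨l, -, h | h⟩
  · exact (disjT_sound h k hs ht).elim
  · exact halfT_sound h k hs ht
  · exact halfT_sound h k ht hs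

theorem detT_sound {s t : IP × IP} (h : detT s t = true) (k : ℕ) {x y : ℝ × ℝ}
    (hs : x ∈ sg k s) (ht : x ∈ sg k t) (hs' : y ∈ sg k s) (ht' : y ∈ sg k t) : x = y := by
  simp only [detT, decide_eq_true_eq] at h
  have hr : ((s.2.1 : ℝ) - s.1.1) * (t.2.2 - t.1.2) - (s.2.2 - s.1.2) * (t.2.1 - t.1.1) ≠ 0 := by
    exact_mod_cast h
  have h6 : (6 : ℝ) ^ k ≠ 0 := by positivity
  obtain ⟨a, b, -, -, hab, rfl⟩ := hs
  obtain ⟨a', b', -, -, hab', rfl⟩ := hs'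
  obtain ⟨c, d, -, -, hcd, h1⟩ := ht
  obtain ⟨c', d', -, -, hcd', h2⟩ := ht'
  have ea : a = 1 - b := by linarith
  have ea' : a' = 1 - b' := by linarith
  have ec : c = 1 - d := by linarith
  have ec' : c' = 1 - d' := by linarith
  subst ea ea' ec ec'
  simp only [R, Prod.ext_iff, Prod.fst_add, Prod.snd_add, Prod.smul_fst, Prod.smul_snd,
    smul_eq_mul] at h1 h2
  obtain ⟨h11, h12⟩ := h1
  obtain ⟨h21, h22⟩ := h2
  have hz : (6 ^ k * (b - b')) *
    (((s.2.1 : ℝ) - s.1.1) * (t.2.2 - t.1.2) - (s.2.2 - s.1.2) * (t.2.1 - t.1.1)) = 0 := by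
    linear_combination (t.2.2 - t.1.2 : ℝ) * (h21 - h11) - (t.2.1 - t.1.1 : ℝ) * (h22 - h12)
  have hb : b = b' := by
    rcases mul_eq_zero.1 hz with h | h
    · rcases mul_eq_zero.1 h with h | h
      · exact (h6 h).elim
      · linarith
    · exact (hr h).elim
  rw [hb]

/-- The point set containing a local edge placed in block `k`. -/
def im (k : ℕ) (S : List (IP × IP)) : Set (ℝ × ℝ) := {x | ∃ s ∈ S, x ∈ sg k s}

theorem im_scl (k d : ℕ) (S : List (IP × IP)) : im k (sclS d S) = im (k + d) S := by
  ext x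
  simp only [im, sclS, List.mem_map, Set.mem_ofPred_eq]
  constructor
  · rintro ⟨_, ⟨s, hs, rfl⟩, h⟩
    exact ⟨s, hs, by simpa only [sg, R_scl] using h⟩
  · rintro ⟨s, hs, h⟩
    exact ⟨_, ⟨s, hs, rfl⟩, by simpa only [sg, R_scl] using h⟩

theorem allT_disj {S S' : List (IP × IP)} (h : allT S S' disjT = true) (k : ℕ) {x : ℝ × ℝ}
    (hs : x ∈ im k S) (ht : x ∈ im k S') : False := by
  obtain ⟨s, hs, hx⟩ := hs
  obtain ⟨t, ht, hx'⟩ := ht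
  simp only [allT, List.all_eq_true] at h
  exact disjT_sound (h s hs t ht) k hx hx'

theorem allT_only {w : IP} {S S' : List (IP × IP)} (h : allT S S' (onlyT w) = true) (k : ℕ)
    {x : ℝ × ℝ} (hs : x ∈ im k S) (ht : x ∈ im k S') : x = R k w := by
  obtain ⟨s, hs, hx⟩ := hs
  obtain ⟨t, ht, hx'⟩ := ht
  simp only [allT, List.all_eq_true] at h
  exact onlyT_sound (h s hs t ht) k hx hx'

theorem crossT_sound {S S' : List (IP × IP)} (h : crossT S S' = true) (k : ℕ) :
    (im k S ∩ im k S').Subsingleton := by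
  rintro x ⟨⟨s, hs, hxs⟩, ⟨t, ht, hxt⟩⟩ y ⟨⟨s', hs', hys⟩, ⟨t', ht', hyt⟩⟩
  unfold crossT at h
  split at h
  · simp only [List.mem_singleton] at hs ht hs' ht'
    subst hs ht hs' ht'
    exact detT_sound h k hxs hxt hys hyt
  · simp only [List.mem_cons, List.not_mem_nil, or_false, Bool.or_eq_true,
      Bool.and_eq_true] at hs ht hs' ht' h
    subst hs hs'
    rcases h with ⟨h1, h2⟩ | ⟨h1, h2⟩ <;> rcases ht with rfl | rfl <;>
      rcases ht' with rfl | rfl <;>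
      first
        | exact detT_sound h1 k hxs hxt hys hyt
        | exact (disjT_sound h2 k hxs hxt).elim
        | exact (disjT_sound h2 k hys hyt).elim
  · simp only [List.mem_cons, List.not_mem_nil, or_false, Bool.or_eq_true,
      Bool.and_eq_true] at hs ht hs' ht' h
    subst ht ht'
    rcases h with ⟨h1, h2⟩ | ⟨h1, h2⟩ <;> rcases hs with rfl | rfl <;>
      rcases hs' with rfl | rfl <;>
      first
        | exact detT_sound h1 k hxs hxt hys hyt
        | exact (disjT_sound h2 k hxs hxt).elim
        | exact (disjT_sound h2 k hys hyt).elim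
  · simp at h

noncomputable def vt (v : ℕ) : ℝ × ℝ := R (v / 16) (base (v % 16))

theorem vt_eq (k a : ℕ) : vt (16 * k + a) = R k (pos a) := by
  rw [pos, R_scl, vt]
  congr 2
  · omega
  · omega

def isEnd (k : ℕ) (e : LE) (w : ℕ) : Prop := w = 16 * k + e.1 ∨ w = 16 * k + e.2.1

/-- The possible relations of two different edges. -/
def Rel (k : ℕ) (e : LE) (k' : ℕ) (f : LE) : Prop :=
  (∃ w, isEnd k e w ∧ isEnd k' f w ∧ (∀ w', isEnd k e w' → isEnd k' f w' → w' = w) ∧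
    ∀ x, x ∈ im k (segs e) → x ∈ im k' (segs f) → x = vt w) ∨
  ((∀ w, isEnd k e w → isEnd k' f w → False) ∧
    ((∀ x, x ∈ im k (segs e) → x ∈ im k' (segs f) → False) ∨
      (k = k' ∧ bad e f = true ∧ (im k (segs e) ∩ im k' (segs f)).Subsingleton)))

theorem chk_sound {d : ℕ} {e f : LE} (he : e.1 ≠ e.2.1) (hf : f.1 ≠ f.2.1)
    (h : chk d e f = true) (k : ℕ) : Rel k e (k + d) f := by
  unfold chk at h
  simp only [] at h
  have him := im_scl k d (segs f)
  split_ifs at h with h1 h2 h3 h4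
  · simp only [Bool.and_eq_true, decide_eq_true_eq] at h
    refine Or.inl ⟨16 * k + e.1, Or.inl rfl, Or.inl (by omega), ?_, ?_⟩
    · unfold isEnd; intro w'; omega
    · intro x hx hx'
      rw [vt_eq]; exact allT_only h.2 k hx (him ▸ hx')
  · simp only [Bool.and_eq_true, decide_eq_true_eq] at h
    refine Or.inl ⟨16 * k + e.1, Or.inl rfl, Or.inr (by omega), ?_, ?_⟩
    · unfold isEnd; intro w'; omega
    · intro x hx hx'
      rw [vt_eq]; exact allT_only h.2 k hx (him ▸ hx')
  · refine Or.inl ⟨16 * k + e.2.1, Or.inr rfl, Or.inl (by omega), ?_, ?_⟩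
    · unfold isEnd; intro w'; omega
    · intro x hx hx'
      rw [vt_eq]; exact allT_only h k hx (him ▸ hx')
  · refine Or.inl ⟨16 * k + e.2.1, Or.inr rfl, Or.inr (by omega), ?_, ?_⟩
    · unfold isEnd; intro w'; omega
    · intro x hx hx'
      rw [vt_eq]; exact allT_only h k hx (him ▸ hx')
  · refine Or.inr ⟨?_, ?_⟩
    · unfold isEnd; intro w'; omega
    · by_cases hd : allT (segs e) (sclS d (segs f)) disjT = true
      · exact Or.inl fun x hx hx' => allT_disj hd k hx (him ▸ hx')
      · simp only [Bool.or_eq_true, hd, Bool.and_eq_true, decide_eq_true_eq] at h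
        obtain ⟨h0, hcr⟩ : d = 0 ∧ crossT (segs e) (segs f) = true := by simpa using h
        subst h0
        have hs0 : im k (sclS 0 (segs f)) = im k (segs f) := him
        by_cases hd' : allT (segs e) (segs f) disjT = true
        · exact Or.inl fun x hx hx' => allT_disj hd' k hx hx'
        · refine Or.inr ⟨rfl, ?_, crossT_sound hcr k⟩
          simp only [bad, noShare, Bool.and_eq_true, decide_eq_true_eq, Bool.not_eq_true']
          refine ⟨⟨⟨⟨?_, ?_⟩, ?_⟩, ?_⟩, by simpa using hd'⟩ <;> omega

theorem far_sound {e f : LE} (he : e ∈ eLow) (hf : f ∈ eUp) (k j : ℕ) (x : ℝ × ℝ)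
    (hx : x ∈ im k (segs e)) (hx' : x ∈ im (k + 2 + j) (segs f)) : False := by
  have h1 := List.all_eq_true.1 cLow e he
  simp only [Bool.and_eq_true, decide_eq_true_eq] at h1
  obtain ⟨⟨⟨h1, h2⟩, h3⟩, -⟩ := h1
  have h4 := List.all_eq_true.1 cfar f hf
  obtain ⟨t, ht, hxt⟩ := hx'
  have h5 := List.all_eq_true.1 h4 t ht
  simp only [List.any_eq_true, Bool.and_eq_true, decide_eq_true_eq, List.all_eq_true,
    List.mem_range] at h5
  obtain ⟨l, -, ⟨p1, p2⟩, h5⟩ := h5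
  obtain ⟨s, hs, hxs⟩ := hx
  have hse : s = (pos e.1, pos e.2.1) := by
    simp only [segs, h1, List.mem_singleton] at hs; exact hs
  subst hse
  have h6 : (0 : ℝ) < 6 ^ k := by positivity
  have hj : (1 : ℝ) ≤ 6 ^ j := one_le_pow₀ (by norm_num)
  have key : ∀ {a b : ℤ}, 0 < b → a < 36 * b → (6 : ℝ) ^ k * a < 6 ^ (k + 2 + j) * b := by
    intro a b hb hab
    have hb' : (0 : ℝ) < b := by exact_mod_cast hb
    have hab' : (a : ℝ) < 36 * b := by exact_mod_cast hab
    calc (6 : ℝ) ^ k * a < 6 ^ k * (36 * b) := mul_lt_mul_of_pos_left hab' h6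
      _ = 6 ^ k * (36 * b) * 1 := by ring
      _ ≤ 6 ^ k * (36 * b) * 6 ^ j := mul_le_mul_of_nonneg_left hj (by positivity)
      _ = 6 ^ (k + 2 + j) * b := by rw [pow_add, pow_add]; ring
  have e1 := L_lt hxs (l := l) _ (key p1 (h5 _ h2).1) (key p1 (h5 _ h3).1)
  have e2 := L_lt hxs (l := l) _ (key p2 (h5 _ h2).2) (key p2 (h5 _ h3).2)
  exact lt_irrefl _ (L_gt hxt _ e1 e2)

def valid (K k : ℕ) (e : LE) : Prop :=
  (k < K ∧ e ∈ eB) ∨ (k = 0 ∧ e ∈ eBot) ∨ (k = K ∧ e ∈ eTop)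

theorem Rel.swapped {k : ℕ} {e : LE} {k' : ℕ} {f : LE} (hk : k < k') (h : Rel k e k' f) :
    Rel k' f k e := by
  rcases h with ⟨w, h1, h2, h3, h4⟩ | ⟨h1, h2⟩
  · exact Or.inl ⟨w, h2, h1, fun w' a b => h3 w' b a, fun x a b => h4 x b a⟩
  · refine Or.inr ⟨fun w a b => h1 w b a, Or.inl ?_⟩
    rcases h2 with h2 | ⟨h2, -⟩
    · exact fun x a b => h2 x b a
    · omega

theorem valid_low {K k : ℕ} {e : LE} (h : valid K k e) (hk : k < K) : e ∈ eLow := by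
  simp only [eLow, List.mem_append]
  rcases h with h | h | h
  · exact Or.inl h.2
  · exact Or.inr h.2
  · omega

theorem valid_top {K k : ℕ} {e : LE} (hK : 1 ≤ K) (h : valid K k e) (hk : K ≤ k) :
    k = K ∧ e ∈ eTop := by
  rcases h with h | h | h
  · omega
  · omega
  · exact h

theorem valid_up {K k : ℕ} {e : LE} (h : valid K k e) (hk : 0 < k) : e ∈ eUp := by
  simp only [eUp, List.mem_append]
  rcases h with h | h | h
  · exact Or.inl h.2
  · omega
  · exact Or.inr h.2

theorem valid_ne {K k : ℕ} {e : LE} (hK : 1 ≤ K) (h : valid K k e) : pos e.1 ≠ pos e.2.1 := by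
  by_cases hk : k < K
  · have h1 := List.all_eq_true.1 cLow e (valid_low h hk)
    simp only [Bool.and_eq_true, decide_eq_true_eq] at h1
    exact h1.2
  · have h1 := List.all_eq_true.1 cTop e (valid_top hK h (not_lt.1 hk)).2
    simp only [Bool.and_eq_true, decide_eq_true_eq] at h1
    exact h1.2

theorem valid_ne' {K k : ℕ} {e : LE} (hK : 1 ≤ K) (h : valid K k e) : e.1 ≠ e.2.1 :=
  fun h' => valid_ne hK h (by rw [h'])

theorem master_le {K k k' : ℕ} {e f : LE} (hK : 1 ≤ K) (he : valid K k e) (hf : valid K k' f)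
    (hne : (k, e) ≠ (k', f)) (hle : k ≤ k') : Rel k e k' f := by
  have e1 := valid_ne' hK he
  have f1 := valid_ne' hK hf
  obtain ⟨d, rfl⟩ := Nat.exists_eq_add_of_le hle
  match d, hle, hf, hne with
  | 0, _, hf, hne =>
    have hne' : e ≠ f := fun h => hne (by rw [h]; rfl)
    by_cases hk : k < K
    · have := List.all_eq_true.1 (List.all_eq_true.1 c00 e (valid_low he hk)) f
        (valid_low hf hk)
      simp only [Bool.or_eq_true, decide_eq_true_eq, hne', false_or] at this
      exact chk_sound e1 f1 this k
    · have hk := not_lt.1 hk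
      have := List.all_eq_true.1 (List.all_eq_true.1 cTT e (valid_top hK he hk).2) f
        (valid_top hK hf hk).2
      simp only [Bool.or_eq_true, decide_eq_true_eq, hne', false_or] at this
      exact chk_sound e1 f1 this k
  | 1, _, hf, hne =>
    have hk : k < K := by
      rcases hf with h | h | h <;> omega
    have := List.all_eq_true.1 (List.all_eq_true.1 c01 e (valid_low he hk)) f
        (valid_up hf (by omega))
    exact chk_sound e1 f1 this k
  | d + 2, _, hf, hne =>
    have hk : k < K := by
      rcases hf with h | h | h <;> omega
    have he' := valid_low he hk
    have h1 := List.all_eq_true.1 cLow e he'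
    simp only [Bool.and_eq_true, decide_eq_true_eq] at h1
    refine Or.inr ⟨?_, Or.inl ?_⟩
    · unfold isEnd; intro w; omega
    · intro x hx hx'
      refine far_sound he' (valid_up hf (by omega)) k d x hx ?_
      rwa [show k + 2 + d = k + (d + 2) by ring]

theorem master {K k k' : ℕ} {e f : LE} (hK : 1 ≤ K) (he : valid K k e) (hf : valid K k' f)
    (hne : (k, e) ≠ (k', f)) : Rel k e k' f := by
  rcases le_or_gt k k' with h | h
  · exact master_le hK he hf hne h
  · exact (master_le hK hf he hne.symm h.le).swapped h

/-- The arc of a local edge placed in block `k`. -/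
noncomputable def arcF (k : ℕ) (e : LE) (t : ℝ) : ℝ × ℝ :=
  match e.2.2 with
  | 0 => (1 - t) • R k (pos e.1) + t • R k (pos e.2.1)
  | 1 => (6 ^ k * (3 - 4 * t), 6 ^ k * min (16 / 3 * t) (13 - 12 * t))
  | _ => (-(6 ^ k * (3 - 4 * t)), -(6 ^ k * min (16 / 3 * t) (13 - 12 * t)))

theorem valid_shape {K k : ℕ} {e : LE} (hK : 1 ≤ K) (h : valid K k e) :
    e.2.2 = 0 ∨ e = (0, 3, 1) ∨ e = (4, 7, 2) := by
  by_cases hk : k < K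
  · have h1 := List.all_eq_true.1 cLow e (valid_low h hk)
    simp only [Bool.and_eq_true, decide_eq_true_eq] at h1
    exact Or.inl h1.1.1.1
  · have h1 := List.all_eq_true.1 cshape e (valid_top hK h (not_lt.1 hk)).2
    simp only [Bool.or_eq_true, decide_eq_true_eq] at h1
    tauto

theorem arcF_cont (k : ℕ) (e : LE) : Continuous (arcF k e) := by
  unfold arcF
  split <;> fun_prop

theorem arcF_zero (k : ℕ) {e : LE} (h : e.2.2 = 0) :
    arcF k e = fun t => (1 - t) • R k (pos e.1) + t • R k (pos e.2.1) := by
  funext t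
  simp only [arcF, h]

theorem arcF_inj {K k : ℕ} {e : LE} (hK : 1 ≤ K) (h : valid K k e) :
    Function.Injective (arcF k e) := by
  have h6 : (6 : ℝ) ^ k ≠ 0 := by positivity
  rcases valid_shape hK h with h0 | rfl | rfl
  · have hne : R k (pos e.1) ≠ R k (pos e.2.1) := fun h' => valid_ne hK h (R_inj h')
    rw [arcF_zero k h0]
    intro s t hst
    have h1 : (s - t) • (R k (pos e.2.1) - R k (pos e.1)) = 0 := by
      simp only at hst
      have := sub_eq_zero.2 hst
      rw [← this]; module
    rcases smul_eq_zero.1 h1 with h1 | h1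
    · linarith
    · exact (hne (sub_eq_zero.1 h1).symm).elim
  · intro s t hst
    have h1 : (6 : ℝ) ^ k * (3 - 4 * s) = 6 ^ k * (3 - 4 * t) := congrArg Prod.fst hst
    have := mul_left_cancel₀ h6 h1
    linarith
  · intro s t hst
    have h1 : -((6 : ℝ) ^ k * (3 - 4 * s)) = -(6 ^ k * (3 - 4 * t)) := congrArg Prod.fst hst
    have := mul_left_cancel₀ h6 (neg_injective h1)
    linarith

theorem arcF_0 {K k : ℕ} {e : LE} (hK : 1 ≤ K) (h : valid K k e) :
    arcF k e 0 = vt (16 * k + e.1) := by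
  rw [vt_eq]
  rcases valid_shape hK h with h0 | rfl | rfl
  · rw [arcF_zero k h0]; simp
  · simp [arcF, R, pos, scl, base]
  · simp [arcF, R, pos, scl, base]

theorem arcF_1 {K k : ℕ} {e : LE} (hK : 1 ≤ K) (h : valid K k e) :
    arcF k e 1 = vt (16 * k + e.2.1) := by
  rw [vt_eq]
  have hm : min ((16 : ℝ) / 3 * 1) (13 - 12 * 1) = 1 := by norm_num
  rcases valid_shape hK h with h0 | rfl | rfl
  · rw [arcF_zero k h0]; simp
  · simp only [arcF, R, pos, scl, base, hm]; norm_num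
  · simp only [arcF, R, pos, scl, base, hm]; norm_num

theorem arcF_im {K k : ℕ} {e : LE} (hK : 1 ≤ K) (h : valid K k e) {t : ℝ}
    (ht : t ∈ Set.Icc (0 : ℝ) 1) : arcF k e t ∈ im k (segs e) := by
  obtain ⟨t0, t1⟩ := ht
  rcases valid_shape hK h with h0 | rfl | rfl
  · rw [arcF_zero k h0]
    refine ⟨(pos e.1, pos e.2.1), by simp [segs, h0], ?_⟩
    exact ⟨1 - t, t, by linarith, t0, by ring, rfl⟩
  · rcases le_total t (3 / 4) with h3 | h3
    · refine ⟨((3, 0), (0, 4)), by simp [segs], 1 - 4 / 3 * t, 4 / 3 * t, by linarith,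
        by linarith, by ring, ?_⟩
      have hm : min ((16 : ℝ) / 3 * t) (13 - 12 * t) = 16 / 3 * t := min_eq_left (by linarith)
      simp only [arcF, R, hm]
      ext <;> simp <;> ring
    · refine ⟨((0, 4), (-1, 1)), by simp [segs], 4 - 4 * t, 4 * t - 3, by linarith,
        by linarith, by ring, ?_⟩
      have hm : min ((16 : ℝ) / 3 * t) (13 - 12 * t) = 13 - 12 * t := min_eq_right (by linarith)
      simp only [arcF, R, hm]
      ext <;> simp <;> ring
  · rcases le_total t (3 / 4) with h3 | h3
    · refine ⟨((-3, 0), (0, -4)), by simp [segs], 1 - 4 / 3 * t, 4 / 3 * t, by linarith,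
        by linarith, by ring, ?_⟩
      have hm : min ((16 : ℝ) / 3 * t) (13 - 12 * t) = 16 / 3 * t := min_eq_left (by linarith)
      simp only [arcF, R, hm]
      ext <;> simp <;> ring
    · refine ⟨((0, -4), (1, -1)), by simp [segs], 4 - 4 * t, 4 * t - 3, by linarith,
        by linarith, by ring, ?_⟩
      have hm : min ((16 : ℝ) / 3 * t) (13 - 12 * t) = 13 - 12 * t := min_eq_right (by linarith)
      simp only [arcF, R, hm]
      ext <;> simp <;> ring

/-- Every vertex lies on an uncrossed edge. -/
theorem cover {K v : ℕ} (hK : 1 ≤ K) (hv : v < 16 * K + 8) :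
    ∃ k e, valid K k e ∧ isEnd k e v ∧ ∀ k' f, valid K k' f → (k, e) ≠ (k', f) →
      ∀ x, x ∈ im k (segs e) → x ∈ im k' (segs f) →
        ∃ w, isEnd k e w ∧ isEnd k' f w ∧ x = vt w := by
  have main : ∀ k e, valid K k e → (∀ f, valid K k f → bad e f = false) →
      ∀ k' f, valid K k' f → (k, e) ≠ (k', f) →
      ∀ x, x ∈ im k (segs e) → x ∈ im k' (segs f) →
        ∃ w, isEnd k e w ∧ isEnd k' f w ∧ x = vt w := by
    intro k e he hb k' f hf hne x hx hx'
    rcases master hK he hf hne with ⟨w, h1, h2, -, h4⟩ | ⟨-, h | ⟨rfl, h, -⟩⟩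
    · exact ⟨w, h1, h2, h4 x hx hx'⟩
    · exact (h x hx hx').elim
    · rw [hb f hf] at h; simp at h
  by_cases hk : v / 16 < K
  · have h1 := List.all_eq_true.1 ccov (v % 16) (List.mem_range.2 (Nat.mod_lt _ (by norm_num)))
    simp only [List.any_eq_true, Bool.or_eq_true, decide_eq_true_eq] at h1
    obtain ⟨e, he, h1⟩ := h1
    have hval : valid K (v / 16) e := Or.inl ⟨hk, by simp [eB, he]⟩
    refine ⟨v / 16, e, hval, by unfold isEnd; omega, main _ _ hval ?_⟩
    intro f hf
    have := List.all_eq_true.1 (List.all_eq_true.1 cH e he) f (valid_low hf hk)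
    simpa using this
  · have h1 := List.all_eq_true.1 ccovT (v % 16) (List.mem_range.2 (by omega))
    simp only [List.any_eq_true, Bool.or_eq_true, decide_eq_true_eq] at h1
    obtain ⟨e, he, h1⟩ := h1
    have hval : valid K (v / 16) e := Or.inr (Or.inr ⟨by omega, by simp [eTop, he]⟩)
    refine ⟨v / 16, e, hval, by unfold isEnd; omega, main _ _ hval ?_⟩
    intro f hf
    have := List.all_eq_true.1 (List.all_eq_true.1 cTH e he) f (valid_top hK hf (not_lt.1 hk)).2
    simpa using this

theorem vt_mem {K k w : ℕ} {e : LE} (hK : 1 ≤ K) (h : valid K k e) (hw : isEnd k e w) :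
    vt w ∈ im k (segs e) := by
  rcases hw with rfl | rfl
  · rw [← arcF_0 hK h]; exact arcF_im hK h (by simp)
  · rw [← arcF_1 hK h]; exact arcF_im hK h (by simp)

theorem vt_on {K k v : ℕ} {e : LE} (hK : 1 ≤ K) (he : valid K k e) (hv : v < 16 * K + 8)
    (hvt : ∀ w, w < 16 * K + 8 → vt w = vt v → w = v)
    (hx : vt v ∈ im k (segs e)) (hb : ∀ w, isEnd k e w → w < 16 * K + 8) : isEnd k e v := by
  obtain ⟨k', f, hf, hvf, hc⟩ := cover hK hv
  by_cases hne : (k', f) = (k, e)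
  · obtain ⟨rfl, rfl⟩ := Prod.mk.inj hne; exact hvf
  · obtain ⟨w, h1, h2, h3⟩ := hc k e he hne _ (vt_mem hK hf hvf) hx
    rw [hvt w (hb w h2) h3.symm] at h2; exact h2

theorem vt_inj {K v w : ℕ} (hK : 1 ≤ K) (hv : v < 16 * K + 8) (hw : w < 16 * K + 8)
    (h : vt v = vt w) : v = w := by
  obtain ⟨k, e, he, hve, hc⟩ := cover hK hv
  obtain ⟨k', f, hf, hwf, hc'⟩ := cover hK hw
  have same : ∀ k e a b, valid K k e → isEnd k e a → isEnd k e b → vt a = vt b → a = b := by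
    intro k e a b he ha hb hab
    have hne := valid_ne hK he
    rcases ha with rfl | rfl <;> rcases hb with rfl | rfl
    · rfl
    · rw [vt_eq, vt_eq] at hab; exact (hne (R_inj hab)).elim
    · rw [vt_eq, vt_eq] at hab; exact (hne (R_inj hab).symm).elim
    · rfl
  by_cases hne : (k, e) = (k', f)
  · obtain ⟨rfl, rfl⟩ := Prod.mk.inj hne
    exact same _ _ _ _ he hve hwf h
  · obtain ⟨u, h1, h2, h3⟩ := hc k' f hf hne _ (vt_mem hK he hve) (h ▸ vt_mem hK hf hwf)
    have e1 := same _ _ _ _ he hve h1 h3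
    have e2 := same _ _ _ _ hf hwf h2 (h ▸ h3)
    rw [e1, e2]

theorem end_lt {K k w : ℕ} {e : LE} (hK : 1 ≤ K) (h : valid K k e) (hw : isEnd k e w) :
    w < 16 * K + 8 := by
  unfold isEnd at hw
  by_cases hk : k < K
  · have h1 := List.all_eq_true.1 cLow e (valid_low h hk)
    simp only [Bool.and_eq_true, decide_eq_true_eq] at h1
    omega
  · obtain ⟨hk, h2⟩ := valid_top hK h (not_lt.1 hk)
    have h1 := List.all_eq_true.1 cTop e h2
    simp only [Bool.and_eq_true, decide_eq_true_eq] at h1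
    omega

def vx (K m : ℕ) : Fin (16 * K + 8) := ⟨m % (16 * K + 8), Nat.mod_lt _ (by omega)⟩

def ed (K : ℕ) (p : ℕ × LE) : Sym2 (Fin (16 * K + 8)) :=
  s(vx K (16 * p.1 + p.2.1), vx K (16 * p.1 + p.2.2.1))

theorem mem_ed {K k : ℕ} {e : LE} (hK : 1 ≤ K) (h : valid K k e) (w : Fin (16 * K + 8)) :
    w ∈ ed K (k, e) ↔ isEnd k e w := by
  have h1 := Nat.mod_eq_of_lt (end_lt hK h (Or.inl rfl))
  have h2 := Nat.mod_eq_of_lt (end_lt hK h (Or.inr rfl))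
  simp only [ed, Sym2.mem_iff, vx, isEnd, Fin.ext_iff, h1, h2]

theorem ed_inj {K : ℕ} (hK : 1 ≤ K) {p q : ℕ × LE} (hp : valid K p.1 p.2) (hq : valid K q.1 q.2)
    (h : ed K p = ed K q) : p = q := by
  by_contra hne
  obtain ⟨k, e⟩ := p
  obtain ⟨k', f⟩ := q
  have hiff : ∀ w, isEnd k e w → isEnd k' f w := by
    intro w hw
    have hl := end_lt hK hp hw
    have := (mem_ed hK hp ⟨w, hl⟩).2 hw
    rw [h] at this
    exact (mem_ed hK hq ⟨w, hl⟩).1 this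
  have i1 := hiff _ (Or.inl rfl)
  have i2 := hiff _ (Or.inr rfl)
  rcases master hK hp hq hne with ⟨w, -, -, h3, -⟩ | ⟨h1, -⟩
  · have := h3 _ (Or.inl rfl) i1
    have := h3 _ (Or.inr rfl) i2
    have := valid_ne' hK hp
    simp only at *
    omega
  · exact h1 _ (Or.inl rfl) i1

def idx (K : ℕ) : Finset (ℕ × LE) :=
  (Finset.range K ×ˢ eB.toFinset) ∪ ({0} ×ˢ eBot.toFinset) ∪ ({K} ×ˢ eTop.toFinset)

theorem mem_idx {K : ℕ} {p : ℕ × LE} : p ∈ idx K ↔ valid K p.1 p.2 := by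
  simp only [idx, Finset.mem_union, Finset.mem_product, Finset.mem_range, Finset.mem_singleton,
    List.mem_toFinset, valid, or_assoc]

theorem card_idx {K : ℕ} (hK : 1 ≤ K) : (idx K).card = 56 * K + 16 := by
  unfold idx
  rw [Finset.card_union_of_disjoint, Finset.card_union_of_disjoint, Finset.card_product,
    Finset.card_product, Finset.card_product, List.toFinset_card_of_nodup cnodB,
    List.toFinset_card_of_nodup cnodBot, List.toFinset_card_of_nodup cnodT]
  · simp [eB, eH, eR, eBot, eTop, eTH, eTR]; ring
  · rw [Finset.disjoint_left]
    rintro ⟨k, e⟩ h1 h2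
    simp only [Finset.mem_product, List.mem_toFinset] at h1 h2
    have := List.all_eq_true.1 cdjB e h1.2
    simp [h2.2] at this
  · rw [Finset.disjoint_left]
    rintro ⟨k, e⟩ h1 h2
    simp only [Finset.mem_product, List.mem_toFinset, Finset.mem_union, Finset.mem_range,
      Finset.mem_singleton] at h1 h2
    omega

def Gr (K : ℕ) : SimpleGraph (Fin (16 * K + 8)) :=
  SimpleGraph.fromEdgeSet (ed K '' (idx K : Set (ℕ × LE)))

theorem Gr_edgeSet {K : ℕ} (hK : 1 ≤ K) : (Gr K).edgeSet = ed K '' (idx K : Set (ℕ × LE)) := by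
  rw [Gr, SimpleGraph.edgeSet_fromEdgeSet]
  refine sdiff_eq_left.2 (Set.disjoint_left.2 ?_)
  rintro _ ⟨⟨k, e⟩, h, rfl⟩ hd
  have h := mem_idx.1 (Finset.mem_coe.1 h)
  have h1 := Nat.mod_eq_of_lt (end_lt hK h (Or.inl rfl))
  have h2 := Nat.mod_eq_of_lt (end_lt hK h (Or.inr rfl))
  have h3 := valid_ne' hK h
  have h4 : vx K (16 * k + e.1) = vx K (16 * k + e.2.1) := by simpa [ed] using hd
  simp only [vx, Fin.ext_iff] at h4
  simp only at h1 h2 h3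
  omega

theorem Gr_card {K : ℕ} (hK : 1 ≤ K) : (Gr K).edgeSet.ncard = 56 * K + 16 := by
  rw [Gr_edgeSet hK, Set.InjOn.ncard_image, Set.ncard_coe_finset, card_idx hK]
  intro p hp q hq h
  exact ed_inj hK (mem_idx.1 hp) (mem_idx.1 hq) h

theorem Gr_ix {K : ℕ} (hK : 1 ≤ K) (x : (Gr K).edgeSet) :
    ∃ p : ℕ × LE, valid K p.1 p.2 ∧ ed K p = x := by
  obtain ⟨p, hp, h⟩ := (Set.ext_iff.1 (Gr_edgeSet hK) _).1 x.2
  exact ⟨p, mem_idx.1 hp, h⟩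

theorem Gr_bip {K : ℕ} (hK : 1 ≤ K) : IsBipartite (Gr K) := by
  refine ⟨fun v => colr (v.val % 16), ?_⟩
  intro u v huv
  obtain ⟨⟨k, e⟩, hp, h⟩ := Gr_ix hK ⟨s(u, v), huv⟩
  have hp : valid K k e := hp
  have hc : colr e.1 ≠ colr e.2.1 := by
    have hm : e ∈ eLow ++ eTop := by
      simp only [eLow, List.mem_append]
      rcases hp with h | h | h <;> tauto
    have := List.all_eq_true.1 ccol e hm
    simpa only [decide_eq_true_eq] using this
  have hcol : ∀ a, colr ((16 * k + a) % 16) = colr a := by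
    intro a
    unfold colr
    congr 2
    · congr 1; omega
    · congr 1; omega
  have h1 := Nat.mod_eq_of_lt (end_lt hK hp (Or.inl rfl))
  have h2 := Nat.mod_eq_of_lt (end_lt hK hp (Or.inr rfl))
  have h' : s(vx K (16 * k + e.1), vx K (16 * k + e.2.1)) = s(u, v) := h
  rw [Sym2.eq_iff] at h'
  rcases h' with ⟨rfl, rfl⟩ | ⟨rfl, rfl⟩
  · simp only [vx, h1, h2, hcol]; exact hc
  · simp only [vx, h1, h2, hcol]; exact hc.symm

theorem Gr_planar {K : ℕ} (hK : 1 ≤ K) : IsTwoPlanar (Gr K) := by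
  choose ix hval hix using Gr_ix hK
  have ixinj : ∀ x y, ix x = ix y → x = y := fun x y h =>
    Subtype.ext (by rw [← hix x, ← hix y, h])
  have hmem : ∀ (x : (Gr K).edgeSet) (w : Fin (16 * K + 8)),
      w ∈ (x : Sym2 (Fin (16 * K + 8))) ↔ isEnd (ix x).1 (ix x).2 w := by
    intro x w
    rw [← hix x]
    exact mem_ed hK (hval x) w
  have hsub : ∀ (x : (Gr K).edgeSet) p,
      p ∈ arcF (ix x).1 (ix x).2 '' Set.Icc (0 : ℝ) 1 → p ∈ im (ix x).1 (segs (ix x).2) := by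
    rintro x _ ⟨t, ht, rfl⟩
    exact arcF_im hK (hval x) ht
  have hrel : ∀ x y, x ≠ y → Rel (ix x).1 (ix x).2 (ix y).1 (ix y).2 := fun x y h =>
    master hK (hval x) (hval y) fun h' => h (ixinj x y h')
  let D : Drawing (Gr K) :=
    { vert := fun v => vt v
      vert_inj := fun v w h => Fin.ext (vt_inj hK v.2 w.2 h)
      arc := fun x => arcF (ix x).1 (ix x).2
      arc_cont := fun x => (arcF_cont _ _).continuousOn
      arc_inj := fun x => (arcF_inj hK (hval x)).injOn
      arc_ends := by
        intro x u v h
        have h1 := Nat.mod_eq_of_lt (end_lt hK (hval x) (Or.inl rfl))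
        have h2 := Nat.mod_eq_of_lt (end_lt hK (hval x) (Or.inr rfl))
        rw [← hix x, ed, Sym2.eq_iff] at h
        simp only [arcF_0 hK (hval x), arcF_1 hK (hval x)]
        rcases h with ⟨rfl, rfl⟩ | ⟨rfl, rfl⟩
        · simp only [vx, h1, h2]
        · simp only [vx, h1, h2]; exact Set.pair_comm _ _
      arc_vertex := by
        intro x t ht w h
        rw [hmem]
        refine vt_on hK (hval x) w.2 (fun u hu hh => vt_inj hK hu w.2 hh) ?_
          (fun u hu => end_lt hK (hval x) hu)
        rw [← h]
        exact arcF_im hK (hval x) ht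
      adj_meet := by
        rintro x y hne ⟨w, hw1, hw2⟩ p hp hp'
        rcases hrel x y hne with ⟨u, h1, h2, -, h4⟩ | ⟨h1, -⟩
        · exact ⟨⟨u, end_lt hK (hval x) h1⟩, (hmem x _).2 h1, (hmem y _).2 h2,
            h4 p (hsub x p hp) (hsub y p hp')⟩
        · exact (h1 w ((hmem x w).1 hw1) ((hmem y w).1 hw2)).elim
      nonadj_meet := by
        intro x y hno
        have hne : x ≠ y := by
          rintro rfl
          exact hno ⟨⟨_, end_lt hK (hval x) (Or.inl rfl)⟩, (hmem x _).2 (Or.inl rfl),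
            (hmem x _).2 (Or.inl rfl)⟩
        rintro p ⟨hp, hp'⟩ q ⟨hq, hq'⟩
        rcases hrel x y hne with ⟨u, h1, h2, -, -⟩ | ⟨-, h2 | ⟨-, -, h2⟩⟩
        · exact (hno ⟨⟨u, end_lt hK (hval x) h1⟩, (hmem x _).2 h1, (hmem y _).2 h2⟩).elim
        · exact (h2 p (hsub x p hp) (hsub y p hp')).elim
        · exact h2 ⟨hsub x p hp, hsub y p hp'⟩ ⟨hsub x q hq, hsub y q hq'⟩ }
  refine ⟨D, ?_⟩
  intro x
  have hcross : ∀ y, D.Crosses x y → (ix x).1 = (ix y).1 ∧ bad (ix x).2 (ix y).2 = true := by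
    rintro y ⟨hne, p, ⟨hp, hp'⟩, hv⟩
    rcases hrel x y hne with ⟨u, h1, h2, -, h4⟩ | ⟨-, h2 | ⟨h1, h2, -⟩⟩
    · exact (hv ⟨u, end_lt hK (hval x) h1⟩ (h4 p (hsub x p hp) (hsub y p hp')).symm).elim
    · exact (h2 p (hsub x p hp) (hsub y p hp')).elim
    · exact ⟨h1, h2⟩
  obtain ⟨l, hl, hl2⟩ : ∃ l : List LE, (∀ f, valid K (ix x).1 f → f ∈ l) ∧
      (l.filter (bad (ix x).2)).length ≤ 2 := by
    by_cases hk : (ix x).1 < K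
    · refine ⟨eLow, fun f hf => valid_low hf hk, ?_⟩
      have := List.all_eq_true.1 cbad _ (valid_low (hval x) hk)
      simpa only [decide_eq_true_eq] using this
    · have hk := not_lt.1 hk
      refine ⟨eTop, fun f hf => (valid_top hK hf hk).2, ?_⟩
      have := List.all_eq_true.1 cbadT _ (valid_top hK (hval x) hk).2
      simpa only [decide_eq_true_eq] using this
  calc {y | D.Crosses x y}.ncard
      ≤ (((l.filter (bad (ix x).2)).toFinset : Finset LE) : Set LE).ncard := by
        refine Set.ncard_le_ncard_of_injOn (fun y => (ix y).2) ?_ ?_ (Finset.finite_toSet _)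
        · intro y hy
          obtain ⟨h1, h2⟩ := hcross y hy
          have := hl (ix y).2 (h1 ▸ hval y)
          simp [this, h2]
        · intro y hy z hz h
          refine ixinj y z (Prod.ext ?_ h)
          rw [← (hcross y hy).1, ← (hcross z hz).1]
    _ ≤ 2 := by
        rw [Set.ncard_coe_finset]
        exact (List.toFinset_card_le _).trans hl2

end TwoPl

/-- For infinitely many values of `n`, there exists a bipartite
2-planar simple graph with `n` vertices and exactly `3.5 n - 12` edges. -/
theorem bipartite_twoplanar_simple_density_lower_bound :
    ∀ N : ℕ, ∃ n : ℕ, N ≤ n ∧ ∃ G : SimpleGraph (Fin n),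
      IsBipartite G ∧ IsTwoPlanar G ∧
      (G.edgeSet.ncard : ℝ) = 3.5 * n - 12 := by
  intro N
  have hK : 1 ≤ N + 1 := by omega
  refine ⟨16 * (N + 1) + 8, by omega, TwoPl.Gr (N + 1), TwoPl.Gr_bip hK, TwoPl.Gr_planar hK, ?_⟩
  rw [TwoPl.Gr_card hK]
  push_cast
  ring
end
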